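/- arXiv:1805.06979 — 5 statements merged into one kernel-verified Lean document; each statement's English description precedes it below -/
import Mathlib

section
/- For a latin square L of order n, χ(L) = n if and only if L possesses an orthogonal mate. -/
/-- Exactly one of three propositions holds. -/
def ExactlyOne (p q r : Prop) : Prop :=
  (p ∧ ¬q ∧ ¬r) ∨ (¬p ∧ q ∧ ¬r) ∨ (¬p ∧ ¬q ∧ r)

/-- `L` is a latin square of order `n`: each row and each column is a bijection. -/
def IsLatinSquare {n : ℕ} (L : Fin n → Fin n → Fin n) : Prop :=
  (∀ r, Function.Bijective fun c => L r c) ∧ (∀ c, Function.Bijective fun r => L r c)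

/-- The latin square graph: distinct cells are adjacent iff exactly one of
same row, same column, same symbol holds. -/
def latinSquareGraph {n : ℕ} (L : Fin n → Fin n → Fin n) : SimpleGraph (Fin n × Fin n) :=
  SimpleGraph.fromRel fun p q =>
    ExactlyOne (p.1 = q.1) (p.2 = q.2) (L p.1 p.2 = L q.1 q.2)

theorem latin_adj_iff {n : ℕ} (L : Fin n → Fin n → Fin n) (hL : IsLatinSquare L)
    (p q : Fin n × Fin n) : (latinSquareGraph L).Adj p q ↔
      p ≠ q ∧ (p.1 = q.1 ∨ p.2 = q.2 ∨ L p.1 p.2 = L q.1 q.2) := by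
  obtain ⟨a, b⟩ := p
  obtain ⟨c, d⟩ := q
  have h1 : a = c → L a b = L c d → b = d := by
    rintro rfl h
    exact (hL.1 a).1 h
  have h2 : b = d → L a b = L c d → a = c := by
    rintro rfl h
    exact (hL.2 b).1 h
  simp only [latinSquareGraph, SimpleGraph.fromRel_adj, ExactlyOne, ne_eq, Prod.mk.injEq,
    eq_comm (a := c) (b := a), eq_comm (a := d) (b := b), eq_comm (a := L c d) (b := L a b)]
  tauto

theorem chromatic_eq_order_iff_orthogonal_mate {n : ℕ} (L : Fin n → Fin n → Fin n)
    (hL : IsLatinSquare L) :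
    (latinSquareGraph L).chromaticNumber = (n : ℕ∞) ↔
      ∃ M : Fin n → Fin n → Fin n, IsLatinSquare M ∧
        Function.Injective fun p : Fin n × Fin n => (L p.1 p.2, M p.1 p.2) := by
  constructor
  · intro h
    have hc : (latinSquareGraph L).Colorable n :=
      SimpleGraph.chromaticNumber_le_iff_colorable.1 h.le
    obtain ⟨C⟩ := hc
    have key : ∀ p q : Fin n × Fin n,
        (p.1 = q.1 ∨ p.2 = q.2 ∨ L p.1 p.2 = L q.1 q.2) → C p = C q → p = q := by
      intro p q hpq hC
      by_contra hne
      exact C.valid ((latin_adj_iff L hL p q).2 ⟨hne, hpq⟩) hC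
    refine ⟨fun r c => C (r, c), ⟨fun r => ?_, fun c => ?_⟩, ?_⟩
    · apply Finite.injective_iff_bijective.1
      intro a b hab
      exact congrArg Prod.snd (key (r, a) (r, b) (Or.inl rfl) hab)
    · apply Finite.injective_iff_bijective.1
      intro a b hab
      exact congrArg Prod.fst (key (a, c) (b, c) (Or.inr (Or.inl rfl)) hab)
    · intro p q hpq
      have h' := Prod.mk.inj hpq
      exact key p q (Or.inr (Or.inr h'.1)) h'.2
  · rintro ⟨M, hM, hi⟩
    apply le_antisymm
    · apply SimpleGraph.chromaticNumber_le_iff_colorable.2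
      refine ⟨SimpleGraph.Coloring.mk (fun p => M p.1 p.2) ?_⟩
      rintro ⟨a, b⟩ ⟨c, d⟩ hadj hEq
      obtain ⟨hne, h⟩ := (latin_adj_iff L hL _ _).1 hadj
      dsimp only at h hEq
      rcases h with rfl | rfl | h
      · exact hne (congrArg _ ((hM.1 a).1 hEq))
      · exact hne (congrArg (fun x => (x, b)) ((hM.2 b).1 hEq))
      · exact hne (hi (Prod.ext h hEq))
    · apply SimpleGraph.le_chromaticNumber_iff_colorable.2
      rintro m ⟨C⟩
      rcases Nat.eq_zero_or_pos n with rfl | hn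
      · exact Nat.zero_le _
      · have hinj : Function.Injective fun c : Fin n => C ((⟨0, hn⟩ : Fin n), c) := by
          intro a b hab
          by_contra hne
          refine C.valid ((latin_adj_iff L hL (⟨0, hn⟩, a) (⟨0, hn⟩, b)).2 ⟨?_, Or.inl rfl⟩) hab
          exact fun h => hne (congrArg Prod.snd h)
        simpa using Fintype.card_le_of_injective _ hinj
end

section
/- Let G be a finite abelian group of order n. If a Sylow 2-subgroup of G is trivial or non-cyclic, then χ(G) = n; otherwise (i.e., if the Sylow 2-subgroups of G are nontrivial and cyclic), χ(G) = n + 2. -/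
/-- The Cayley table graph of a group `G`: vertices are cells `(a, b)` of the Cayley
table, and distinct cells are adjacent iff exactly one of same row, same column,
same symbol (`a * b`) holds. -/
def cayleyGraph (G : Type*) [Group G] : SimpleGraph (G × G) :=
  SimpleGraph.fromRel fun p q =>
    ExactlyOne (p.1 = q.1) (p.2 = q.2) (p.1 * p.2 = q.1 * q.2)

universe u

/-- exchange step of Hall's theorem -/
theorem hall_step {ι A : Type*} [AddCommGroup A] [Fintype ι] [Fintype A] [DecidableEq ι]
    (d : ι → A) (hd : ∑ i, d i = 0) (i2 : ι) (w : A) :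
    ∀ (k : ℕ) (V : Finset ι) (l : ι) (α : ι ≃ A), Fintype.card ι - V.card = k → l ∈ V → i2 ∉ V →
      (∀ i j, i ≠ l → i ≠ i2 → j ≠ l → j ≠ i2 → α i + d i = α j + d j → i = j) →
      (α l + d l + α i2 = w) →
      (∀ j ∈ V, j ≠ l → ∃ s ∈ V, α j + d j + α s = w) →
      ∃ β : ι ≃ A, Function.Injective (fun i => β i + d i) := by
  intro k
  induction k with
  | zero =>
    intro V l α hk hl h2
    exfalso
    have : V.card < Fintype.card ι := by
      rw [← Finset.card_univ]
      exact Finset.card_lt_card (Finset.ssubset_univ_iff.2 (fun h => h2 (h ▸ Finset.mem_univ _)))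
    omega
  | succ k ih =>
    intro V l α hk hl h2 hinj hw hV
    have hl2 : l ≠ i2 := fun h => h2 (h ▸ hl)
    by_cases hex : ∃ k, k ≠ l ∧ k ≠ i2 ∧ α k + d k = α l + d l
    · obtain ⟨k', hkl, hk2, hke⟩ := hex
      have hkV : k' ∉ V := by
        intro hkV
        obtain ⟨s, hs, hse⟩ := hV k' hkV hkl
        rw [hke, ← hw] at hse
        have := α.injective (add_left_cancel hse)
        exact h2 (this ▸ hs)
      have hsw : ∀ i, i ≠ k' → i ≠ i2 → (Equiv.swap k' i2).trans α i = α i := by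
        intro i h1 h2
        simp [Equiv.swap_apply_of_ne_of_ne h1 h2]
      have hswk : (Equiv.swap k' i2).trans α k' = α i2 := by simp
      have hsw2 : (Equiv.swap k' i2).trans α i2 = α k' := by simp
      apply ih (insert k' V) k' ((Equiv.swap k' i2).trans α)
      · rw [Finset.card_insert_of_notMem hkV]; omega
      · simp
      · simp [h2, Ne.symm hk2]
      · intro i j hi hi2 hj hj2 h
        rw [hsw i hi hi2, hsw j hj hj2] at h
        by_cases h3 : i = l
        · by_cases h4 : j = l
          · rw [h3, h4]
          · subst h3
            rw [← hke] at h
            exact absurd (hinj _ _ hkl hk2 h4 hj2 h) (Ne.symm hj)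
        · by_cases h4 : j = l
          · subst h4
            rw [← hke] at h
            exact absurd (hinj _ _ h3 hi2 hkl hk2 h) hi
          · exact hinj _ _ h3 hi2 h4 hj2 h
      · rw [hswk, hsw2, ← hw, ← hke]; abel
      · intro j hj hjk
        rw [Finset.mem_insert] at hj
        have hjV : j ∈ V := hj.resolve_left hjk
        have hj2 : j ≠ i2 := fun h => h2 (h ▸ hjV)
        rw [hsw j hjk hj2]
        by_cases hjl : j = l
        · refine ⟨k', by simp, ?_⟩
          rw [hswk, hjl, hw]
        · obtain ⟨s, hs, hse⟩ := hV j hjV hjl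
          refine ⟨s, by simp [hs], ?_⟩
          rw [hsw s (fun h => hkV (h ▸ hs)) (fun h => h2 (h ▸ hs)), hse]
    · push Not at hex
      refine ⟨α, ?_⟩
      have hinj2 : ∀ i j, i ≠ i2 → j ≠ i2 → α i + d i = α j + d j → i = j := by
        intro i j hi hj h
        by_cases h3 : i = l
        · by_contra hne
          subst h3
          exact hex j (Ne.symm hne) hj h.symm
        · by_cases h4 : j = l
          · subst h4
            exact absurd h (hex i h3 hi)
          · exact hinj _ _ h3 hi h4 hj h
      -- the missing value
      classical
      set T : Finset A := (Finset.univ.erase i2).image (fun i => α i + d i) with hT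
      have hTc : T.card = Fintype.card A - 1 := by
        rw [hT, Finset.card_image_of_injOn, Finset.card_erase_of_mem (Finset.mem_univ _),
          Finset.card_univ, Fintype.card_congr α]
        intro i hi j hj h
        simp at hi hj
        exact hinj2 i j hi hj h
      have hpos : 0 < Fintype.card A := Fintype.card_pos_iff.2 ⟨α l⟩
      have hTc2 : Tᶜ.card = 1 := by
        rw [Finset.card_compl, hTc]; omega
      obtain ⟨u, hu⟩ := Finset.card_eq_one.1 hTc2
      have hsumT : ∑ x ∈ T, x = ∑ i ∈ Finset.univ.erase i2, (α i + d i) := by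
        rw [hT, Finset.sum_image]
        intro i hi j hj h
        simp at hi hj
        exact hinj2 i j hi hj h
      have hs1 : ∑ i, (α i + d i) = ∑ x : A, x := by
        rw [Finset.sum_add_distrib, hd, add_zero]
        exact Equiv.sum_comp α (fun x => x)
      have hs2 : ∑ x ∈ T, x + ∑ x ∈ Tᶜ, x = ∑ x : A, x := Finset.sum_add_sum_compl T _
      have hs3 := Finset.sum_erase_add Finset.univ (fun i => α i + d i) (Finset.mem_univ i2)
      rw [hu, Finset.sum_singleton, hsumT, ← hs1, ← hs3] at hs2
      have hu2 : u = α i2 + d i2 := add_left_cancel hs2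
      have huT : u ∉ T := by
        have : u ∈ Tᶜ := by rw [hu]; simp
        simpa using this
      intro i j h
      simp only at h
      by_cases hi : i = i2
      · by_cases hj : j = i2
        · rw [hi, hj]
        · exfalso; apply huT
          rw [hu2, hT, Finset.mem_image]
          exact ⟨j, by simp [hj], by rw [← hi, h]⟩
      · by_cases hj : j = i2
        · exfalso; apply huT
          rw [hu2, hT, Finset.mem_image]
          exact ⟨i, by simp [hi], by rw [← hj, h]⟩
        · exact hinj2 i j hi hj h

theorem hall_exchange {ι A : Type*} [AddCommGroup A] [Fintype ι] [Fintype A] [DecidableEq ι]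
    (d d' : ι → A) (hd : ∑ i, d' i = 0) (i1 i2 : ι) (h12 : i1 ≠ i2)
    (hdd : ∀ i, i ≠ i1 → i ≠ i2 → d i = d' i)
    (h : ∃ β : ι ≃ A, Function.Injective (fun i => β i + d i)) :
    ∃ β : ι ≃ A, Function.Injective (fun i => β i + d' i) := by
  obtain ⟨α, hα⟩ := h
  apply hall_step d' hd i2 (α i1 + d' i1 + α i2) _ {i1} i1 α rfl (by simp) (by simp [h12.symm])
  · intro i j hi hi2 hj hj2 h
    apply hα
    simp only
    rw [hdd i hi hi2, hdd j hj hj2, h]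
  · rfl
  · intro j hj hj1
    simp at hj
    exact absurd hj hj1

theorem hall_complete {A : Type*} [AddCommGroup A] [Fintype A] [DecidableEq A]
    (hs : ∑ x : A, x = 0) :
    ∃ β : A ≃ A, Function.Injective (fun i => β i + i) := by
  have key : ∀ s : Finset A, 0 ∉ s → ∃ β : A ≃ A, Function.Injective
      (fun i => β i + (if i ∈ s then i else if i = 0 then - ∑ x ∈ s, x else 0)) := by
    intro s
    induction s using Finset.induction_on with
    | empty =>
      intro _
      refine ⟨Equiv.refl _, ?_⟩
      intro i j h
      simpa using h
    | insert a s has ih =>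
      intro h0
      simp only [Finset.mem_insert, not_or] at h0
      refine hall_exchange _ _ ?_ a 0 (Ne.symm h0.1) ?_ (ih h0.2)
      · have h1 : ∀ i : A, (if i ∈ insert a s then i else if i = 0 then - ∑ x ∈ insert a s, x else 0)
            = (if i ∈ insert a s then i else 0) + (if i = 0 then - ∑ x ∈ insert a s, x else 0) := by
          intro i
          by_cases hi : i = 0
          · subst hi
            simp [h0.1, h0.2]
          · simp [hi]
        rw [Finset.sum_congr rfl (fun i _ => h1 i), Finset.sum_add_distrib, Finset.sum_ite_mem,
          Finset.sum_ite_eq']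
        simp
      · intro i hi1 hi2
        simp [hi1, hi2]
  obtain ⟨β, hβ⟩ := key (Finset.univ.erase 0) (by simp)
  refine ⟨β, ?_⟩
  have h2 : ∑ x ∈ Finset.univ.erase (0 : A), x = 0 := by
    have := Finset.sum_erase_add Finset.univ (fun x : A => x) (Finset.mem_univ 0)
    simpa [hs] using this
  convert hβ using 2 with i
  by_cases hi : i = 0
  · simp [hi, h2]
  · simp [hi]

theorem cyc_pattern (l : ℕ) (hl : 0 < l) : ∃ x y : ℕ → ℤ,
    (∀ j < l, y j - x j = 2 * j ∨ (y j - x j = 2 * j + 1 ∧ ¬ (l : ℤ) ∣ x j + 1)) ∧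
    (∀ i < l, ∀ j < l, (2 * l : ℤ) ∣ x i - x j → i = j) ∧
    (∀ i < l, ∀ j < l, (2 * l : ℤ) ∣ y i - y j → i = j) ∧
    (∀ i < l, ∀ j < l, (2 * l : ℤ) ∣ (x i + y i) - (x j + y j) → i = j) := by
  obtain ⟨N, s, hN, hs, hs3⟩ : ∃ N s : ℕ, (l = 2 * N + 1 ∧ (s = 1 ∨ s = 2) ∨
      l = 2 * N ∧ (s = 2 ∨ s = 3)) ∧ True ∧ ¬ 3 ∣ N + 2 + s := by
    rcases Nat.even_or_odd' l with ⟨N, h | h⟩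
    · by_cases h3 : 3 ∣ N + 2 + 2
      · exact ⟨N, 3, by omega, trivial, by omega⟩
      · exact ⟨N, 2, by omega, trivial, by omega⟩
    · by_cases h3 : 3 ∣ N + 2 + 1
      · exact ⟨N, 2, by omega, trivial, by omega⟩
      · exact ⟨N, 1, by omega, trivial, by omega⟩
  have small : ∀ z : ℤ, (2 * l : ℤ) ∣ z → z < 2 * (2 * l) → -(2 * (2 * l)) < z →
      z = 0 ∨ z = 2 * l ∨ z = - (2 * l) := by
    rintro z ⟨k, rfl⟩ h1 h2
    have hl' : (0 : ℤ) < 2 * l := by omega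
    have hk1 : k < 2 := by nlinarith
    have hk2 : -2 < k := by nlinarith
    interval_cases k <;> omega
  refine ⟨fun j => if j % 2 = 0 then -s - (j / 2 : ℕ) else N - 1 - (j / 2 : ℕ),
    fun j => if j % 2 = 0 then -s + 3 * (j / 2 : ℕ) else N + 2 + 3 * (j / 2 : ℕ), ?_, ?_, ?_, ?_⟩
  · intro j hj
    simp only
    by_cases h : j % 2 = 0
    · left; rw [if_pos h, if_pos h]; omega
    · right; rw [if_neg h, if_neg h]
      refine ⟨by omega, ?_⟩
      intro hd
      have := Int.le_of_dvd (by omega) hd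
      omega
  · intro i hi j hj hd
    simp only at hd
    have := small _ hd (by split_ifs <;> omega) (by split_ifs <;> omega)
    split_ifs at this <;> omega
  · intro i hi j hj hd
    simp only at hd
    have := small _ hd (by split_ifs <;> omega) (by split_ifs <;> omega)
    split_ifs at this <;> omega
  · intro i hi j hj hd
    simp only at hd
    have := small _ hd (by split_ifs <;> omega) (by split_ifs <;> omega)
    split_ifs at this <;> omega

/-- strong complete mapping on a subgroup -/
def SCmap {A : Type*} [AddCommGroup A] (X : AddSubgroup A) : Prop :=
  ∃ θ : A → A, (∀ u ∈ X, θ u ∈ X) ∧ (∀ u ∈ X, ∀ v ∈ X, θ u = θ v → u = v) ∧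
    (∀ u ∈ X, ∀ v ∈ X, θ u + u = θ v + v → u = v) ∧
    (∀ u ∈ X, ∀ v ∈ X, θ u - u = θ v - v → u = v)

theorem SCmap_ext {A : Type*} [AddCommGroup A] (N : AddSubgroup A) (Y : AddSubgroup (A ⧸ N))
    (hN : SCmap N) (hY : SCmap Y) : SCmap (Y.comap (QuotientAddGroup.mk' N)) := by
  obtain ⟨τ, t0, t1, t2, t3⟩ := hN
  obtain ⟨ψ, p0, p1, p2, p3⟩ := hY
  let mk : A →+ A ⧸ N := QuotientAddGroup.mk' N
  let rep : A ⧸ N → A := fun q => q.out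
  have hrep : ∀ q, mk (rep q) = q := fun q => QuotientAddGroup.out_eq' q
  have hmk : ∀ a, mk a = 0 ↔ a ∈ N := fun a => QuotientAddGroup.eq_zero_iff a
  have hsub : ∀ a, a - rep (mk a) ∈ N := by
    intro a
    rw [← hmk, map_sub, hrep, sub_self]
  let θ : A → A := fun u => rep (ψ (mk u)) + τ (u - rep (mk u))
  have hθ : ∀ u, mk (θ u) = ψ (mk u) := by
    intro u
    simp only [θ, map_add, hrep]
    rw [(hmk _).2 (t0 _ (hsub u)), add_zero]
  refine ⟨θ, ?_, ?_, ?_, ?_⟩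
  · intro u hu
    change mk (θ u) ∈ Y
    rw [hθ]
    exact p0 _ hu
  · intro u hu v hv h
    have h1 : mk u = mk v := p1 _ hu _ hv (by rw [← hθ, ← hθ, h])
    simp only [θ, h1] at h
    have h2 := add_left_cancel h
    have h3 := t1 _ (h1 ▸ hsub u) _ (hsub v) h2
    exact sub_left_injective h3
  · intro u hu v hv h
    have h1 : mk u = mk v := p2 _ hu _ hv (by rw [← hθ, ← hθ, ← map_add, ← map_add, h])
    simp only [θ, h1] at h
    have h3 := t2 _ (h1 ▸ hsub u) _ (hsub v) (by
      have := congrArg (fun z => z - rep (ψ (mk v)) - rep (mk v)) h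
      convert this using 1 <;> abel)
    exact sub_left_injective h3
  · intro u hu v hv h
    have h1 : mk u = mk v := p3 _ hu _ hv (by rw [← hθ, ← hθ, ← map_sub, ← map_sub, h])
    simp only [θ, h1] at h
    have h3 := t3 _ (h1 ▸ hsub u) _ (hsub v) (by
      have := congrArg (fun z => z - rep (ψ (mk v)) + rep (mk v)) h
      convert this using 1 <;> abel)
    exact sub_left_injective h3

theorem SC_mod {N : Type*} [AddCommGroup N] [Finite N] (p : ℕ) [Fact p.Prime]
    [Module (ZMod p) N] (hc : 3 < Nat.card N) :
    ∃ f : N → N, f.Injective ∧ (Function.Injective fun x => f x + x) ∧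
      (Function.Injective fun x => f x - x) := by
  classical
  have : Module.Finite (ZMod p) N := Module.Finite.of_finite
  have hr : Module.finrank (ZMod p) N ≠ 0 := by
    intro h
    have := (Module.finrank_zero_iff (R := ZMod p) (M := N)).1 h
    have : Nat.card N = 1 := Nat.card_unique
    omega
  let F := GaloisField p (Module.finrank (ZMod p) N)
  have hF : Module.finrank (ZMod p) F = Module.finrank (ZMod p) N := GaloisField.finrank p hr
  let E : N ≃ₗ[ZMod p] F := LinearEquiv.ofFinrankEq _ _ hF.symm
  have : Finite F := Finite.of_equiv _ E.toEquiv
  have : Fintype F := Fintype.ofFinite F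
  obtain ⟨α, hα⟩ : ∃ α : F, α ∉ ({0, 1, -1} : Finset F) := by
    by_contra hcon
    push Not at hcon
    have h1 : Fintype.card F ≤ 3 := by
      rw [← Finset.card_univ]
      exact (Finset.card_le_card (fun x _ => hcon x)).trans Finset.card_le_three
    have h2 : Nat.card N = Fintype.card F := by
      rw [Nat.card_congr E.toEquiv, Nat.card_eq_fintype_card]
    omega
  simp only [Finset.mem_insert, Finset.mem_singleton, not_or] at hα
  obtain ⟨a0, a1, a2⟩ := hα
  refine ⟨fun u => E.symm (α * E u), ?_, ?_, ?_⟩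
  · intro u v h1
    have h2 := congrArg E h1
    simp only [LinearEquiv.apply_symm_apply] at h2
    exact E.injective (mul_left_cancel₀ a0 h2)
  · intro u v h1
    have h2 := congrArg E h1
    simp only [map_add, LinearEquiv.apply_symm_apply] at h2
    exact E.injective (mul_left_cancel₀ (a := α + 1)
      (fun h => a2 (eq_neg_of_add_eq_zero_left h)) (by linear_combination h2))
  · intro u v h1
    have h2 := congrArg E h1
    simp only [map_sub, LinearEquiv.apply_symm_apply] at h2
    exact E.injective (mul_left_cancel₀ (a := α - 1)
      (fun h => a1 (sub_eq_zero.1 h)) (by linear_combination h2))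

theorem SCmap_elem {A : Type*} [AddCommGroup A] [Finite A] (N : AddSubgroup A) (p : ℕ)
    (hp : p.Prime) (hN : ∀ x ∈ N, p • x = 0) (hc : 3 < Nat.card N) : SCmap N := by
  classical
  have : Fact p.Prime := ⟨hp⟩
  obtain ⟨f, f1, f2, f3⟩ := @SC_mod N _ _ p _ (AddCommGroup.zmodModule (fun x => by
    ext; simpa using hN x x.2)) hc
  refine ⟨fun u => if h : u ∈ N then f ⟨u, h⟩ else 0, ?_, ?_, ?_, ?_⟩
  · intro u hu
    simp [hu]
  · intro u hu v hv h
    simp only [hu, hv, dif_pos] at h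
    exact congrArg Subtype.val (f1 (Subtype.ext h))
  · intro u hu v hv h
    simp only [hu, hv, dif_pos] at h
    have h3 := @f2 ⟨u, hu⟩ ⟨v, hv⟩ (Subtype.ext h)
    exact congrArg Subtype.val h3
  · intro u hu v hv h
    simp only [hu, hv, dif_pos] at h
    have h3 := @f3 ⟨u, hu⟩ ⟨v, hv⟩ (Subtype.ext h)
    exact congrArg Subtype.val h3

/-- torsion subgroup -/
def tors (A : Type*) [AddCommGroup A] (n : ℕ) : AddSubgroup A :=
  (nsmulAddMonoidHom (α := A) n).ker

theorem mem_tors {A : Type*} [AddCommGroup A] (n : ℕ) (x : A) : x ∈ tors A n ↔ n • x = 0 := by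
  simp [tors, AddMonoidHom.mem_ker]

theorem card_tors_mul {A : Type*} [AddCommGroup A] [Finite A] (p n : ℕ) :
    Nat.card (tors A (p * n)) ≤ Nat.card (tors A p) * Nat.card (tors A n) := by
  let f : tors A (p * n) →+ tors A n :=
    { toFun := fun x => ⟨p • (x : A), by
        rw [mem_tors, ← mul_smul, mul_comm]; exact (mem_tors _ _).1 x.2⟩
      map_zero' := by ext; simp
      map_add' := by intro x y; ext; simp }
  have h1 : Nat.card f.ker ≤ Nat.card (tors A p) := by
    apply Nat.card_le_card_of_injective
      (fun x : f.ker => (⟨((x : tors A (p * n)) : A), by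
        rw [mem_tors]
        have := x.2
        rw [AddMonoidHom.mem_ker] at this
        exact congrArg Subtype.val this⟩ : tors A p))
    intro x y h
    simp only [Subtype.mk.injEq] at h
    exact Subtype.ext (Subtype.ext h)
  have h2 : Nat.card f.range ≤ Nat.card (tors A n) :=
    Nat.card_le_card_of_injective _ Subtype.val_injective
  have h3 := AddSubgroup.card_eq_card_quotient_mul_card_addSubgroup f.ker
  have h4 : Nat.card (tors A (p * n) ⧸ f.ker) = Nat.card f.range :=
    Nat.card_congr (QuotientAddGroup.quotientKerEquivRange f).toEquiv
  rw [h3, h4, mul_comm]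
  exact Nat.mul_le_mul h1 h2

theorem exists_big_tors {A : Type*} [AddCommGroup A] [Finite A] (hA : ¬ IsAddCyclic A) :
    ∃ p : ℕ, p.Prime ∧ p < Nat.card (tors A p) := by
  classical
  haveI : Fintype A := Fintype.ofFinite A
  by_contra hcon
  push Not at hcon
  have key : ∀ n : ℕ, 0 < n → Nat.card (tors A n) ≤ n := by
    intro n
    induction n using Nat.recOnMul with
    | zero => intro h; omega
    | one =>
      intro _
      have : tors A 1 = ⊥ := by
        ext x; rw [mem_tors]; simp
      rw [this]; simp
    | prime p hp => intro _; exact hcon p hp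
    | mul a b ha hb =>
      intro h
      have h0 : 0 < a := Nat.pos_of_mul_pos_right h
      have h1 : 0 < b := Nat.pos_of_mul_pos_left h
      exact (card_tors_mul a b).trans (Nat.mul_le_mul (ha h0) (hb h1))
  apply hA
  apply isAddCyclic_of_card_nsmul_eq_zero_le
  intro n hn
  have := key n hn
  rw [Nat.card_eq_fintype_card, Fintype.card_subtype] at this
  simpa [mem_tors] using this

theorem exists_SC_cyclic : ∀ (k : ℕ) (A : Type u) [AddCommGroup A] [Finite A],
    Nat.card A = k → (∃ (c : A) (m : ℕ), Odd m ∧ ∀ a : A, m • a ∈ AddSubgroup.zmultiples c) →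
    ∃ X : AddSubgroup A, Odd (Nat.card X) ∧ SCmap X ∧
      ∃ e : A, ∀ a : A, ∃ j : ℤ, a - j • e ∈ X := by
  intro k
  induction k using Nat.strong_induction_on with
  | _ k ih =>
  intro A _ _ hk hc
  by_cases hcyc : IsAddCyclic A
  · obtain ⟨e, he⟩ := hcyc.exists_zsmul_surjective
    refine ⟨⊥, by simp, ⟨id, by simp, by simp, by simp, by simp⟩, e, ?_⟩
    intro a
    obtain ⟨j, hj⟩ := he a
    exact ⟨j, by simp only at hj; rw [hj, sub_self]; exact AddSubgroup.zero_mem _⟩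
  · obtain ⟨p, hp, hpc⟩ := exists_big_tors hcyc
    obtain ⟨c, m, hm, hcm⟩ := hc
    have hp2 : p ≠ 2 := by
      rintro rfl
      classical
      haveI : Fintype (AddSubgroup.zmultiples c) := Fintype.ofFinite _
      have h1 := IsAddCyclic.card_nsmul_eq_zero_le (α := AddSubgroup.zmultiples c) (n := 2) (by norm_num)
      have hmem : ∀ x ∈ tors A 2, x ∈ AddSubgroup.zmultiples c := by
        intro x hx
        rw [mem_tors] at hx
        obtain ⟨r, hr⟩ := hm
        have := hcm x
        rwa [hr, add_smul, mul_comm, mul_smul, hx, smul_zero, zero_add, one_smul] at this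
      have h2 : Nat.card (tors A 2) ≤ Nat.card {a : AddSubgroup.zmultiples c // 2 • a = 0} := by
        apply Nat.card_le_card_of_injective (fun x : tors A 2 =>
          (⟨⟨x, hmem x x.2⟩, by ext; simpa using (mem_tors _ _).1 x.2⟩ :
            {a : AddSubgroup.zmultiples c // 2 • a = 0}))
        intro x y h
        simp only [Subtype.mk.injEq] at h
        exact Subtype.ext h
      have h3 : Nat.card {a : AddSubgroup.zmultiples c // 2 • a = 0} =
          (Finset.univ.filter (fun a : AddSubgroup.zmultiples c => 2 • a = 0)).card := by
        rw [Nat.card_eq_fintype_card, Fintype.card_subtype]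
      rw [h3] at h2
      exact absurd (hpc.trans_le h2) (not_lt.2 h1)
    have hp3 : 3 ≤ p := by have := hp.two_le; omega
    have hpodd : Odd p := hp.odd_of_ne_two hp2
    set N := tors A p with hNdef
    have hSC : SCmap N := SCmap_elem N p hp (fun x hx => (mem_tors _ _).1 hx) (by omega)
    have hNodd : Odd (Nat.card N) := by
      rw [← Nat.not_even_iff_odd]
      intro hev
      haveI : Fact (Nat.Prime 2) := ⟨Nat.prime_two⟩
      obtain ⟨x, hx⟩ := exists_prime_addOrderOf_dvd_card' 2 hev.two_dvd
      have h1 : p • x = 0 := by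
        ext; simpa using (mem_tors _ _).1 x.2
      have h2 := addOrderOf_dvd_of_nsmul_eq_zero h1
      rw [hx] at h2
      exact (Nat.not_even_iff_odd.2 hpodd) (even_iff_two_dvd.2 h2)
    have hcard := AddSubgroup.card_eq_card_quotient_mul_card_addSubgroup N
    have hlt : Nat.card (A ⧸ N) < k := by
      have : 0 < Nat.card (A ⧸ N) := Nat.card_pos
      rw [← hk, hcard]
      nlinarith
    obtain ⟨Y, hY1, hY2, e, he⟩ := ih _ hlt (A ⧸ N) rfl
      ⟨QuotientAddGroup.mk' N c, m, hm, by
        intro a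
        obtain ⟨a, rfl⟩ := QuotientAddGroup.mk'_surjective N a
        obtain ⟨j, hj⟩ := hcm a
        refine ⟨j, ?_⟩
        simp only at hj ⊢
        rw [← map_zsmul, ← map_nsmul, hj]⟩
    obtain ⟨e, rfl⟩ := QuotientAddGroup.mk'_surjective N e
    refine ⟨Y.comap (QuotientAddGroup.mk' N), ?_, SCmap_ext N Y hSC hY2, e, ?_⟩
    · let f : (Y.comap (QuotientAddGroup.mk' N)) →+ Y :=
        { toFun := fun x => ⟨QuotientAddGroup.mk' N x, x.2⟩
          map_zero' := by ext; simp
          map_add' := by intro x y; ext; simp }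
      have hsurj : Function.Surjective f := by
        rintro ⟨y, hy⟩
        obtain ⟨a, rfl⟩ := QuotientAddGroup.mk'_surjective N y
        exact ⟨⟨a, hy⟩, rfl⟩
      have h3 := AddSubgroup.card_eq_card_quotient_mul_card_addSubgroup f.ker
      have h4 : Nat.card ((Y.comap (QuotientAddGroup.mk' N)) ⧸ f.ker) = Nat.card Y :=
        Nat.card_congr (QuotientAddGroup.quotientKerEquivOfSurjective f hsurj).toEquiv
      have h5 : Nat.card f.ker = Nat.card N := by
        have hle : N ≤ Y.comap (QuotientAddGroup.mk' N) := by
          intro x hx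
          rw [AddSubgroup.mem_comap]
          rw [(QuotientAddGroup.eq_zero_iff x).2 hx |> fun h => (h : QuotientAddGroup.mk' N x = 0)]
          exact Y.zero_mem
        have h6 : ∀ x : (Y.comap (QuotientAddGroup.mk' N)), x ∈ f.ker ↔ (x : A) ∈ N := by
          intro x
          rw [AddMonoidHom.mem_ker, ← QuotientAddGroup.eq_zero_iff (N := N)]
          constructor
          · intro h; exact congrArg Subtype.val h
          · intro h; exact Subtype.ext h
        exact Nat.card_congr
          { toFun := fun x => ⟨x.1.1, (h6 _).1 x.2⟩
            invFun := fun x => ⟨⟨x.1, hle x.2⟩, (h6 _).2 x.2⟩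
            left_inv := fun x => rfl
            right_inv := fun x => rfl }
      rw [h3, h4, h5]
      exact hY1.mul hNodd
    · intro a
      obtain ⟨j, hj⟩ := he (QuotientAddGroup.mk' N a)
      refine ⟨j, ?_⟩
      rw [AddSubgroup.mem_comap, map_sub, map_zsmul]
      exact hj

theorem exists_harm : ∀ (k : ℕ) (A : Type u) [AddCommGroup A] [Finite A],
    Nat.card A = k → Odd k →
    ∃ ξ : ℤ → A, Function.Surjective ξ ∧ (∀ i j, ξ i = ξ j ↔ (k : ℤ) ∣ i - j) ∧
      (∀ i j, ξ i + ξ (i + 1) = ξ j + ξ (j + 1) → (k : ℤ) ∣ i - j) := by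
  intro k
  induction k using Nat.strong_induction_on with
  | _ k ih =>
  intro A _ _ hk hodd
  by_cases h1 : k = 1
  · subst h1
    haveI := (Nat.card_eq_one_iff_unique.1 hk).1
    refine ⟨fun _ => 0, fun a => ⟨0, Subsingleton.elim _ _⟩, ?_, ?_⟩
    · intro i j; simp
    · intro i j; simp
  · haveI : Nontrivial A := by
      rw [← Finite.one_lt_card_iff_nontrivial, hk]
      rcases hodd with ⟨r, hr⟩
      omega
    obtain ⟨z, hz⟩ := exists_ne (0 : A)
    set Z := AddSubgroup.zmultiples z with hZ
    have hcard := AddSubgroup.card_eq_card_quotient_mul_card_addSubgroup Z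
    rw [hk] at hcard
    have hZc : Nat.card Z = addOrderOf z := Nat.card_zmultiples z
    set o := addOrderOf z with ho
    rw [hZc] at hcard
    have ho1 : o ≠ 1 := fun h => hz (AddMonoid.addOrderOf_eq_one_iff.1 h)
    have hopos : 0 < o := addOrderOf_pos z
    set ℓ := Nat.card (A ⧸ Z) with hℓ
    have hℓpos : 0 < ℓ := Nat.card_pos
    have hoodd : Odd o := by
      rw [hcard] at hodd; exact (Nat.odd_mul.1 hodd).2
    have hℓodd : Odd ℓ := by
      rw [hcard] at hodd; exact (Nat.odd_mul.1 hodd).1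
    obtain ⟨η, hs, hp, hh⟩ := ih ℓ (by rw [hcard]; nlinarith [show 2 ≤ o by omega]) (A ⧸ Z) rfl hℓodd
    let mk : A →+ A ⧸ Z := QuotientAddGroup.mk' Z
    let rep : A ⧸ Z → A := fun q => q.out
    have hrep : ∀ q, mk (rep q) = q := fun q => QuotientAddGroup.out_eq' q
    have hmk : ∀ a, mk a = 0 ↔ a ∈ Z := fun a => QuotientAddGroup.eq_zero_iff a
    have hmkz : ∀ i : ℤ, mk (i • z) = 0 := fun i => (hmk _).2 ⟨i, rfl⟩
    have hdvd : ∀ i : ℤ, i • z = 0 ↔ (o : ℤ) ∣ i := fun i => addOrderOf_dvd_iff_zsmul_eq_zero.symm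
    have hℓz : (ℓ : ℤ) ≠ 0 := by omega
    have hdiv : ∀ i j : ℤ, (i + ℓ * j) / ℓ = i / ℓ + j := fun i j => Int.add_mul_ediv_left _ _ hℓz
    have hper : ∀ i j : ℤ, η (i + ℓ * j) = η i := fun i j => (hp _ _).2 ⟨j, by ring⟩
    refine ⟨fun i => rep (η i) + (i / ℓ) • z, ?_, ?_, ?_⟩
    · intro a
      obtain ⟨i, hi⟩ := hs (mk a)
      have : a - rep (η i) - (i / ℓ) • z ∈ Z := by
        rw [← hmk, map_sub, map_sub, hmkz, hrep, hi]; simp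
      obtain ⟨j, hj⟩ := this
      refine ⟨i + ℓ * j, ?_⟩
      simp only at hj ⊢
      rw [hper, hdiv, add_smul, hj]; abel
    · intro i j
      constructor
      · intro h
        have h1 := congrArg mk h
        simp only [map_add, hmkz, hrep, add_zero] at h1
        obtain ⟨r, hr⟩ := (hp _ _).1 h1
        have hi : i = j + ℓ * r := by linarith
        subst hi
        simp only at h
        rw [hper, hdiv] at h
        have h2 := add_left_cancel h
        rw [add_smul] at h2
        have h3 : r • z = 0 := by simpa using h2
        obtain ⟨s, rfl⟩ := (hdvd _).1 h3
        exact ⟨s, by rw [hcard]; push_cast; ring⟩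
      · rintro ⟨s, hs⟩
        have hi : i = j + ℓ * (o * s) := by
          rw [hcard] at hs; push_cast at hs; linarith
        subst hi
        simp only
        rw [hper, hdiv, add_smul, (hdvd (o * s)).2 ⟨s, rfl⟩, add_zero]
    · intro i j h
      have h1 := congrArg mk h
      simp only [map_add, hmkz, hrep, add_zero] at h1
      obtain ⟨r, hr⟩ := hh _ _ h1
      have hi : i = j + ℓ * r := by linarith
      subst hi
      simp only at h
      rw [show j + ℓ * r + 1 = (j + 1) + ℓ * r by ring, hper, hdiv, hper, hdiv] at h
      have h3 : (2 * r) • z = 0 := by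
        have := congrArg (fun x => x - (rep (η j) + (j / ℓ) • z + (rep (η (j + 1)) + ((j + 1) / ℓ) • z))) h
        simp only [sub_self] at this
        rw [← this]
        simp only [add_smul, two_mul]
        abel
      have h4 : (o : ℤ) ∣ 2 * r := (hdvd _).1 h3
      have h5 : IsCoprime (o : ℤ) 2 := by
        have := (Nat.coprime_two_right.2 hoodd)
        exact_mod_cast Nat.isCoprime_iff_coprime.2 this
      obtain ⟨s, rfl⟩ := h5.dvd_of_dvd_mul_left h4
      exact ⟨s, by rw [hcard]; push_cast; ring⟩

theorem lad_num1 (L r s δ : ℤ) (hL : 0 < L) (r0 : 0 < r) (r1 : r < 4 * L) (r2 : r ≠ 2 * L)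
    (s0 : 0 < s) (s1 : s < 4 * L) (s2 : s ≠ 2 * L) (h1 : -1 ≤ δ) (h2 : δ ≤ 1)
    (hd : 4 * L ∣ r - s - δ)
    (hc : (r + if r < 2 * L then 0 else 1) % 2 = (s + if s < 2 * L then 0 else 1) % 2) :
    r = s := by
  obtain ⟨k, hk⟩ := hd
  have k1 : k < 2 := by by_contra h; nlinarith
  have k2 : -2 < k := by by_contra h; nlinarith
  split_ifs at hc <;> interval_cases k <;> omega

theorem lad_num2 (L r s : ℤ) (hL : 0 < L) (r0 : 0 < r) (r1 : r < 4 * L) (r2 : r ≠ 2 * L)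
    (s0 : 0 < s) (s1 : s < 4 * L) (s2 : s ≠ 2 * L)
    (hd : 2 * L ∣ r - s)
    (hc : (r + if r < 2 * L then 0 else 1) % 2 = (s + if s < 2 * L then 0 else 1) % 2) :
    r = s := by
  obtain ⟨k, hk⟩ := hd
  have k1 : k < 2 := by by_contra h; nlinarith
  have k2 : -2 < k := by by_contra h; nlinarith
  split_ifs at hc <;> interval_cases k <;> omega

theorem ladder {A : Type*} [AddCommGroup A] (L : ℤ) (hL : 0 < L) (D : AddSubgroup A) (t : A)
    (g : ℤ → A) (hgL : ∀ i, g (i + L) = g i + t) (ht : t + t = 0)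
    (hinj : ∀ i j, g i = g j → 2 * L ∣ i - j) (hsurj : Function.Surjective g)
    (hD2 : ∀ a : A, a + a ∈ D) (hDi : ∀ a b : A, a ∉ D → b ∉ D → a - b ∈ D)
    (hDg : ∀ i, g (i + 1) - g i ∉ D)
    (hh : ∀ i j, g i + g (i + 1) = g j + g (j + 1) → L ∣ i - j)
    (h2t : ∀ x y : A, x + x = y + y → x = y ∨ x = y + t)
    (P0 : A → ℤ)
    (hr : ∀ d ∈ D, ∀ d' ∈ D, g (P0 d / 2) = g (P0 d' / 2) → d = d')
    (hcl : ∀ d ∈ D, ∀ d' ∈ D, g ((P0 d + 1) / 2) + d = g ((P0 d' + 1) / 2) + d' → d = d')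
    (hs : ∀ d ∈ D, ∀ d' ∈ D, g (P0 d / 2) + (g ((P0 d + 1) / 2) + d) =
      g (P0 d' / 2) + (g ((P0 d' + 1) / 2) + d') → d = d') :
    ∃ f : A × A → (D × Bool) ⊕ Bool, ∀ x y, f x = f y →
      (x.1 = y.1 ∨ x.2 = y.2 ∨ x.1 + x.2 = y.1 + y.2) → x = y := by
  classical
  have hex : ∀ x : A × A, ∃ (p : ℤ) (d : D), x.1 = g (p / 2) ∧ x.2 = g ((p + 1) / 2) + d := by
    rintro ⟨a, b⟩
    obtain ⟨i, rfl⟩ := hsurj a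
    by_cases h : b - g i ∈ D
    · refine ⟨2 * i, ⟨_, h⟩, ?_, ?_⟩
      · simp only; congr 1; omega
      · simp only; rw [show (2 * i + 1) / 2 = i by omega]; abel
    · have h' := hDi _ _ h (hDg i)
      rw [sub_sub_sub_cancel_right] at h'
      refine ⟨2 * i + 1, ⟨_, h'⟩, ?_, ?_⟩
      · simp only; congr 1; omega
      · simp only; rw [show (2 * i + 1 + 1) / 2 = i + 1 by omega]; abel
  choose p d hp1 hp2 using hex
  have hg2 : ∀ i k : ℤ, g (i + 2 * L * k) = g i := by
    have h1 : ∀ i, g (i + 2 * L) = g i := by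
      intro i
      rw [show i + 2 * L = i + L + L by ring, hgL, hgL, add_assoc, ht, add_zero]
    intro i k
    induction k using Int.induction_on with
    | zero => simp
    | succ k ih => rw [show i + 2 * L * ((k : ℤ) + 1) = i + 2 * L * k + 2 * L by ring, h1, ih]
    | pred k ih =>
      rw [← h1, show i + 2 * L * (-(k : ℤ) - 1) + 2 * L = i + 2 * L * -k by ring, ih]
  have hq : ∀ (a k : ℤ), (a + 4 * L * k) / 2 = a / 2 + 2 * L * k := by
    intro a k
    rw [show a + 4 * L * k = a + 2 * (2 * L * k) by ring]
    exact Int.add_mul_ediv_left _ _ (by norm_num)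
  -- same p modulo 4L and same d gives same cell
  have hsame : ∀ x y, d x = d y → 4 * L ∣ p x - p y → x = y := by
    intro x y h1 ⟨k, hk⟩
    have hpx : p x = p y + 4 * L * k := by linarith
    apply Prod.ext
    · rw [hp1, hp1 y, hpx, hq, hg2]
    · rw [hp2, hp2 y, hpx, h1, show p y + 4 * L * k + 1 = p y + 1 + 4 * L * k by ring, hq, hg2]
  let r : A × A → ℤ := fun x => (p x - P0 (d x)) % (4 * L)
  have r0 : ∀ x, 0 ≤ r x := fun x => Int.emod_nonneg _ (by omega)
  have r1 : ∀ x, r x < 4 * L := fun x => Int.emod_lt_of_pos _ (by omega)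
  have rd : ∀ x, ∃ k, p x = P0 (d x) + r x + 4 * L * k := fun x =>
    ⟨(p x - P0 (d x)) / (4 * L), by have := Int.emod_add_mul_ediv (p x - P0 (d x)) (4 * L); simp only [r]; linarith⟩
  let f : A × A → (D × Bool) ⊕ Bool := fun x =>
    if r x = 0 then Sum.inr false else if r x = 2 * L then Sum.inr true else
      Sum.inl (d x, decide ((r x + if r x < 2 * L then 0 else 1) % 2 = 0))
  refine ⟨f, ?_⟩
  intro x y hf hxy
  by_cases hx0 : r x = 0
  · have hy0 : r y = 0 := by
      simp only [f, hx0, if_true] at hf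
      by_contra h
      simp only [h, if_false] at hf
      split_ifs at hf <;> simp at hf
    have key : ∀ z, r z = 0 → z.1 = g (P0 (d z) / 2) ∧ z.2 = g ((P0 (d z) + 1) / 2) + d z := by
      intro z hz
      obtain ⟨k, hk⟩ := rd z
      rw [hz, add_zero] at hk
      refine ⟨by rw [hp1, hk, hq, hg2], ?_⟩
      rw [hp2, hk, show P0 (d z) + 4 * L * k + 1 = P0 (d z) + 1 + 4 * L * k by ring, hq, hg2]
    obtain ⟨kx1, kx2⟩ := key x hx0
    obtain ⟨ky1, ky2⟩ := key y hy0
    have hdd : d x = d y := by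
      apply Subtype.ext
      rw [kx1, kx2, ky1, ky2] at hxy
      rcases hxy with h | h | h
      · exact hr _ (d x).2 _ (d y).2 h
      · exact hcl _ (d x).2 _ (d y).2 h
      · exact hs _ (d x).2 _ (d y).2 h
    apply Prod.ext
    · rw [kx1, ky1, hdd]
    · rw [kx2, ky2, hdd]
  by_cases hx2 : r x = 2 * L
  · have hy2 : r y = 2 * L := by
      have h0 : (2 * L = 0) = False := by simp; omega
      simp only [f, hx2, h0, if_true, if_false] at hf
      by_contra h
      simp only [h, if_false] at hf
      split_ifs at hf <;> simp at hf
    have key : ∀ z, r z = 2 * L → z.1 = g (P0 (d z) / 2) + t ∧ z.2 = g ((P0 (d z) + 1) / 2) + d z + t := by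
      intro z hz
      obtain ⟨k, hk⟩ := rd z
      rw [hz] at hk
      refine ⟨by rw [hp1, hk, hq, hg2, ← hgL]; congr 1; omega, ?_⟩
      rw [hp2, hk, show P0 (d z) + 2 * L + 4 * L * k + 1 = P0 (d z) + 1 + 2 * L + 4 * L * k by ring, hq, hg2,
        show (P0 (d z) + 1 + 2 * L) / 2 = (P0 (d z) + 1) / 2 + L by omega, hgL]
      abel
    obtain ⟨kx1, kx2⟩ := key x hx2
    obtain ⟨ky1, ky2⟩ := key y hy2
    have hdd : d x = d y := by
      apply Subtype.ext
      rw [kx1, kx2, ky1, ky2] at hxy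
      rcases hxy with h | h | h
      · exact hr _ (d x).2 _ (d y).2 (add_right_cancel h)
      · exact hcl _ (d x).2 _ (d y).2 (add_right_cancel h)
      · apply hs _ (d x).2 _ (d y).2
        apply add_right_cancel (b := t + t)
        convert h using 1 <;> abel
    apply Prod.ext
    · rw [kx1, ky1, hdd]
    · rw [kx2, ky2, hdd]
  have hy0 : r y ≠ 0 := by
    intro h
    simp [f, h, hx0, hx2] at hf
  have hy2 : r y ≠ 2 * L := by
    intro h
    simp [f, h, hx0, hx2, hL.ne'] at hf
  simp only [f, hx0, hx2, hy0, hy2, if_false, Sum.inl.injEq, Prod.mk.injEq, decide_eq_decide] at hf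
  obtain ⟨hd, hcc⟩ := hf
  have hcc' : (r x + if r x < 2 * L then 0 else 1) % 2 = (r y + if r y < 2 * L then 0 else 1) % 2 := by
    omega
  have e0 := r0 x
  have e1 := r0 y
  obtain ⟨kx, hkx⟩ := rd x
  obtain ⟨ky, hky⟩ := rd y
  have hfin : r x = r y → x = y := by
    intro h
    apply hsame x y hd
    exact ⟨kx - ky, by rw [hkx, hky, h, hd]; ring⟩
  have hrs : ∀ M, M ∣ 4 * L → ∀ δ, M ∣ p x - p y - δ → M ∣ r x - r y - δ := by
    intro M hM δ h
    have : r x - r y - δ = (p x - p y - δ) - 4 * L * (kx - ky) := by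
      rw [hkx, hky, hd]; ring
    rw [this]
    exact dvd_sub h (hM.mul_right _)
  apply hfin
  rcases hxy with h | h | h
  · rw [hp1, hp1 y] at h
    obtain ⟨k, hk⟩ := hinj _ _ h
    refine lad_num1 L _ _ (p x % 2 - p y % 2) hL (by omega) (r1 x) hx2 (by omega) (r1 y) hy2
      (by omega) (by omega) (hrs _ dvd_rfl _ ⟨k, ?_⟩) hcc'
    linarith [Int.emod_add_mul_ediv (p x) 2, Int.emod_add_mul_ediv (p y) 2]
  · rw [hp2, hp2 y, hd] at h
    obtain ⟨k, hk⟩ := hinj _ _ (add_right_cancel h)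
    refine lad_num1 L _ _ ((p x + 1) % 2 - (p y + 1) % 2) hL (by omega) (r1 x) hx2 (by omega) (r1 y) hy2
      (by omega) (by omega) (hrs _ dvd_rfl _ ⟨k, ?_⟩) hcc'
    linarith [Int.emod_add_mul_ediv (p x + 1) 2, Int.emod_add_mul_ediv (p y + 1) 2]
  · rw [hp2, hp2 y, hd, hp1, hp1 y, ← add_assoc, ← add_assoc] at h
    have h := add_right_cancel h
    suffices hL2 : 2 * L ∣ p x - p y by
      refine lad_num2 L _ _ hL (by omega) (r1 x) hx2 (by omega) (r1 y) hy2 ?_ hcc'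
      have := hrs (2 * L) ⟨2, by ring⟩ 0 (by simpa using hL2)
      simpa using this
    have hodd : ∀ i, g i + g (i + 1) ∉ D := by
      intro i hi
      apply hDg i
      have := D.sub_mem hi (hD2 (g i))
      rwa [add_sub_add_left_eq_sub] at this
    have hsm : ∀ i j, g i + g i = g j + g j → L ∣ i - j := by
      intro i j hij
      rcases h2t _ _ hij with h | h
      · exact dvd_trans ⟨2, by ring⟩ (hinj _ _ h)
      · rw [← hgL] at h
        have h1 : L ∣ i - (j + L) := dvd_trans ⟨2, by ring⟩ (hinj _ _ h)
        have h2 := dvd_add h1 (dvd_refl L)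
        rwa [show i - (j + L) + L = i - j by ring] at h2
    rcases Int.even_or_odd' (p x) with ⟨i, hi | hi⟩ <;> rcases Int.even_or_odd' (p y) with ⟨j, hj | hj⟩ <;>
      rw [hi, hj] at h ⊢
    · rw [show 2 * i / 2 = i by omega, show (2 * i + 1) / 2 = i by omega,
        show 2 * j / 2 = j by omega, show (2 * j + 1) / 2 = j by omega] at h
      rw [← mul_sub]
      exact mul_dvd_mul_left _ (hsm _ _ h)
    · rw [show 2 * i / 2 = i by omega, show (2 * i + 1) / 2 = i by omega,
        show (2 * j + 1 + 1) / 2 = j + 1 by omega, show (2 * j + 1) / 2 = j by omega] at h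
      exact absurd (h ▸ hD2 _) (hodd j)
    · rw [show 2 * j / 2 = j by omega, show (2 * j + 1) / 2 = j by omega,
        show (2 * i + 1 + 1) / 2 = i + 1 by omega, show (2 * i + 1) / 2 = i by omega] at h
      exact absurd (h ▸ hD2 _) (hodd i)
    · rw [show (2 * i + 1 + 1) / 2 = i + 1 by omega, show (2 * i + 1) / 2 = i by omega,
        show (2 * j + 1 + 1) / 2 = j + 1 by omega, show (2 * j + 1) / 2 = j by omega] at h
      rw [add_sub_add_right_eq_sub, ← mul_sub]
      exact mul_dvd_mul_left _ (hh _ _ h)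

theorem upper_aux {A : Type u} [AddCommGroup A] [Finite A] (hev : Even (Nat.card A))
    (X : AddSubgroup A) (hX : Odd (Nat.card X)) (hSC : SCmap X) (e : A)
    (he : ∀ a : A, ∃ j : ℤ, a - j • e ∈ X) :
    ∃ t : A, t ≠ 0 ∧ t + t = 0 ∧ (∀ z : A, z + z = 0 → z = 0 ∨ z = t) ∧
    ∃ D : AddSubgroup A, Nat.card D * 2 = Nat.card A ∧
    ∃ f : A × A → (D × Bool) ⊕ Bool, ∀ x y, f x = f y →
      (x.1 = y.1 ∨ x.2 = y.2 ∨ x.1 + x.2 = y.1 + y.2) → x = y := by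
  classical
  let mk : A →+ A ⧸ X := QuotientAddGroup.mk' X
  have hmk : ∀ a, mk a = 0 ↔ a ∈ X := fun a => QuotientAddGroup.eq_zero_iff a
  set n' := addOrderOf (mk e) with hn'
  have hmem : ∀ k : ℤ, k • e ∈ X ↔ (n' : ℤ) ∣ k := by
    intro k
    rw [← hmk, map_zsmul, hn', addOrderOf_dvd_iff_zsmul_eq_zero]
  have hcq : Nat.card (A ⧸ X) = n' := by
    rw [hn', ← Nat.card_zmultiples]
    have : AddSubgroup.zmultiples (mk e) = ⊤ := by
      rw [eq_top_iff]
      intro q _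
      obtain ⟨a, rfl⟩ := QuotientAddGroup.mk'_surjective X q
      obtain ⟨j, hj⟩ := he a
      refine ⟨j, ?_⟩
      rw [← hmk, map_sub, map_zsmul, sub_eq_zero] at hj
      exact hj.symm
    rw [this, AddSubgroup.card_top]
  have hcard := AddSubgroup.card_eq_card_quotient_mul_card_addSubgroup X
  rw [hcq] at hcard
  set m := Nat.card X with hm
  have hn'ev : Even n' := by
    rw [hcard, Nat.even_mul] at hev
    rcases hev with h | h
    · exact h
    · exact absurd hX (Nat.not_odd_iff_even.2 h)
  have hn'pos : 0 < n' := by rw [← hcq]; exact Nat.card_pos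
  have hmpos : 0 < m := Nat.card_pos
  obtain ⟨l, hl⟩ := hn'ev
  have hlpos : 0 < l := by omega
  have hmem2 : ∀ k : ℤ, k • e ∈ X ↔ (2 * (l : ℤ)) ∣ k := by
    intro k; rw [hmem, hl]; push_cast; rw [two_mul]
  have hmX : ∀ u ∈ X, m • u = 0 := by
    intro u hu
    have : m • (⟨u, hu⟩ : X) = 0 := by rw [hm]; exact card_nsmul_eq_zero'
    exact congrArg Subtype.val this
  obtain ⟨r, hr⟩ := hX
  have h2X : ∀ u ∈ X, u + u = 0 → u = 0 := by
    intro u hu h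
    have := hmX u hu
    rwa [hr, add_smul, mul_comm, mul_smul, two_smul, h, smul_zero, zero_add, one_smul] at this
  have hdiff : ∀ a b : A, ∀ i j : ℤ, a - i • e ∈ X → b - j • e ∈ X → a = b → 2 * (l : ℤ) ∣ i - j := by
    intro a b i j h1 h2 h
    rw [← hmem2]
    have := X.sub_mem h2 h1
    rw [h] at this
    rw [sub_smul]
    convert this using 1
    abel
  -- the involution
  set t : A := ((m : ℤ) * l) • e with htdef
  have htt : t + t = 0 := by
    have h1 : (2 * (l : ℤ)) • e ∈ X := (hmem2 _).2 dvd_rfl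
    have h2 := hmX _ h1
    rw [← h2, htdef, ← add_smul, ← natCast_zsmul, ← mul_smul]
    congr 1
    ring
  have htX : t - (l : ℤ) • e ∈ X := by
    rw [htdef, ← sub_smul, hmem2]
    refine ⟨r, ?_⟩
    rw [hr]; push_cast; ring
  have ht0 : t ≠ 0 := by
    intro h
    have := hdiff t 0 l 0 htX (by simp) h
    obtain ⟨s, hs⟩ := this
    have : (l : ℤ) * (2 * s - 1) = 0 := by linarith
    rcases mul_eq_zero.1 this with h | h <;> omega
  have h2s : ∀ s : ℤ, (2 * s) • t = 0 := by
    intro s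
    rw [mul_comm, mul_smul, two_smul, htt, smul_zero]
  have hinvol : ∀ z : A, z + z = 0 → z = 0 ∨ z = t := by
    intro z hz
    obtain ⟨j, hj⟩ := he z
    have h1 := hdiff (z + z) 0 (j + j) 0 (by
      rw [add_smul]; convert X.add_mem hj hj using 1; abel) (by simp) hz
    obtain ⟨s, hs⟩ := h1
    have hj2 : j = l * s := by linarith
    rcases Int.even_or_odd' s with ⟨k, hk | hk⟩
    · left
      apply h2X z _ hz
      have : j • e ∈ X := by
        rw [hmem2]; exact ⟨k, by rw [hj2, hk]; ring⟩
      simpa using X.add_mem hj this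
    · right
      rw [← sub_eq_zero]
      apply h2X
      · have : (j - l) • e ∈ X := by
          rw [hmem2]; exact ⟨k, by rw [hj2, hk]; ring⟩
        have h2 := X.sub_mem (X.add_mem hj this) htX
        rw [sub_smul] at h2
        convert h2 using 1
        abel
      · rw [sub_add_sub_comm, hz, htt, sub_zero]
  refine ⟨t, ht0, htt, hinvol, ?_⟩
  -- D
  let D : AddSubgroup A :=
    { carrier := {a | ∃ k : ℤ, a - (2 * k) • e ∈ X}
      zero_mem' := ⟨0, by simp⟩
      add_mem' := by
        rintro a b ⟨i, hi⟩ ⟨j, hj⟩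
        refine ⟨i + j, ?_⟩
        rw [mul_add, add_smul]
        convert X.add_mem hi hj using 1; abel
      neg_mem' := by
        rintro a ⟨i, hi⟩
        refine ⟨-i, ?_⟩
        rw [mul_neg, neg_smul]
        convert X.neg_mem hi using 1; abel }
  have hDmem : ∀ a : A, ∀ j : ℤ, a - j • e ∈ X → (a ∈ D ↔ Even j) := by
    intro a j hj
    constructor
    · rintro ⟨k, hk⟩
      obtain ⟨s, hs⟩ := hdiff a a j (2 * k) hj hk rfl
      exact ⟨l * s + k, by linarith⟩
    · rintro ⟨k, hk⟩
      exact ⟨k, by rw [two_mul, ← hk]; exact hj⟩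
  have hD2 : ∀ a : A, a + a ∈ D := by
    intro a
    obtain ⟨j, hj⟩ := he a
    refine ⟨j, ?_⟩
    rw [two_mul, add_smul]; convert X.add_mem hj hj using 1; abel
  have hDi : ∀ a b : A, a ∉ D → b ∉ D → a - b ∈ D := by
    intro a b ha hb
    obtain ⟨i, hi⟩ := he a
    obtain ⟨j, hj⟩ := he b
    rw [hDmem _ _ hi, Int.not_even_iff_odd] at ha
    rw [hDmem _ _ hj, Int.not_even_iff_odd] at hb
    rw [hDmem _ (i - j) (by rw [sub_smul]; convert X.sub_mem hi hj using 1; abel)]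
    exact ha.sub_odd hb
  have heD : e ∉ D := by
    rw [hDmem e 1 (by simp)]
    simp
  refine ⟨D, ?_, ?_⟩
  · have : D.index = 2 := by
      rw [AddSubgroup.index_eq_two_iff]
      refine ⟨e, fun b => ?_⟩
      by_cases hb : b ∈ D
      · right
        refine ⟨hb, fun h => heD ?_⟩
        simpa using D.sub_mem h hb
      · left
        refine ⟨?_, hb⟩
        have h1 := D.add_mem (hDi b e hb heD) (hD2 e)
        convert h1 using 1; abel
    rw [← this, AddSubgroup.card_mul_index]
  obtain ⟨ξ', hξs', hξp', hξh'⟩ := exists_harm m X rfl ⟨r, hr⟩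
  obtain ⟨ξ, hξX, hξs, hξp, hξh⟩ : ∃ ξ : ℤ → A, (∀ i, ξ i ∈ X) ∧ (∀ u ∈ X, ∃ i, ξ i = u) ∧
      (∀ i j, ξ i = ξ j ↔ (m : ℤ) ∣ i - j) ∧
      (∀ i j, ξ i + ξ (i + 1) = ξ j + ξ (j + 1) → (m : ℤ) ∣ i - j) := by
    refine ⟨fun i => ξ' i, fun i => (ξ' i).2, ?_, ?_, ?_⟩
    · intro u hu
      obtain ⟨i, hi⟩ := hξs' ⟨u, hu⟩
      exact ⟨i, by simp only [hi]⟩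
    · intro i j
      rw [← hξp']
      exact Subtype.ext_iff.symm
    · intro i j h
      exact hξh' i j (Subtype.ext h)
  have hlz : (l : ℤ) ≠ 0 := by omega
  have hdiv : ∀ i j : ℤ, (i + l * j) / l = i / l + j := fun i j => Int.add_mul_ediv_left _ _ hlz
  have hmod : ∀ i j : ℤ, (i + l * j) % l = i % l := fun i j => Int.add_mul_emod_self_left _ _ _
  let g : ℤ → A := fun i => (i / l) • t + ξ (i / l) + (i % l) • e
  have hgdef : ∀ i, g i = (i / l) • t + ξ (i / l) + (i % l) • e := fun i => rfl
  have hgX : ∀ i, g i - i • e ∈ X := by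
    intro i
    have h1 := X.add_mem (X.zsmul_mem htX (i / l)) (hξX (i / l))
    have h2 : i • e = (i / l) • ((l : ℤ) • e) + (i % l) • e := by
      rw [← mul_smul, ← add_smul]
      congr 1
      linarith [Int.emod_add_mul_ediv i l, mul_comm (l : ℤ) (i / l)]
    rw [hgdef, h2]
    rw [smul_sub] at h1
    convert h1 using 1; abel
  have hgl : ∀ i s : ℤ, g (i + l * s) = (i / l + s) • t + ξ (i / l + s) + (i % l) • e := by
    intro i s
    rw [hgdef, hdiv, hmod]
  have hcop : IsCoprime (m : ℤ) 2 := by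
    have := (Nat.coprime_two_right.2 ⟨r, hr⟩)
    exact_mod_cast Nat.isCoprime_iff_coprime.2 this
  have hmt : (m : ℤ) • t = t := by
    rw [hr]; push_cast; rw [add_smul, h2s, zero_add, one_smul]
  have hinj : ∀ i j, g i = g j → 2 * ((l : ℤ) * m) ∣ i - j := by
    intro i j h
    obtain ⟨s, hs⟩ := hdiff _ _ i j (hgX i) (hgX j) h
    have hi : i = j + l * (2 * s) := by linarith
    rw [hi, hgl, hgdef j, add_smul, h2s, add_zero] at h
    have h1 := add_left_cancel (add_right_cancel h)
    rw [hξp] at h1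
    rw [add_sub_cancel_left] at h1
    obtain ⟨w, hw⟩ := hcop.dvd_of_dvd_mul_left h1
    exact ⟨w, by rw [hi, hw]; ring⟩
  have hsurj : Function.Surjective g := by
    intro a
    obtain ⟨j, hj⟩ := he a
    have h1 : a - (j / l) • t - (j % l) • e ∈ X := by
      have := X.add_mem (X.sub_mem hj (hgX j)) (hξX (j / l))
      rw [hgdef] at this
      convert this using 1; abel
    obtain ⟨w, hw⟩ := hξs _ h1
    refine ⟨j + l * (2 * ((w - j / l) * (r + 1))), ?_⟩
    rw [hgl, add_smul, h2s, add_zero]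
    have : ξ (j / l + 2 * ((w - j / l) * (r + 1))) = ξ w := by
      rw [hξp]
      refine ⟨w - j / l, ?_⟩
      rw [hr]; push_cast; ring
    rw [this, hw]; abel
  have hge : ∀ i : ℤ, ¬ (l : ℤ) ∣ i + 1 → g (i + 1) = g i + e := by
    intro i hi
    have hlt : i % l < l := Int.emod_lt_of_pos _ (by omega)
    have h0 : 0 ≤ i % l := Int.emod_nonneg _ hlz
    have hne : i % l + 1 ≠ l := by
      intro h
      apply hi
      refine ⟨i / l + 1, ?_⟩
      linarith [Int.emod_add_mul_ediv i l]
    have e1 : i + 1 = (i % l + 1) + l * (i / l) := by linarith [Int.emod_add_mul_ediv i l]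
    have hd0 : (i % l + 1) / l = 0 := Int.ediv_eq_zero_of_lt (by omega) (by omega)
    have hm0 : (i % l + 1) % l = i % l + 1 := Int.emod_eq_of_lt (by omega) (by omega)
    rw [e1, hgl, hd0, hm0, zero_add, hgdef i, add_smul, one_smul, add_assoc, add_assoc, add_assoc]
  have hq1 : ∀ i : ℤ, (i + 1) / l = i / l ∨ (i + 1) / l = i / l + 1 := by
    intro i
    have hlt : i % l < l := Int.emod_lt_of_pos _ (by omega)
    have h0 : 0 ≤ i % l := Int.emod_nonneg _ hlz
    have e1 : i + 1 = (i % l + 1) + l * (i / l) := by linarith [Int.emod_add_mul_ediv i l]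
    rw [e1, hdiv]
    by_cases hne : i % l + 1 = l
    · right
      rw [hne, Int.ediv_self hlz, add_comm]
    · left
      rw [Int.ediv_eq_zero_of_lt (by omega) (by omega), zero_add]
  obtain ⟨θ, θX, θ1, θ2, θ3⟩ := hSC
  have θsurj : ∀ v ∈ X, ∃ u ∈ X, θ u - u = v := by
    intro v hv
    have hinj : Function.Injective (fun u : X => (⟨θ u - u, X.sub_mem (θX _ u.2) u.2⟩ : X)) := by
      intro u w h
      exact Subtype.ext (θ3 _ u.2 _ w.2 (congrArg Subtype.val h))
    obtain ⟨u, hu⟩ := (Finite.injective_iff_surjective.1 hinj) ⟨v, hv⟩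
    exact ⟨u, u.2, congrArg Subtype.val hu⟩
  obtain ⟨x, y, hxy, hx, hy, hxy2⟩ := cyc_pattern l hlpos
  have hP : ∀ d : A, d ∈ D → ∃ (p : ℤ) (j : ℕ) (u : A), j < l ∧ u ∈ X ∧
      g (p / 2) = x j • e + u ∧ g ((p + 1) / 2) + d = y j • e + θ u ∧
      θ u - u = d - (2 * (j : ℤ)) • e := by
    rintro d ⟨k, hk⟩
    have hlt : k % l < l := Int.emod_lt_of_pos _ (by omega)
    have h0 : 0 ≤ k % l := Int.emod_nonneg _ hlz
    obtain ⟨j, hj⟩ := Int.eq_ofNat_of_zero_le h0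
    have hjl : j < l := by omega
    have hdX : d - (2 * (j : ℤ)) • e ∈ X := by
      have h1 : (2 * k - 2 * (j : ℤ)) • e ∈ X := by
        rw [hmem2]
        exact ⟨k / l, by linarith [Int.emod_add_mul_ediv k l]⟩
      have h2 := X.add_mem hk h1
      rw [sub_smul] at h2
      convert h2 using 1; abel
    obtain ⟨u, hu, huv⟩ := θsurj _ hdX
    obtain ⟨i, hi⟩ := hsurj (x j • e + u)
    have hd : d = (2 * (j : ℤ)) • e + θ u - u := by rw [add_sub_assoc, huv]; abel
    rcases hxy j hjl with h | ⟨h, h'⟩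
    · refine ⟨2 * i, j, u, hjl, hu, ?_, ?_, huv⟩
      · rw [show 2 * i / 2 = i by omega, hi]
      · rw [show (2 * i + 1) / 2 = i by omega, hi, hd, ← h, sub_smul]; abel
    · refine ⟨2 * i + 1, j, u, hjl, hu, ?_, ?_, huv⟩
      · rw [show (2 * i + 1) / 2 = i by omega, hi]
      · have hix : 2 * (l : ℤ) ∣ i - x j :=
          hdiff _ _ i (x j) (hgX i) (by simpa using hu) hi
        rw [show (2 * i + 1 + 1) / 2 = i + 1 by omega, hge i, hi, hd]
        · rw [show y j = x j + 2 * j + 1 by linarith, add_smul, add_smul, one_smul]; abel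
        · intro hh
          apply h'
          have := dvd_sub hh (dvd_trans ⟨2, by ring⟩ hix)
          rwa [show i + 1 - (i - x j) = x j + 1 by ring] at this
  choose! p j u hjl huX hrow hcol huv using hP
  have hdet : ∀ d ∈ D, ∀ d' ∈ D, j d = j d' → u d = u d' → d = d' := by
    intro d hd d' hd' h1 h2
    have e1 := huv d hd
    have e2 := huv d' hd'
    rw [h1, h2, e2] at e1
    exact (sub_left_injective e1).symm
  refine ladder ((l : ℤ) * m) (by positivity) D t g ?_ htt hinj hsurj hD2 hDi ?_ ?_ ?_ p ?_ ?_ ?_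
  · intro i
    rw [hgl, hgdef i, add_smul, hmt, (hξp (i / l + m) (i / l)).2 (by simp)]
    abel
  · intro i
    rw [hDmem _ 1]
    · simp
    · have := X.sub_mem (hgX (i + 1)) (hgX i)
      rw [add_smul] at this
      convert this using 1; abel
  · intro i j h
    obtain ⟨s, hs⟩ := hdiff _ _ (i + (i + 1)) (j + (j + 1))
      (by rw [add_smul i]; convert X.add_mem (hgX i) (hgX (i + 1)) using 1; abel)
      (by rw [add_smul j]; convert X.add_mem (hgX j) (hgX (j + 1)) using 1; abel) h
    have hi : i = j + l * s := by linarith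
    rw [hi, show j + l * s + 1 = j + 1 + l * s by ring, hgl, hgl, hgdef j, hgdef (j + 1),
      add_smul, add_smul] at h
    have h1 : ξ (j / l + s) + ξ ((j + 1) / l + s) = ξ (j / l) + ξ ((j + 1) / l) := by
      have h3 := h2s s
      rw [two_mul, add_smul] at h3
      have h4 : ξ (j / l + s) + ξ ((j + 1) / l + s) =
          ((j / l) • t + s • t + ξ (j / l + s) + (j % l) • e +
          (((j + 1) / l) • t + s • t + ξ ((j + 1) / l + s) + ((j + 1) % l) • e)) - (s • t + s • t)
          - ((j / l) • t + (j % l) • e + (((j + 1) / l) • t + ((j + 1) % l) • e)) := by abel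
      rw [h4, h, h3]; abel
    have h2 : (m : ℤ) ∣ s := by
      rcases hq1 j with h | h
      · rw [h] at h1
        have h3 := h2X (ξ (j / l + s) - ξ (j / l)) (X.sub_mem (hξX _) (hξX _))
          (by rw [sub_add_sub_comm, h1, sub_self])
        rw [sub_eq_zero, hξp] at h3
        simpa using h3
      · rw [h, show j / l + 1 + s = j / l + s + 1 by ring] at h1
        simpa using hξh _ _ h1
    rw [hi, add_sub_cancel_left]
    exact mul_dvd_mul_left _ h2
  · intro x y h
    rcases hinvol (x - y) (by rw [sub_add_sub_comm, h, sub_self]) with h | h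
    · exact Or.inl (sub_eq_zero.1 h)
    · exact Or.inr (by rw [← h]; abel)
  · intro d hd d' hd' h
    rw [hrow d hd, hrow d' hd'] at h
    have h1 := hx _ (hjl d hd) _ (hjl d' hd') (hdiff _ _ (x (j d)) (x (j d'))
      (by simpa using huX d hd) (by simpa using huX d' hd') h)
    rw [h1] at h
    exact hdet d hd d' hd' h1 (add_left_cancel h)
  · intro d hd d' hd' h
    rw [hcol d hd, hcol d' hd'] at h
    have h1 := hy _ (hjl d hd) _ (hjl d' hd') (hdiff _ _ (y (j d)) (y (j d'))
      (by simpa using θX _ (huX d hd)) (by simpa using θX _ (huX d' hd')) h)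
    rw [h1] at h
    exact hdet d hd d' hd' h1 (θ1 _ (huX d hd) _ (huX d' hd') (add_left_cancel h))
  · intro d hd d' hd' h
    rw [hrow d hd, hrow d' hd', hcol d hd, hcol d' hd'] at h
    have h0 : ∀ d, x (j d) • e + u d + (y (j d) • e + θ (u d)) =
        (x (j d) + y (j d)) • e + (θ (u d) + u d) := by
      intro d; rw [add_smul]; abel
    rw [h0, h0] at h
    have h1 := hxy2 _ (hjl d hd) _ (hjl d' hd') (hdiff _ _ (x (j d) + y (j d)) (x (j d') + y (j d'))
      (by simpa using X.add_mem (θX _ (huX d hd)) (huX d hd))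
      (by simpa using X.add_mem (θX _ (huX d' hd')) (huX d' hd')) h)
    rw [h1] at h
    exact hdet d hd d' hd' h1 (θ2 _ (huX d hd) _ (huX d' hd') (add_left_cancel h))

theorem sum_one_invol {A : Type*} [AddCommGroup A] [Fintype A] (t : A)
    (htt : t + t = 0) (h : ∀ z : A, z + z = 0 → z = 0 ∨ z = t) : ∑ x : A, x = t := by
  classical
  rw [← Finset.sum_erase_add _ _ (Finset.mem_univ t)]
  have h0 : ∑ x ∈ Finset.univ.erase t, x = 0 := by
    refine Finset.sum_involution (fun x _ => -x) ?_ ?_ ?_ ?_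
    · intro x _; simp
    · intro x hx h0 hneg
      rw [Finset.mem_erase] at hx
      rcases h x (by nth_rewrite 1 [← hneg]; simp) with h | h
      · exact h0 h
      · exact hx.1 h
    · intro x hx
      rw [Finset.mem_erase] at hx ⊢
      refine ⟨fun hh => hx.1 ?_, Finset.mem_univ _⟩
      rw [← neg_neg x, hh]
      exact neg_eq_of_add_eq_zero_left htt
    · intro x _; simp
  rw [h0, zero_add]

theorem sum_two_invol {A : Type*} [AddCommGroup A] [Fintype A] (a b : A) (ha : a ≠ 0) (hb : b ≠ 0)
    (hab : a ≠ b) (ha2 : a + a = 0) (hb2 : b + b = 0) : ∑ x : A, x = 0 := by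
  classical
  have hE : ∑ x : A, x = ∑ x ∈ Finset.univ.filter (fun x : A => x + x = 0), x := by
    rw [← Finset.sum_filter_add_sum_filter_not Finset.univ (fun x : A => x + x = 0)]
    have : ∑ x ∈ Finset.univ.filter (fun x : A => ¬ x + x = 0), x = 0 := by
      refine Finset.sum_involution (fun x _ => -x) ?_ ?_ ?_ ?_
      · intro x _; simp
      · intro x hx h0 hneg
        rw [Finset.mem_filter] at hx
        apply hx.2
        nth_rewrite 1 [← hneg]; simp
      · intro x hx
        rw [Finset.mem_filter] at hx ⊢
        refine ⟨Finset.mem_univ _, fun hh => hx.2 ?_⟩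
        rw [← neg_add, neg_eq_zero] at hh
        exact hh
      · intro x _; simp
    rw [this, add_zero]
  have key : ∀ c : A, c ≠ 0 → c + c = 0 → ∑ x : A, x = 0 ∨ ∑ x : A, x = c := by
    intro c hc hc2
    have h1 : QuotientAddGroup.mk' (AddSubgroup.zmultiples c) (∑ x : A, x) = 0 := by
      rw [hE, map_sum]
      refine Finset.sum_involution (fun x _ => x + c) ?_ ?_ ?_ ?_
      · intro x hx
        rw [Finset.mem_filter] at hx
        rw [← map_add, ← add_assoc, hx.2, zero_add]
        exact (QuotientAddGroup.eq_zero_iff c).2 (AddSubgroup.mem_zmultiples c)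
      · intro x hx h0 h
        exact hc (by simpa using h)
      · intro x hx
        rw [Finset.mem_filter] at hx ⊢
        refine ⟨Finset.mem_univ _, ?_⟩
        rw [add_add_add_comm, hx.2, hc2, add_zero]
      · intro x _; rw [add_assoc, hc2, add_zero]
    obtain ⟨k, hk⟩ := (QuotientAddGroup.eq_zero_iff _).1 h1
    simp only at hk
    rw [← hk]
    rcases Int.even_or_odd' k with ⟨i, hi | hi⟩
    · left
      rw [hi, mul_comm, mul_smul, two_smul, hc2, smul_zero]
    · right
      rw [hi, add_smul, mul_comm, mul_smul, two_smul, hc2, smul_zero, zero_add, one_smul]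
  rcases key a ha ha2 with h | h
  · exact h
  · rcases key b hb hb2 with h' | h'
    · exact h'
    · exact absurd (h.symm.trans h') hab

theorem class_lt {A : Type*} [AddCommGroup A] [Fintype A] (h0 : ∑ x : A, x ≠ 0)
    (S : Finset (A × A)) (h1 : ∀ x ∈ S, ∀ y ∈ S, x.1 = y.1 → x = y)
    (h2 : ∀ x ∈ S, ∀ y ∈ S, x.2 = y.2 → x = y)
    (h3 : ∀ x ∈ S, ∀ y ∈ S, x.1 + x.2 = y.1 + y.2 → x = y) : S.card < Fintype.card A := by
  classical
  have key : ∀ f : A × A → A, (∀ x ∈ S, ∀ y ∈ S, f x = f y → x = y) →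
      S.card ≤ Fintype.card A ∧ (S.card = Fintype.card A → ∑ x ∈ S, f x = ∑ x : A, x) := by
    intro f hf
    have hc : (S.image f).card = S.card := Finset.card_image_of_injOn (fun x hx y hy h => hf x hx y hy h)
    refine ⟨hc ▸ Finset.card_le_univ _, fun h => ?_⟩
    have hu : S.image f = Finset.univ := Finset.eq_univ_of_card _ (hc.trans h)
    rw [← hu, Finset.sum_image (fun x hx y hy h => hf x hx y hy h)]
  refine lt_of_le_of_ne (key _ h1).1 fun h => h0 ?_
  have e1 := (key _ h1).2 h
  have e2 := (key _ h2).2 h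
  have e3 := (key (fun x => x.1 + x.2) h3).2 h
  rw [Finset.sum_add_distrib, e1, e2] at e3
  simpa using e3

theorem cayley_adj {G : Type*} [Group G] (x y : G × G) (hne : x ≠ y)
    (h : x.1 = y.1 ∨ x.2 = y.2 ∨ x.1 * x.2 = y.1 * y.2) : (cayleyGraph G).Adj x y := by
  rw [cayleyGraph, SimpleGraph.fromRel_adj]
  refine ⟨hne, Or.inl ?_⟩
  have h12 : x.1 = y.1 → x.2 ≠ y.2 := fun a b => hne (Prod.ext a b)
  have h13 : x.1 = y.1 → x.1 * x.2 ≠ y.1 * y.2 := fun a b => h12 a (by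
    rw [a] at b; exact mul_left_cancel b)
  have h23 : x.2 = y.2 → x.1 * x.2 ≠ y.1 * y.2 := fun a b => h12 (by
    rw [a] at b; exact mul_right_cancel b) a
  unfold ExactlyOne
  tauto

theorem cayley_colorable {G : Type*} [Group G] {κ : Type*} [Fintype κ] (f : G × G → κ)
    (hf : ∀ x y, f x = f y → (x.1 = y.1 ∨ x.2 = y.2 ∨ x.1 * x.2 = y.1 * y.2) → x = y) :
    (cayleyGraph G).Colorable (Fintype.card κ) := by
  refine (SimpleGraph.Coloring.mk f ?_).colorable
  intro x y hxy h
  have hne := hxy.ne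
  rw [cayleyGraph, SimpleGraph.fromRel_adj] at hxy
  apply hne
  apply hf x y h
  unfold ExactlyOne at hxy
  rcases hxy.2 with h | h
  · tauto
  · rw [eq_comm (a := x.1), eq_comm (a := x.2), eq_comm (a := x.1 * x.2)]; tauto

theorem chrom_n {G : Type*} [CommGroup G] [Fintype G]
    (h0 : ∑ x : Additive G, x = 0) :
    (cayleyGraph G).chromaticNumber = (Fintype.card G : ℕ∞) := by
  classical
  apply le_antisymm
  · apply SimpleGraph.Colorable.chromaticNumber_le
    obtain ⟨β, hβ⟩ := hall_complete h0
    refine cayley_colorable (κ := G) (fun x => Additive.toMul (Additive.ofMul x.2 - β (Additive.ofMul x.1))) ?_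
    rintro ⟨a, b⟩ ⟨c, d⟩ h hs
    have h : Additive.ofMul b - β (Additive.ofMul a) = Additive.ofMul d - β (Additive.ofMul c) := h
    rcases hs with hs | hs | hs
    · simp only at hs
      subst hs
      rw [sub_left_inj] at h
      exact Prod.ext rfl h
    · simp only at hs
      subst hs
      rw [sub_right_inj] at h
      exact Prod.ext (β.injective h) rfl
    · have hs : Additive.ofMul a + Additive.ofMul b = Additive.ofMul c + Additive.ofMul d := hs
      have h1 : β (Additive.ofMul a) + Additive.ofMul a = β (Additive.ofMul c) + Additive.ofMul c := by
        have e1 : β (Additive.ofMul a) + Additive.ofMul a =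
          (Additive.ofMul a + Additive.ofMul b) - (Additive.ofMul b - β (Additive.ofMul a)) := by abel
        rw [e1, hs, h]; abel
      have h2 : Additive.ofMul a = Additive.ofMul c := hβ h1
      rw [h2] at hs
      have h3 : Additive.ofMul b = Additive.ofMul d := add_left_cancel hs
      exact Prod.ext h2 h3
  · rw [SimpleGraph.le_chromaticNumber_iff_colorable]
    intro k hk
    obtain ⟨C⟩ := hk
    have : Function.Injective (fun b : G => C (1, b)) := by
      intro b c h
      by_contra hbc
      exact C.valid (cayley_adj (1, b) (1, c) (by simpa using hbc) (Or.inl rfl)) h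
    simpa using Fintype.card_le_of_injective _ this

theorem chrom_lower {G : Type*} [CommGroup G] [Fintype G]
    (h0 : ∑ x : Additive G, x ≠ 0) :
    ((Fintype.card G + 2 : ℕ) : ℕ∞) ≤ (cayleyGraph G).chromaticNumber := by
  classical
  rw [SimpleGraph.le_chromaticNumber_iff_colorable]
  intro k hk
  obtain ⟨C⟩ := hk
  have hC : ∀ x y, C x = C y → (x.1 = y.1 ∨ x.2 = y.2 ∨ x.1 * x.2 = y.1 * y.2) → x = y := by
    intro x y h hs
    by_contra hne
    exact C.valid (cayley_adj x y hne hs) h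
  have hcl : ∀ c : Fin k, (Finset.univ.filter (fun x : G × G => C x = c)).card ≤ Fintype.card G - 1 := by
    intro c
    have := class_lt h0 (Finset.univ.filter (fun x : G × G => C x = c) : Finset (G × G)) ?_ ?_ ?_
    · have h := this
      rw [Fintype.card_additive] at h
      exact Nat.le_sub_one_of_lt h
    all_goals
      intro x hx y hy h
      have hx2 := ((Finset.mem_filter (α := G × G)).1 hx).2
      have hy2 := ((Finset.mem_filter (α := G × G)).1 hy).2
      apply hC x y (hx2.trans hy2.symm)
    · exact Or.inl h
    · exact Or.inr (Or.inl h)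
    · exact Or.inr (Or.inr h)
  have hsum : Fintype.card (G × G) ≤ (Fintype.card G - 1) * k := by
    have := Finset.card_le_mul_card_image_of_maps_to (s := (Finset.univ : Finset (G × G)))
      (t := (Finset.univ : Finset (Fin k))) (f := C) (fun _ _ => Finset.mem_univ _)
      (Fintype.card G - 1) (fun c _ => hcl c)
    simpa using this
  rw [Fintype.card_prod] at hsum
  have hpos : 0 < Fintype.card G := Fintype.card_pos
  obtain ⟨q, hq⟩ : ∃ q, Fintype.card G = q + 1 := ⟨Fintype.card G - 1, by omega⟩
  rw [hq] at hsum ⊢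
  by_contra hlt
  have : k ≤ q + 2 := by omega
  have h2 : (q + 1 - 1) * k ≤ q * (q + 2) := by
    rw [Nat.add_sub_cancel]; exact Nat.mul_le_mul_left _ this
  nlinarith

theorem abelian_chromatic_number {G : Type*} [CommGroup G] [Fintype G] {n : ℕ}
    (hn : Fintype.card G = n) (P : Sylow 2 G) :
    (((P : Subgroup G) = ⊥ ∨ ¬ IsCyclic ↥(P : Subgroup G)) →
        (cayleyGraph G).chromaticNumber = (n : ℕ∞)) ∧
    (((P : Subgroup G) ≠ ⊥ ∧ IsCyclic ↥(P : Subgroup G)) →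
        (cayleyGraph G).chromaticNumber = (n : ℕ∞) + 2) := by
  classical
  subst hn
  have hodd : Odd (P : Subgroup G).index := by
    rw [← Nat.not_even_iff_odd, even_iff_two_dvd]
    exact P.not_dvd_index
  obtain ⟨k, hk⟩ := IsPGroup.iff_card.1 P.isPGroup'
  refine ⟨fun h => chrom_n ?_, ?_⟩
  · rcases h with h | h
    · refine sum_one_invol 0 (add_zero 0) ?_
      intro z hz
      left
      rw [h, Subgroup.index_bot, Nat.card_eq_fintype_card] at hodd
      obtain ⟨r, hr⟩ := hodd
      have h1 : Fintype.card (Additive G) • z = 0 := card_nsmul_eq_zero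
      rwa [Fintype.card_additive, hr, add_smul, mul_comm, mul_smul, two_smul, hz, smul_zero,
        zero_add, one_smul] at h1
    · have hA : ¬ IsAddCyclic (Additive (P : Subgroup G)) := by
        rwa [isAddCyclic_additive_iff]
      obtain ⟨p, hp, hpc⟩ := exists_big_tors hA
      have hp2 : p = 2 := by
        have hnt : Nontrivial (tors (Additive (P : Subgroup G)) p) := by
          rw [← Finite.one_lt_card_iff_nontrivial]
          exact hp.one_lt.trans hpc
        obtain ⟨x, hx⟩ := exists_ne (0 : tors (Additive (P : Subgroup G)) p)
        have : Fact p.Prime := ⟨hp⟩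
        have ho : addOrderOf (x : Additive (P : Subgroup G)) = p :=
          addOrderOf_eq_prime ((mem_tors _ _).1 x.2) (by simpa using hx)
        have hd := addOrderOf_dvd_natCard (x : Additive (P : Subgroup G))
        rw [ho] at hd
        have hd : p ∣ 2 ^ k := hk ▸ hd
        exact (Nat.prime_dvd_prime_iff_eq hp Nat.prime_two).1 (hp.dvd_of_dvd_pow hd)
      subst hp2
      have : Fintype (tors (Additive (P : Subgroup G)) 2) := Fintype.ofFinite _
      rw [Nat.card_eq_fintype_card, Fintype.two_lt_card_iff] at hpc
      obtain ⟨a, b, c, hab, hac, hbc⟩ := hpc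
      let F : Additive (P : Subgroup G) →+ Additive G := MonoidHom.toAdditive (P : Subgroup G).subtype
      have hF : Function.Injective F := Subtype.val_injective
      have h2 : ∀ x : tors (Additive (P : Subgroup G)) 2, F x + F x = 0 := by
        intro x
        rw [← map_add, ← two_smul ℕ (x : Additive (P : Subgroup G)), (mem_tors _ _).1 x.2, map_zero]
      refine sum_two_invol (F ↑(a - b)) (F ↑(a - c)) ?_ ?_ ?_ (h2 _) (h2 _)
      · rw [Ne, map_eq_zero_iff F hF, ZeroMemClass.coe_eq_zero, sub_eq_zero]; exact hab
      · rw [Ne, map_eq_zero_iff F hF, ZeroMemClass.coe_eq_zero, sub_eq_zero]; exact hac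
      · intro h
        have := Subtype.ext (hF h)
        rw [sub_right_inj] at this
        exact hbc this
  · rintro ⟨hP, hcyc⟩
    obtain ⟨c, hc⟩ := hcyc.exists_generator
    have hev : Even (Nat.card (Additive G)) := by
      have hk0 : k ≠ 0 := by
        rintro rfl
        exact hP (Subgroup.card_eq_one.1 (by simpa using hk))
      have h1 : Nat.card (P : Subgroup G) ∣ Nat.card G := Subgroup.card_subgroup_dvd_card _
      rw [even_iff_two_dvd]
      exact (dvd_pow_self 2 hk0).trans (hk ▸ h1)
    obtain ⟨X, hX, hSC, e, he⟩ := exists_SC_cyclic _ (Additive G) rfl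
      ⟨Additive.ofMul (c : G), (P : Subgroup G).index, hodd, by
        intro a
        have h1 := (P : Subgroup G).pow_index_mem (Additive.toMul a)
        obtain ⟨j, hj⟩ := hc ⟨_, h1⟩
        exact ⟨j, congrArg Subtype.val hj⟩⟩
    obtain ⟨t, t0, tt, ti, D, hD, f, hf⟩ := upper_aux hev X hX hSC e he
    apply le_antisymm
    · have : Fintype D := Fintype.ofFinite _
      have h1 := cayley_colorable (G := G) (κ := (D × Bool) ⊕ Bool) f hf
      have h2 : Fintype.card ((D × Bool) ⊕ Bool) = Fintype.card G + 2 := by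
        rw [Nat.card_eq_fintype_card] at hD
        simp only [Fintype.card_sum, Fintype.card_prod, Fintype.card_bool]
        rw [hD, Nat.card_eq_fintype_card, Fintype.card_additive]
      rw [h2] at h1
      exact_mod_cast h1.chromaticNumber_le
    · have := chrom_lower (G := G) (by rw [sum_one_invol t tt ti]; exact t0)
      exact_mod_cast this
end

section
/- For every finite group G of order n ≥ 3, the chromatic number of its Cayley table satisfies 2·χ(G) ≤ 3n (that is, χ(G) ≤ (3/2)n). -/
def Bd (G : Type*) [Group G] : Prop :=
  ∃ k, (cayleyGraph G).Colorable k ∧ 2 * k ≤ 3 * Nat.card G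

/-- good coloring predicate -/
def GoodCol {G : Type*} [Group G] {α : Type*} (f : G → G → α) : Prop :=
  (∀ x y y', f x y = f x y' → y = y') ∧ (∀ x x' y, f x y = f x' y → x = x') ∧
  (∀ x y x' y', f x y = f x' y' → x * y = x' * y' → x = x')

theorem GoodCol.colorable {G : Type*} [Group G] {α : Type*} [Finite α] {f : G → G → α}
    (h : GoodCol f) : (cayleyGraph G).Colorable (Nat.card α) := by
  obtain ⟨h1, h2, h3⟩ := h
  have : Fintype α := Fintype.ofFinite α
  let C : (cayleyGraph G).Coloring α := SimpleGraph.Coloring.mk (fun p => f p.1 p.2) (by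
    rintro ⟨x, y⟩ ⟨x', y'⟩ hadj heq
    simp only [cayleyGraph, SimpleGraph.fromRel_adj, ExactlyOne] at hadj heq
    obtain ⟨hne, h⟩ := hadj
    have key : x = x' ∨ y = y' ∨ x * y = x' * y' := by tauto
    apply hne
    rcases key with rfl | rfl | h
    · rw [h1 _ _ _ heq]
    · rw [h2 _ _ _ heq]
    · have := h3 _ _ _ _ heq h
      subst this
      rw [mul_left_cancel h])
  rw [Nat.card_eq_fintype_card]
  exact C.colorable

theorem exists_goodCol {G : Type*} [Group G] {k : ℕ} (h : (cayleyGraph G).Colorable k) :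
    ∃ f : G → G → Fin k, GoodCol f := by
  obtain ⟨C⟩ := h
  have key : ∀ x y x' y', C (x, y) = C (x', y') → (x, y) ≠ (x', y') →
      ¬ (x = x') ∧ ¬ (y = y') ∧ ¬ (x * y = x' * y') := by
    intro x y x' y' hC hne
    by_contra hcon
    have hex : ExactlyOne (x = x') (y = y') (x * y = x' * y') := by
      unfold ExactlyOne
      by_cases e1 : x = x'
      · subst e1
        have : y ≠ y' := by rintro rfl; exact hne rfl
        simp [this]
      · by_cases e2 : y = y'
        · subst e2
          simp [e1]
        · simp [e1, e2] at hcon ⊢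
          exact hcon
    exact C.valid (v := (x, y)) (w := (x', y')) (by
      simp only [cayleyGraph, SimpleGraph.fromRel_adj]
      exact ⟨hne, Or.inl hex⟩) hC
  refine ⟨fun x y => C (x, y), ?_, ?_, ?_⟩
  · intro x y y' h
    by_contra hne
    exact (key _ _ _ _ h (by simp [hne])).1 rfl
  · intro x x' y h
    by_contra hne
    exact (key _ _ _ _ h (by simp [hne])).2.1 rfl
  · intro x y x' y' h h'
    by_contra hne
    exact (key _ _ _ _ h (by simp [hne])).2.2 h'

/-- has complete mapping -/
def CM (G : Type*) [Group G] : Prop :=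
  ∃ φ : G → G, Function.Injective φ ∧ Function.Injective (fun y => φ y * y)

theorem CM.colorable {G : Type*} [Group G] [Finite G] (h : CM G) :
    (cayleyGraph G).Colorable (Nat.card G) := by
  obtain ⟨φ, h1, h2⟩ := h
  apply GoodCol.colorable (f := fun x y => x * (φ y)⁻¹)
  refine ⟨?_, ?_, ?_⟩
  · intro x y y' h
    simp at h
    exact h1 h
  · intro x x' y h
    simpa using h
  · intro x y x' y' h h'
    have hb := Finite.injective_iff_surjective.mp h2
    have : φ y * y = φ y' * y' := by
      have e : (x * (φ y)⁻¹)⁻¹ * (x * y) = (x' * (φ y')⁻¹)⁻¹ * (x' * y') := by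
        simp only at h
        rw [h, h']
      simpa [mul_assoc] using e
    have := h2 this
    subst this
    simpa using h

theorem CM.bd {G : Type*} [Group G] [Finite G] (h : CM G) : Bd G :=
  ⟨_, h.colorable, by omega⟩

theorem CM_of_odd {G : Type*} [Group G] [Finite G] (h : Odd (Nat.card G)) : CM G := by
  refine ⟨id, Function.injective_id, ?_⟩
  have : (Nat.card G).Coprime 2 := Nat.coprime_two_right.mpr h
  intro x y hxy
  have := (powCoprime this).injective (a₁ := x) (a₂ := y) (by simpa [powCoprime, sq] using hxy)
  exact this

theorem colorable_prod {G : Type*} [Group G] (N : Subgroup G) [N.Normal] {a b : ℕ}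
    (ha : (cayleyGraph (G ⧸ N)).Colorable a) (hb : (cayleyGraph N).Colorable b) :
    (cayleyGraph G).Colorable (a * b) := by
  obtain ⟨f, f1, f2, f3⟩ := exists_goodCol ha
  obtain ⟨g, g1, g2, g3⟩ := exists_goodCol hb
  let π : G →* G ⧸ N := QuotientGroup.mk' N
  let s : G ⧸ N → G := Quotient.out
  have hs : ∀ q : G ⧸ N, π (s q) = q := fun q => QuotientGroup.out_eq' q
  have hmem : ∀ x, π x = 1 → x ∈ N := fun x hx => (QuotientGroup.eq_one_iff x).mp hx
  let ν : G → N := fun x => ⟨(s (π x))⁻¹ * x, by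
    apply hmem; rw [map_mul, map_inv, hs]; simp⟩
  let μ : G → N := fun x => ⟨x * (s (π x))⁻¹, by
    apply hmem; rw [map_mul, map_inv, hs]; simp⟩
  have hν : ∀ x : G, x = s (π x) * ν x := fun x => by simp [ν]
  have hμ : ∀ x : G, x = μ x * s (π x) := fun x => by simp [μ]
  clear_value ν μ
  have main : GoodCol (fun x y : G => (f (π x) (π y), g (ν x) (μ y))) := by
    refine ⟨?_, ?_, ?_⟩
    · intro x y y' h
      simp only [Prod.mk.injEq] at h
      have e := f1 _ _ _ h.1
      rw [hμ y, hμ y', e, g1 _ _ _ h.2]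
    · intro x x' y h
      simp only [Prod.mk.injEq] at h
      have e := f2 _ _ _ h.1
      rw [hν x, hν x', e, g2 _ _ _ h.2]
    · intro x y x' y' h hm
      simp only [Prod.mk.injEq] at h
      have hm' : π x * π y = π x' * π y' := by rw [← map_mul, hm, map_mul]
      have e := f3 _ _ _ _ h.1 hm'
      have e' : π y = π y' := by
        rw [e] at hm'
        exact mul_left_cancel hm'
      have e2 : ν x * μ y = ν x' * μ y' := by
        apply Subtype.ext
        push_cast
        rw [hν x, hμ y, hν x', hμ y', e, e', mul_assoc, mul_assoc (s (π x'))] at hm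
        have hm := mul_left_cancel hm
        rw [← mul_assoc, ← mul_assoc] at hm
        exact mul_right_cancel hm
      rw [hν x, hν x', e, g3 _ _ _ _ h.2 e2]
  have := main.colorable
  simpa using this

/-- reduction lemmas -/
theorem bd_of_quot_CM {G : Type*} [Group G] [Finite G] (N : Subgroup G) [N.Normal]
    (h1 : CM (G ⧸ N)) (h2 : Bd N) : Bd G := by
  obtain ⟨k, hk, hk'⟩ := h2
  refine ⟨_, colorable_prod N h1.colorable hk, ?_⟩
  have := N.card_eq_card_quotient_mul_card_subgroup
  rw [this]
  nlinarith

theorem bd_of_sub_CM {G : Type*} [Group G] [Finite G] (N : Subgroup G) [N.Normal]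
    (h1 : Bd (G ⧸ N)) (h2 : CM N) : Bd G := by
  obtain ⟨k, hk, hk'⟩ := h1
  refine ⟨_, colorable_prod N hk h2.colorable, ?_⟩
  have := N.card_eq_card_quotient_mul_card_subgroup
  rw [this]
  nlinarith

/-- tile lemma -/
theorem tile {G : Type*} [Group G] [Finite G] (K : Finset G) (x : Bool → G → G)
    (c : Bool → G → Fin 3) (hK : ∀ y g, ∃ b, ∃ k ∈ K, g = k * x b y)
    (hcard : 2 * K.card ≤ Nat.card G)
    (hgood : ∀ b y b' y', c b y = c b' y' →
      ((y = y' → b = b') ∧ (x b y = x b' y' → y = y') ∧ (x b y * y = x b' y' * y' → y = y'))) :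
    Bd G := by
  choose b k hkK hk using hK
  have : GoodCol (fun g y : G => ((⟨k y g, hkK y g⟩, c (b y g) y) : K × Fin 3)) := by
    refine ⟨?_, ?_, ?_⟩
    · intro g y y' h
      simp only [Prod.mk.injEq, Subtype.mk.injEq] at h
      apply (hgood _ _ _ _ h.2).2.1
      have e1 := hk y g
      have e2 := hk y' g
      rw [h.1] at e1
      exact mul_left_cancel (e1.symm.trans e2)
    · intro g g' y h
      simp only [Prod.mk.injEq, Subtype.mk.injEq] at h
      rw [hk y g, hk y g', h.1, (hgood _ _ _ _ h.2).1 rfl]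
    · intro g y g' y' h hm
      simp only [Prod.mk.injEq, Subtype.mk.injEq] at h
      have e : y = y' := by
        apply (hgood _ _ _ _ h.2).2.2
        rw [hk y g, hk y' g', h.1, mul_assoc, mul_assoc] at hm
        exact mul_left_cancel hm
      subst e
      exact mul_right_cancel hm
  refine ⟨_, this.colorable, ?_⟩
  simp
  omega


/-- partial transversal -/
def PTr {G : Type*} [Group G] (A : Finset (G × G)) : Prop :=
  ∀ p ∈ A, ∀ q ∈ A, (p.1 = q.1 ∨ p.2 = q.2 ∨ p.1 * p.2 = q.1 * q.2) → p = q

theorem PTr.insert {G : Type*} [Group G] [DecidableEq G] {A : Finset (G × G)} (h : PTr A)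
    (r z : G) (hr : ∀ p ∈ A, p.1 ≠ r) (hz : ∀ p ∈ A, p.2 ≠ z) (hs : ∀ p ∈ A, p.1 * p.2 ≠ r * z) :
    PTr (insert (r, z) A) := by
  intro p hp q hq hpq
  rw [Finset.mem_insert] at hp hq
  rcases hp with rfl | hp <;> rcases hq with rfl | hq
  · rfl
  · have := hr q hq; have := hz q hq; have := hs q hq
    exfalso
    rcases hpq with h | h | h <;> simp_all
  · have := hr p hp; have := hz p hp; have := hs p hp
    exfalso
    rcases hpq with h | h | h <;> simp_all
  · exact h p hp q hq hpq

theorem PTr.mono {G : Type*} [Group G] {A B : Finset (G × G)} (h : PTr A) (hB : B ⊆ A) :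
    PTr B := fun p hp q hq hpq => h p (hB hp) q (hB hq) hpq

theorem chain_step {G : Type*} [Group G] [Fintype G] [DecidableEq G] (A : Finset (G × G))
    (hA : PTr A) (hmax : ∀ B : Finset (G × G), PTr B → B.card ≤ A.card) (c : ℕ)
    (hc : c + A.card = Fintype.card G) (k : ℕ) (hk : k ≤ c) :
    ∃ U C : Finset G, U.card = k ∧ (∀ r ∈ U, r ∉ A.image Prod.fst) ∧ (k + 1) * c ≤ C.card ∧
      (A.image Prod.snd)ᶜ ⊆ C ∧
      ∀ z ∈ C, ∃ A' : Finset (G × G), PTr A' ∧ A'.card = A.card ∧ (∀ p ∈ A', p.2 ≠ z) ∧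
        (∀ p ∈ A', p.1 * p.2 ∈ A.image (fun p => p.1 * p.2)) ∧
        (∀ p ∈ A', p.1 ∈ A.image Prod.fst ∨ p.1 ∈ U) ∧ (∀ p ∈ A, p.2 ∉ C → p ∈ A') := by
  have hrows : (A.image Prod.fst).card = A.card :=
    Finset.card_image_of_injOn (fun p hp q hq h => hA p hp q hq (Or.inl h))
  have hcols : (A.image Prod.snd).card = A.card :=
    Finset.card_image_of_injOn (fun p hp q hq h => hA p hp q hq (Or.inr (Or.inl h)))
  induction k with
  | zero =>
    refine ⟨∅, (A.image Prod.snd)ᶜ, rfl, by simp, ?_, le_rfl, ?_⟩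
    · rw [Finset.card_compl, hcols]; omega
    · intro z hz
      refine ⟨A, hA, rfl, ?_, ?_, ?_, fun p hp _ => hp⟩
      · rintro p hp rfl
        simp only [Finset.mem_compl, Finset.mem_image, not_exists, not_and] at hz
        exact hz p hp rfl
      · intro p hp; exact Finset.mem_image_of_mem (fun p : G × G => p.1 * p.2) hp
      · intro p hp; exact Or.inl (Finset.mem_image_of_mem _ hp)
  | succ k ih =>
    obtain ⟨U, C, hU, hUA, hC, hC0, hz⟩ := ih (by omega)
    -- pick a new row
    obtain ⟨r, hr⟩ : ∃ r, r ∉ A.image Prod.fst ∪ U := by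
      by_contra hcon
      push Not at hcon
      have h1 : (A.image Prod.fst ∪ U) = Finset.univ := Finset.eq_univ_iff_forall.mpr hcon
      have h2 := Finset.card_union_le (A.image Prod.fst) U
      rw [h1, Finset.card_univ, hrows, hU] at h2
      omega
    rw [Finset.mem_union, not_or] at hr
    obtain ⟨hrA, hrU⟩ := hr
    have hsym : ∀ z ∈ C, r * z ∈ A.image (fun p => p.1 * p.2) := by
      intro z hzC
      obtain ⟨A', h1, h2, h3, h4, h5, h6⟩ := hz z hzC
      by_contra hcon
      have hB : PTr (insert (r, z) A') := by
        apply h1.insert _ _ _ h3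
        · intro p hp h
          exact hcon (h ▸ h4 p hp)
        · rintro p hp rfl
          rcases h5 p hp with h | h
          · exact hrA h
          · exact hrU h
      have := hmax _ hB
      rw [Finset.card_insert_of_notMem (fun h => h3 _ h rfl)] at this
      omega
    have hsym' : ∀ z ∈ C, ∃ p ∈ A, p.1 * p.2 = r * z := by
      intro z hzC
      simpa only [Finset.mem_image] using hsym z hzC
    choose! f hfA hf using hsym'
    let E := C.image (fun z => (f z).2)
    have hE : E.card = C.card := by
      apply Finset.card_image_of_injOn
      intro z hzC z' hzC' h
      have e := hA _ (hfA z hzC) _ (hfA z' hzC') (Or.inr (Or.inl h))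
      have := hf z hzC
      rw [e, hf z' hzC'] at this
      exact (mul_left_cancel this).symm
    have hEsub : E ⊆ A.image Prod.snd := by
      intro y hy
      simp only [E, Finset.mem_image] at hy ⊢
      obtain ⟨z, hzC, rfl⟩ := hy
      exact ⟨_, hfA z hzC, rfl⟩
    refine ⟨insert r U, C ∪ E, ?_, ?_, ?_, hC0.trans Finset.subset_union_left, ?_⟩
    · rw [Finset.card_insert_of_notMem hrU, hU]
    · intro x hx
      rcases Finset.mem_insert.mp hx with rfl | hx
      · exact hrA
      · exact hUA x hx
    · have hd : Disjoint (A.image Prod.snd)ᶜ E := by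
        rw [Finset.disjoint_left]
        intro x hx hx'
        exact (Finset.mem_compl.mp hx) (hEsub hx')
      have h1 : ((A.image Prod.snd)ᶜ ∪ E).card ≤ (C ∪ E).card :=
        Finset.card_le_card (Finset.union_subset_union_left hC0)
      rw [Finset.card_union_of_disjoint hd, Finset.card_compl, hcols, hE] at h1
      have h2 : Fintype.card G - A.card = c := by omega
      rw [h2] at h1
      nlinarith
    · intro y hy
      by_cases hyC : y ∈ C
      · obtain ⟨A', h1, h2, h3, h4, h5, h6⟩ := hz y hyC
        refine ⟨A', h1, h2, h3, h4, ?_, ?_⟩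
        · intro p hp
          rcases h5 p hp with h | h
          · exact Or.inl h
          · exact Or.inr (Finset.mem_insert_of_mem h)
        · intro p hp hpC
          exact h6 p hp (fun h => hpC (Finset.mem_union_left _ h))
      · have hyE : y ∈ E := by
          rcases Finset.mem_union.mp hy with h | h
          · exact absurd h hyC
          · exact h
        obtain ⟨z, hzC, hzy⟩ := Finset.mem_image.mp hyE
        obtain ⟨A', h1, h2, h3, h4, h5, h6⟩ := hz z hzC
        have hfA' : f z ∈ A' := h6 _ (hfA z hzC) (by rw [hzy]; exact hyC)
        refine ⟨insert (r, z) (A'.erase (f z)), ?_, ?_, ?_, ?_, ?_, ?_⟩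
        · apply (h1.mono (Finset.erase_subset _ _)).insert
          · rintro p hp rfl
            rcases h5 p (Finset.mem_of_mem_erase hp) with h | h
            · exact hrA h
            · exact hrU h
          · intro p hp
            exact h3 p (Finset.mem_of_mem_erase hp)
          · intro p hp h
            rw [← hf z hzC] at h
            exact (Finset.ne_of_mem_erase hp)
              (h1 p (Finset.mem_of_mem_erase hp) _ hfA' (Or.inr (Or.inr h)))
        · rw [Finset.card_insert_of_notMem, Finset.card_erase_of_mem hfA', h2]
          · have : 0 < A'.card := Finset.card_pos.mpr ⟨_, hfA'⟩
            omega
          · intro h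
            exact h3 _ (Finset.mem_of_mem_erase h) rfl
        · intro p hp hpy
          rcases Finset.mem_insert.mp hp with rfl | hp
          · simp only at hpy
            exact hyC (hpy ▸ hzC)
          · exact (Finset.ne_of_mem_erase hp)
              (h1 p (Finset.mem_of_mem_erase hp) _ hfA' (Or.inr (Or.inl (hpy.trans hzy.symm))))
        · intro p hp
          rcases Finset.mem_insert.mp hp with rfl | hp
          · exact hsym z hzC
          · exact h4 p (Finset.mem_of_mem_erase hp)
        · intro p hp
          rcases Finset.mem_insert.mp hp with rfl | hp
          · exact Or.inr (Finset.mem_insert_self _ _)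
          · rcases h5 p (Finset.mem_of_mem_erase hp) with h | h
            · exact Or.inl h
            · exact Or.inr (Finset.mem_insert_of_mem h)
        · intro p hp hpC
          rw [Finset.mem_union, not_or] at hpC
          apply Finset.mem_insert_of_mem
          apply Finset.mem_erase_of_ne_of_mem _ (h6 p hp hpC.1)
          rintro rfl
          exact hpC.2 (hzy ▸ hyE)

theorem exists_near {G : Type*} [Group G] [Fintype G] [DecidableEq G] :
    ∃ (C0 : Finset G) (a : G → G), C0.card * (C0.card + 1) ≤ Fintype.card G ∧
      (∀ y ∉ C0, ∀ y' ∉ C0, a y = a y' → y = y') ∧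
      (∀ y ∉ C0, ∀ y' ∉ C0, a y * y = a y' * y' → y = y') := by
  classical
  obtain ⟨A, hA, hmax⟩ := Finset.exists_max_image
    (Finset.univ.filter (fun A : Finset (G × G) => PTr A)) Finset.card
    ⟨∅, by simp [PTr]⟩
  simp only [Finset.mem_filter, Finset.mem_univ, true_and] at hA hmax
  have hcols : (A.image Prod.snd).card = A.card :=
    Finset.card_image_of_injOn (fun p hp q hq h => hA p hp q hq (Or.inr (Or.inl h)))
  have hle : (A.image Prod.snd).card ≤ Fintype.card G := Finset.card_le_univ _
  obtain ⟨U, C, -, -, hC, -, -⟩ := chain_step A hA hmax (Fintype.card G - A.card) (by omega)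
    (Fintype.card G - A.card) le_rfl
  have hex : ∀ y ∈ A.image Prod.snd, ∃ x, (x, y) ∈ A := by
    intro y hy
    obtain ⟨⟨x, y'⟩, hp, rfl⟩ := Finset.mem_image.mp hy
    exact ⟨x, hp⟩
  choose! a ha using hex
  refine ⟨(A.image Prod.snd)ᶜ, a, ?_, ?_, ?_⟩
  · rw [Finset.card_compl, hcols]
    have := Finset.card_le_univ C
    rw [mul_comm]
    omega
  · intro y hy y' hy' h
    have := hA _ (ha y (by simpa using hy)) _ (ha y' (by simpa using hy')) (Or.inl h)
    exact congrArg Prod.snd this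
  · intro y hy y' hy' h
    have := hA _ (ha y (by simpa using hy)) _ (ha y' (by simpa using hy')) (Or.inr (Or.inr h))
    exact congrArg Prod.snd this


theorem exists_half {G : Type*} [Group G] [Fintype G] [DecidableEq G] (t : G) (ht : t * t = 1)
    (ht1 : t ≠ 1) : ∃ K : Finset G, 2 * K.card ≤ Nat.card G ∧ ∀ g, g ∈ K ∨ g * t ∈ K := by
  classical
  obtain ⟨S, hS, -⟩ := Subgroup.exists_isComplement_left (Subgroup.zpowers t) 1
  have hord : orderOf t = 2 := orderOf_eq_prime (by rw [sq, ht]) ht1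
  refine ⟨S.toFinset, ?_, ?_⟩
  · have := hS.card_mul_card
    rw [← this, Nat.card_eq_fintype_card (α := S), Set.toFinset_card, mul_comm]
    apply Nat.mul_le_mul_left
    change 2 ≤ Nat.card (Subgroup.zpowers t)
    rw [Nat.card_zpowers, hord]
  · intro g
    obtain ⟨⟨⟨s, hs⟩, ⟨u, hu⟩⟩, hsu, -⟩ := hS.existsUnique g
    simp only at hsu
    obtain ⟨k, hk⟩ := Subgroup.mem_zpowers_iff.mp hu
    rcases Int.even_or_odd' k with ⟨m, rfl | rfl⟩
    · left
      have : u = 1 := by rw [← hk, zpow_mul, zpow_ofNat, sq, ht, one_zpow]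
      rw [this, mul_one] at hsu
      simpa [← hsu] using hs
    · right
      have : u = t := by rw [← hk, zpow_add, zpow_mul, zpow_ofNat, sq, ht, one_zpow]; simp
      rw [this] at hsu
      have : g * t = s := by rw [← hsu, mul_assoc, ht, mul_one]
      simpa [this] using hs

set_option maxHeartbeats 1000000 in
theorem finish1 {G : Type*} [Group G] [Fintype G] [DecidableEq G] (t : G) (ht : t * t = 1)
    (ht1 : t ≠ 1) (C0 : Finset G) (a : G → G)
    (h1 : ∀ y ∉ C0, ∀ y' ∉ C0, a y = a y' → y = y')
    (h2 : ∀ y ∉ C0, ∀ y' ∉ C0, a y * y = a y' * y' → y = y')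
    (h3 : ∀ y ∈ C0, ∀ y' ∈ C0, a y = a y' → y = y')
    (h4 : ∀ y ∈ C0, ∀ y' ∈ C0, a y * y = a y' * y' → y = y')
    (h5 : ∀ y ∉ C0, ∀ z1 ∈ C0, (a y = a z1 ∨ a y * y = a z1 * z1) → ∀ z2 ∈ C0,
      a z2 ≠ t * a y ∧ a z2 * z2 ≠ t * (a y * y)) : Bd G := by
  classical
  obtain ⟨K, hKc, hK⟩ := exists_half t ht ht1
  let kicked : G → Prop := fun y => ∃ z1 ∈ C0, (a y = a z1 ∨ a y * y = a z1 * z1)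
  let x : Bool → G → G := fun b y => if b then t * a y else a y
  let c : Bool → G → Fin 3 := fun b y => if y ∈ C0 then (if b then 1 else 2) else
    (if b then (if kicked y then 2 else 1) else 0)
  refine tile K x c ?_ hKc ?_
  · intro y g
    rcases hK (g * (a y)⁻¹) with h | h
    · exact ⟨false, _, h, by simp [x]⟩
    · refine ⟨true, _, h, ?_⟩
      simp only [x, if_true]
      rw [mul_assoc, ← mul_assoc t t, ht]
      simp
  · intro b y b' y' hc
    refine ⟨?_, ?_, ?_⟩
    · rintro rfl
      clear h1 h2 h3 h4 h5 hK hKc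
      by_cases hy : y ∈ C0 <;> by_cases hk : kicked y <;> cases b <;> cases b' <;>
        simp_all [c]
    · by_cases hy : y ∈ C0 <;> by_cases hy' : y' ∈ C0
      · have := h3 y hy y' hy'
        clear h1 h2 h3 h4 h5 hK hKc
        cases b <;> cases b' <;> simp_all [c, x]
      · by_cases hk : kicked y'
        · obtain ⟨z1, hz1, hz⟩ := id hk
          have := (h5 y' hy' z1 hz1 hz y hy).1
          clear h1 h2 h3 h4 h5 hK hKc
          cases b <;> cases b' <;> simp_all [c, x]
        · have : a y' ≠ a y := fun h => hk ⟨y, hy, Or.inl h⟩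
          have := this.symm
          clear h1 h2 h3 h4 h5 hK hKc
          cases b <;> cases b' <;> simp_all [c, x]
      · by_cases hk : kicked y
        · obtain ⟨z1, hz1, hz⟩ := id hk
          have := (h5 y hy z1 hz1 hz y' hy').1.symm
          clear h1 h2 h3 h4 h5 hK hKc
          cases b <;> cases b' <;> simp_all [c, x]
        · have : a y ≠ a y' := fun h => hk ⟨y', hy', Or.inl h⟩
          clear h1 h2 h3 h4 h5 hK hKc
          cases b <;> cases b' <;> simp_all [c, x]
      · have := h1 y hy y' hy'
        clear h1 h2 h3 h4 h5 hK hKc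
        cases b <;> cases b' <;> by_cases hk : kicked y <;> by_cases hk' : kicked y' <;>
          simp_all [c, x]
    · by_cases hy : y ∈ C0 <;> by_cases hy' : y' ∈ C0
      · have := h4 y hy y' hy'
        clear h1 h2 h3 h4 h5 hK hKc
        cases b <;> cases b' <;> simp_all [c, x, mul_assoc]
      · by_cases hk : kicked y'
        · obtain ⟨z1, hz1, hz⟩ := id hk
          have := (h5 y' hy' z1 hz1 hz y hy).2
          clear h1 h2 h3 h4 h5 hK hKc
          cases b <;> cases b' <;> simp_all [c, x, mul_assoc]
        · have : a y' * y' ≠ a y * y := fun h => hk ⟨y, hy, Or.inr h⟩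
          have := this.symm
          clear h1 h2 h3 h4 h5 hK hKc
          cases b <;> cases b' <;> simp_all [c, x, mul_assoc]
      · by_cases hk : kicked y
        · obtain ⟨z1, hz1, hz⟩ := id hk
          have := (h5 y hy z1 hz1 hz y' hy').2.symm
          clear h1 h2 h3 h4 h5 hK hKc
          cases b <;> cases b' <;> simp_all [c, x, mul_assoc]
        · have : a y * y ≠ a y' * y' := fun h => hk ⟨y', hy', Or.inr h⟩
          clear h1 h2 h3 h4 h5 hK hKc
          cases b <;> cases b' <;> simp_all [c, x, mul_assoc]
      · have := h2 y hy y' hy'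
        clear h1 h2 h3 h4 h5 hK hKc
        cases b <;> cases b' <;> by_cases hk : kicked y <;> by_cases hk' : kicked y' <;>
          simp_all [c, x, mul_assoc]

/-- conflict set -/
def betaSet {G : Type*} [Group G] [Fintype G] [DecidableEq G] (t : G) (C0 : Finset G) (a : G → G)
    (z : G) : Finset G := (C0ᶜ).filter (fun y => a y * y = t * a y * z)

theorem greedy {G : Type*} [Group G] [Fintype G] [DecidableEq G] (t : G) (ht : t * t = 1)
    (ht1 : t ≠ 1) (C0 : Finset G) (a : G → G)
    (h1 : ∀ y ∉ C0, ∀ y' ∉ C0, a y = a y' → y = y')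
    (h2 : ∀ y ∉ C0, ∀ y' ∉ C0, a y * y = a y' * y' → y = y')
    (hstep : ∀ S ⊆ C0, S.Nonempty → ∃ z ∈ S,
      8 * (S.card - 1) + 2 * (betaSet t C0 a z).card < Fintype.card G) (k : ℕ) :
    ∀ S ⊆ C0, S.card = k → ∃ g : G → G, (∀ y ∈ S, ∀ y' ∈ S, g y = g y' → y = y') ∧
      (∀ y ∈ S, ∀ y' ∈ S, g y * y = g y' * y' → y = y') ∧
      (∀ y ∉ C0, ∀ z1 ∈ S, (a y = g z1 ∨ a y * y = g z1 * z1) → ∀ z2 ∈ S,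
      g z2 ≠ t * a y ∧ g z2 * z2 ≠ t * (a y * y)) := by
  classical
  have htt : ∀ g, t * (t * g) = g := fun g => by rw [← mul_assoc, ht, one_mul]
  have htne : ∀ g, g ≠ t * g := fun g h => ht1 (by simpa using h.symm)
  -- partial inverses
  obtain ⟨ra, hra⟩ : ∃ ra : G → G, ∀ y ∉ C0, ra (a y) = y := by
    refine ⟨fun v => if h : ∃ y, y ∉ C0 ∧ a y = v then h.choose else 1, ?_⟩
    intro y hy
    have h : ∃ y', y' ∉ C0 ∧ a y' = a y := ⟨y, hy, rfl⟩
    simp only [dif_pos h]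
    exact h1 _ h.choose_spec.1 _ hy h.choose_spec.2
  obtain ⟨sa, hsa⟩ : ∃ sa : G → G, ∀ y ∉ C0, sa (a y * y) = y := by
    refine ⟨fun v => if h : ∃ y, y ∉ C0 ∧ a y * y = v then h.choose else 1, ?_⟩
    intro y hy
    have h : ∃ y', y' ∉ C0 ∧ a y' * y' = a y * y := ⟨y, hy, rfl⟩
    simp only [dif_pos h]
    exact h2 _ h.choose_spec.1 _ hy h.choose_spec.2
  induction k with
  | zero =>
    intro S hS hcard
    rw [Finset.card_eq_zero] at hcard
    subst hcard
    exact ⟨id, by simp, by simp, by simp⟩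
  | succ k ih =>
    intro S hS hcard
    obtain ⟨z, hz, hlt⟩ := hstep S hS (by rw [← Finset.card_pos]; omega)
    obtain ⟨g, g1, g2, g3⟩ := ih (S.erase z) ((Finset.erase_subset _ _).trans hS)
      (by rw [Finset.card_erase_of_mem hz]; omega)
    let L : G → Finset G := fun z' => ([g z', g z' * z' * z⁻¹, t * g z', t * (g z' * z') * z⁻¹,
      t * (a (ra (g z')) * ra (g z')) * z⁻¹, t * a (sa (g z' * z')), a (sa (t * (g z' * z'))),
      a (ra (t * g z')) * ra (t * g z') * z⁻¹] : List G).toFinset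
    let F : Finset G := (S.erase z).biUnion L ∪
      ((betaSet t C0 a z).image a ∪ (betaSet t C0 a z).image (fun y => t * a y))
    have hF : F.card < Fintype.card G := by
      have e1 : ((S.erase z).biUnion L).card ≤ (S.erase z).card * 8 :=
        Finset.card_biUnion_le_card_mul _ _ _ (fun z' _ => (List.toFinset_card_le _).trans (by simp))
      rw [Finset.card_erase_of_mem hz] at e1
      have e2 : ((betaSet t C0 a z).image a).card ≤ _ := Finset.card_image_le
      have e3 : ((betaSet t C0 a z).image (fun y => t * a y)).card ≤ _ := Finset.card_image_le
      have e4 := Finset.card_union_le ((S.erase z).biUnion L)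
        ((betaSet t C0 a z).image a ∪ (betaSet t C0 a z).image (fun y => t * a y))
      have e5 := Finset.card_union_le
        ((betaSet t C0 a z).image a) ((betaSet t C0 a z).image (fun y => t * a y))
      simp only [F]
      omega
    obtain ⟨x, hx⟩ : ∃ x, x ∉ F := by
      by_contra hcon
      push Not at hcon
      rw [Finset.eq_univ_iff_forall.mpr hcon, Finset.card_univ] at hF
      omega
    simp only [F, Finset.mem_union, not_or, Finset.mem_biUnion, not_exists, not_and, L,
      List.mem_toFinset, List.mem_cons, List.not_mem_nil, or_false, Finset.mem_image,
      betaSet, Finset.mem_filter, Finset.mem_compl, and_imp] at hx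
    obtain ⟨hx1, hx2, hx3⟩ := hx
    have hxz : ∀ w, x ≠ w * z⁻¹ → x * z ≠ w := by
      rintro w h rfl; simp at h
    have hS' : ∀ y ∈ S, y ≠ z → y ∈ S.erase z := fun y h h' => Finset.mem_erase.mpr ⟨h', h⟩
    refine ⟨Function.update g z x, ?_, ?_, ?_⟩
    · intro y hy y' hy' h
      by_cases e : y = z <;> by_cases e' : y' = z
      · rw [e, e']
      · subst e
        simp only [Function.update_self, Function.update_of_ne e'] at h
        exact absurd h (hx1 y' (hS' _ hy' e')).1
      · subst e'
        simp only [Function.update_self, Function.update_of_ne e] at h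
        exact absurd h.symm (hx1 y (hS' _ hy e)).1
      · simp only [Function.update_of_ne e, Function.update_of_ne e'] at h
        exact g1 _ (hS' _ hy e) _ (hS' _ hy' e') h
    · intro y hy y' hy' h
      by_cases e : y = z <;> by_cases e' : y' = z
      · rw [e, e']
      · subst e
        simp only [Function.update_self, Function.update_of_ne e'] at h
        exact absurd h (hxz _ (hx1 y' (hS' _ hy' e')).2.1)
      · subst e'
        simp only [Function.update_self, Function.update_of_ne e] at h
        exact absurd h.symm (hxz _ (hx1 y (hS' _ hy e)).2.1)
      · simp only [Function.update_of_ne e, Function.update_of_ne e'] at h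
        exact g2 _ (hS' _ hy e) _ (hS' _ hy' e') h
    · intro y hy z1 hz1 hk z2 hz2
      by_cases e : z1 = z <;> by_cases e' : z2 = z
      · subst e
        subst e'
        simp only [Function.update_self] at hk ⊢
        rcases hk with hk | hk
        · rw [← hk]
          refine ⟨htne _, ?_⟩
          intro h
          refine hx2 y hy ?_ hk
          rw [mul_assoc, h, htt]
        · rw [hk]
          refine ⟨?_, htne _⟩
          intro h
          refine hx3 y hy ?_ h.symm
          rw [hk, h]
      · subst e
        simp only [Function.update_self, Function.update_of_ne e'] at hk ⊢
        obtain ⟨f1, f2, f3, f4, f5, f6, f7, f8⟩ : _ ∧ _ := by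
          simpa only [not_or] using hx1 z2 (hS' _ hz2 e')
        rcases hk with hk | hk
        · refine ⟨?_, ?_⟩
          · intro h
            apply f3
            rw [h, htt, hk]
          · intro h
            apply f7
            rw [h, htt, hsa y hy, hk]
        · refine ⟨?_, ?_⟩
          · intro h
            apply hxz _ f8
            rw [h, htt, hra y hy, hk]
          · intro h
            apply hxz _ f4
            rw [h, htt, hk]
      · subst e'
        simp only [Function.update_self, Function.update_of_ne e] at hk ⊢
        obtain ⟨f1, f2, f3, f4, f5, f6, f7, f8⟩ : _ ∧ _ := by
          simpa only [not_or] using hx1 z1 (hS' _ hz1 e)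
        rcases hk with hk | hk
        · refine ⟨?_, ?_⟩
          · intro h
            apply f3
            rw [h, hk]
          · intro h
            apply hxz _ f5
            rw [h, ← hk, hra y hy]
        · refine ⟨?_, ?_⟩
          · intro h
            apply f6
            rw [h, ← hk, hsa y hy]
          · intro h
            apply hxz _ f4
            rw [h, hk]
      · simp only [Function.update_of_ne e, Function.update_of_ne e'] at hk ⊢
        exact g3 y hy _ (hS' _ hz1 e) hk _ (hS' _ hz2 e')

theorem finish2 {G : Type*} [Group G] [Fintype G] [DecidableEq G] (t : G) (ht : t * t = 1)
    (ht1 : t ≠ 1) (C0 : Finset G) (a : G → G)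
    (h1 : ∀ y ∉ C0, ∀ y' ∉ C0, a y = a y' → y = y')
    (h2 : ∀ y ∉ C0, ∀ y' ∉ C0, a y * y = a y' * y' → y = y')
    (hstep : ∀ S ⊆ C0, S.Nonempty → ∃ z ∈ S,
      8 * (S.card - 1) + 2 * (betaSet t C0 a z).card < Fintype.card G) : Bd G := by
  obtain ⟨g, g1, g2, g3⟩ := greedy t ht ht1 C0 a h1 h2 hstep _ C0 subset_rfl rfl
  apply finish1 t ht ht1 C0 (fun y => if y ∈ C0 then g y else a y)
  · intro y hy y' hy'
    simp only [if_neg hy, if_neg hy']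
    exact h1 y hy y' hy'
  · intro y hy y' hy'
    simp only [if_neg hy, if_neg hy']
    exact h2 y hy y' hy'
  · intro y hy y' hy'
    simp only [if_pos hy, if_pos hy']
    exact g1 y hy y' hy'
  · intro y hy y' hy'
    simp only [if_pos hy, if_pos hy']
    exact g2 y hy y' hy'
  · intro y hy z1 hz1 hk z2 hz2
    simp only [if_pos hz1, if_pos hz2, if_neg hy] at hk ⊢
    exact g3 y hy z1 hz1 hk z2 hz2


/-- conjugacy class as a finset -/
def conjCl {G : Type*} [Group G] [Fintype G] [DecidableEq G] (t : G) : Finset G :=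
  Finset.univ.image (fun g => g * t * g⁻¹)

theorem general0 {G : Type*} [Group G] [Fintype G] [DecidableEq G] (t : G) (ht : t * t = 1)
    (ht1 : t ≠ 1) (C0 : Finset G) (a : G → G)
    (h1 : ∀ y ∉ C0, ∀ y' ∉ C0, a y = a y' → y = y')
    (h2 : ∀ y ∉ C0, ∀ y' ∉ C0, a y * y = a y' * y' → y = y')
    (harith : ∀ i β, 1 ≤ i → i ≤ C0.card →
      β ≤ (conjCl t).card → (conjCl t).card * (i * β) ≤ C0.card * (Fintype.card G - C0.card) →
      8 * (i - 1) + 2 * β < Fintype.card G) : Bd G := by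
  have hsum : ∑ t' ∈ conjCl t, ∑ z ∈ C0, (betaSet t' C0 a z).card ≤
      C0.card * (Fintype.card G - C0.card) := by
    rw [Finset.sum_comm, ← Finset.card_compl, ← smul_eq_mul]
    apply Finset.sum_le_card_nsmul
    intro z hz
    rw [← Finset.card_biUnion]
    · apply Finset.card_le_card
      intro y hy
      simp only [Finset.mem_biUnion, betaSet, Finset.mem_filter] at hy
      obtain ⟨_, _, h, _⟩ := hy
      exact h
    · intro t1 _ t2 _ hne
      rw [Function.onFun, Finset.disjoint_left]
      intro y hy hy'
      simp only [betaSet, Finset.mem_filter] at hy hy'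
      apply hne
      have := hy.2.symm.trans hy'.2
      simpa using this
  have hne : (conjCl t).Nonempty := ⟨1 * t * 1⁻¹, Finset.mem_image_of_mem _ (Finset.mem_univ _)⟩
  obtain ⟨t', ht', hmin⟩ := Finset.exists_min_image (conjCl t)
    (fun t' => ∑ z ∈ C0, (betaSet t' C0 a z).card) hne
  have hsum2 : (conjCl t).card * ∑ z ∈ C0, (betaSet t' C0 a z).card ≤
      C0.card * (Fintype.card G - C0.card) := by
    refine le_trans ?_ hsum
    rw [← smul_eq_mul]
    exact Finset.card_nsmul_le_sum _ _ _ hmin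
  simp only [conjCl, Finset.mem_image, Finset.mem_univ, true_and] at ht'
  obtain ⟨g, rfl⟩ := ht'
  refine finish2 (g * t * g⁻¹) ?_ ?_ C0 a h1 h2 ?_
  · calc g * t * g⁻¹ * (g * t * g⁻¹) = g * (t * t) * g⁻¹ := by group
      _ = 1 := by rw [ht]; group
  · intro h
    apply ht1
    have : t = g⁻¹ * (g * t * g⁻¹) * g := by group
    rw [this, h]; group
  · intro S hS hSne
    obtain ⟨z, hz, hzmin⟩ := Finset.exists_min_image S
      (fun z => (betaSet (g * t * g⁻¹) C0 a z).card) hSne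
    refine ⟨z, hz, harith S.card _ (Finset.card_pos.mpr hSne) (Finset.card_le_card hS)
      ?_ ?_⟩
    · apply Finset.card_le_card_of_injOn (fun y => y * z⁻¹)
      · intro y hy
        simp only [betaSet, Finset.coe_filter, Set.mem_ofPred_eq] at hy
        simp only [conjCl, Finset.coe_image, Set.mem_image]
        refine ⟨(a y)⁻¹ * g, by simp, ?_⟩
        have : y = (a y)⁻¹ * (a y * y) := by group
        conv_rhs => rw [this, hy.2]
        group
      · intro y _ y' _ h
        simpa using h
    · refine le_trans (Nat.mul_le_mul_left _ ?_) hsum2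
      rw [← smul_eq_mul]
      refine le_trans (Finset.card_nsmul_le_sum _ _ _ hzmin) ?_
      exact Finset.sum_le_sum_of_subset hS

theorem general {G : Type*} [Group G] [Fintype G] [DecidableEq G] (t : G) (ht : t * t = 1)
    (ht1 : t ≠ 1) (harith : ∀ c i β, c * (c + 1) ≤ Fintype.card G → 1 ≤ i → i ≤ c →
      β ≤ (conjCl t).card → (conjCl t).card * (i * β) ≤ c * (Fintype.card G - c) →
      8 * (i - 1) + 2 * β < Fintype.card G) : Bd G := by
  obtain ⟨C0, a, hc, h1, h2⟩ := exists_near (G := G)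
  exact general0 t ht ht1 C0 a h1 h2 (fun i β => harith _ i β hc)

theorem conjCl_card {G : Type*} [Group G] [Fintype G] [DecidableEq G] (t : G) :
    (conjCl t).card = (Subgroup.centralizer {t}).index := by
  have e : ((conjCl t : Finset G) : Set G) = MulAction.orbit (ConjAct G) t := by
    ext x
    simp only [conjCl, Finset.coe_image, Finset.coe_univ, Set.image_univ, Set.mem_range,
      MulAction.mem_orbit_iff]
    constructor
    · rintro ⟨g, rfl⟩
      exact ⟨ConjAct.toConjAct g, by simp [ConjAct.smul_def]⟩
    · rintro ⟨g, rfl⟩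
      exact ⟨ConjAct.ofConjAct g, by simp [ConjAct.smul_def]⟩
  rw [← Set.ncard_coe_finset, e, ← MulAction.index_stabilizer, ConjAct.stabilizer_eq_centralizer]
  rfl

theorem exists_invol {G : Type*} [Group G] [Fintype G] [DecidableEq G] (h : Even (Fintype.card G)) :
    ∃ t : G, t * t = 1 ∧ t ≠ 1 ∧ Odd (conjCl t).card ∧ (conjCl t).card ∣ Fintype.card G := by
  have : Fact (Nat.Prime 2) := ⟨Nat.prime_two⟩
  obtain ⟨P⟩ : Nonempty (Sylow 2 G) := inferInstance
  have hP1 : Nontrivial (P : Subgroup G) := by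
    have := P.dvd_card_of_dvd_card (by rw [Nat.card_eq_fintype_card]; exact h.two_dvd)
    have hc : 1 < Nat.card (P : Subgroup G) :=
      lt_of_lt_of_le one_lt_two (Nat.le_of_dvd Nat.card_pos this)
    exact (Finite.one_lt_card_iff_nontrivial).mp hc
  have hZ : Nontrivial (Subgroup.center (P : Subgroup G)) := P.isPGroup'.center_nontrivial
  have hZp : IsPGroup 2 (Subgroup.center (P : Subgroup G)) := P.isPGroup'.to_subgroup _
  obtain ⟨n, hn, hcard⟩ := (hZp.nontrivial_iff_card).mp hZ
  obtain ⟨z, hz⟩ := exists_prime_orderOf_dvd_card' (G := Subgroup.center (P : Subgroup G)) 2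
    (by rw [hcard]; exact dvd_pow_self 2 (by omega))
  have hz2 : z * z = 1 := by
    have := pow_orderOf_eq_one z
    rwa [hz, sq] at this
  have hz1 : z ≠ 1 := by rintro rfl; simp at hz
  refine ⟨((z : (P : Subgroup G)) : G), ?_, ?_, ?_, ?_⟩
  · exact_mod_cast congrArg (fun w : Subgroup.center (P : Subgroup G) => ((w : (P : Subgroup G)) : G)) hz2
  · intro h
    apply hz1
    exact_mod_cast h
  · rw [conjCl_card]
    have hle : (P : Subgroup G) ≤ Subgroup.centralizer {((z : (P : Subgroup G)) : G)} := by
      intro p hp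
      rw [Subgroup.mem_centralizer_singleton_iff]
      have := (Subgroup.mem_center_iff.mp z.2) ⟨p, hp⟩
      have := congrArg (fun w : (P : Subgroup G) => (w : G)) this
      simpa using this
    have h1 := Subgroup.index_dvd_of_le hle
    have h2 := P.not_dvd_index
    rw [← Nat.not_even_iff_odd, even_iff_two_dvd]
    exact fun h => h2 (h.trans h1)
  · rw [conjCl_card, ← Nat.card_eq_fintype_card]
    exact Subgroup.index_dvd_card _

/-- exceptional orders -/
def excL : List ℕ := [2, 6, 8, 10, 12, 14, 16, 18, 20, 22, 24, 26, 28, 30, 32, 34, 36, 40, 42, 44, 50, 56]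

/-- arithmetic check -/
def chkA (n D c i : ℕ) : Bool :=
  Nat.blt D ((n + 1 - 8 * (i - 1)) / 2) ||
    Nat.blt (c * (n - c)) (D * (i * ((n + 1 - 8 * (i - 1)) / 2)))

/-- arithmetic check -/
def chkB (n D : ℕ) : Bool :=
  !(Nat.beq (n % D) 0) || !(Nat.beq (D % 2) 1) || (List.range 17).all fun c =>
    Nat.blt n (c * (c + 1)) || (List.range c).all fun i => chkA n D c (i + 1)

theorem arith_small0 : ((List.range 272).all fun n => !(Nat.beq (n % 2) 0) || Nat.beq n 0 ||
    excL.elem n || (List.range n).all fun D => chkB n (D + 1)) = true := by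
  decide +kernel

theorem arith_small (n : ℕ) (hn : n < 272) (h1 : 1 ≤ n) (h2 : n % 2 = 0) (h3 : n ∉ excL) (D : ℕ)
    (hD : D < n + 1) (hD1 : n % D = 0) (hD2 : D % 2 = 1) (c : ℕ) (hc : c < 17)
    (hc2 : c * (c + 1) ≤ n) (i : ℕ) (hi : i < c + 1) (hi1 : 1 ≤ i) :
      (D < (n + 1 - 8 * (i - 1)) / 2 ∨
        c * (n - c) < D * (i * ((n + 1 - 8 * (i - 1)) / 2))) := by
  have h := arith_small0
  rw [List.all_eq_true] at h
  have h := h n (List.mem_range.mpr hn)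
  simp only [Bool.or_eq_true, Bool.not_eq_true', List.all_eq_true,
    List.elem_eq_mem, decide_eq_true_eq, h3, or_false] at h
  rcases h with (h | h) | h
  · rw [h2] at h; simp at h
  · have := Nat.eq_of_beq_eq_true h
    omega
  · have h := h (D - 1) (List.mem_range.mpr (by omega))
    rw [show D - 1 + 1 = D by omega] at h
    simp only [chkB, hD1, hD2, Bool.or_eq_true, Bool.not_eq_true', List.all_eq_true] at h
    rcases h with (h | h) | h
    · simp at h
    · simp at h
    · rcases h c (List.mem_range.mpr hc) with h | h
      · have := Nat.blt_eq.mp h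
        omega
      · have h := h (i - 1) (List.mem_range.mpr (by omega))
        rw [show i - 1 + 1 = i by omega] at h
        simpa only [chkA, Bool.or_eq_true, Nat.blt_eq] using h

theorem arith (n D : ℕ) (hn1 : 1 ≤ n) (hn : Even n) (hD : Odd D) (hDn : D ∣ n) (hL : n ∉ excL) :
    ∀ c i β, c * (c + 1) ≤ n → 1 ≤ i → i ≤ c →
      β ≤ D → D * (i * β) ≤ c * (n - c) → 8 * (i - 1) + 2 * β < n := by
  intro c i β hc hi hic hβ h
  by_contra hcon
  push Not at hcon
  rcases lt_or_ge n 272 with hlt | hge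
  · have := arith_small n hlt hn1 (Nat.even_iff.mp hn) hL D
      (Nat.lt_succ_of_le (Nat.le_of_dvd hn1 hDn)) (Nat.mod_eq_zero_of_dvd hDn) (Nat.odd_iff.mp hD) c
      (by by_contra h; nlinarith) hc i (by omega) hi
    have hb : (n + 1 - 8 * (i - 1)) / 2 ≤ β := by omega
    rcases this with h' | h'
    · omega
    · have : D * (i * ((n + 1 - 8 * (i - 1)) / 2)) ≤ D * (i * β) := by gcongr
      omega
  · have h16 : 16 * c < n := by
      rcases le_or_gt c 16 with h | h
      · omega
      · nlinarith
    have h4 : n < 4 * β := by omega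
    have h5 : β * β ≤ c * (n - c) := by
      refine le_trans ?_ h
      calc β * β ≤ D * β := by gcongr
        _ ≤ D * (i * β) := by
          gcongr
          exact Nat.le_mul_of_pos_left β hi
    have h6 : c * (n - c) ≤ c * n := by gcongr; omega
    nlinarith

theorem main_large {G : Type*} [Group G] [Finite G] (h : Even (Nat.card G))
    (hL : Nat.card G ∉ excL) : Bd G := by
  classical
  have : Fintype G := Fintype.ofFinite G
  rw [Nat.card_eq_fintype_card] at h hL
  obtain ⟨t, ht, ht1, hodd, hdvd⟩ := exists_invol h
  exact general t ht ht1 (arith _ _ Fintype.card_pos h hodd hdvd hL)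

/-- one missing column suffices -/
theorem bd_of_near {G : Type*} [Group G] [Finite G] (h : Even (Nat.card G)) (h4 : 3 ≤ Nat.card G)
    (z : G) (a : G → G) (h1 : ∀ y, y ≠ z → ∀ y', y' ≠ z → a y = a y' → y = y')
    (h2 : ∀ y, y ≠ z → ∀ y', y' ≠ z → a y * y = a y' * y' → y = y') : Bd G := by
  classical
  have : Fintype G := Fintype.ofFinite G
  rw [Nat.card_eq_fintype_card] at h h4
  obtain ⟨t, ht, ht1, hodd, hdvd⟩ := exists_invol h
  refine general0 t ht ht1 {z} a ?_ ?_ ?_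
  · simpa using h1
  · simpa using h2
  · intro i β hi hi' hβ hβ'
    simp only [Finset.card_singleton] at hi' hβ'
    have : i = 1 := by omega
    subst this
    obtain ⟨k, hk⟩ := hodd
    rcases Nat.eq_zero_or_pos k with rfl | hk0
    · omega
    · have : 2 * β ≤ (conjCl t).card * β := Nat.mul_le_mul_right _ (by omega)
      rw [one_mul] at hβ'
      omega


theorem mod_aux (n u v : ℕ) (hu : u < 2 * n) (hv : v < 2 * n) (h : u ≡ v [MOD n]) :
    u = v ∨ u = v + n ∨ v = u + n := by
  have key : ∀ u, u < 2 * n → u % n = u ∧ u < n ∨ u % n = u - n ∧ n ≤ u := by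
    intro u hu
    rcases lt_or_ge u n with h | h
    · left; exact ⟨Nat.mod_eq_of_lt h, h⟩
    · right; rw [Nat.mod_eq_sub_mod h]; exact ⟨Nat.mod_eq_of_lt (by omega), h⟩
  unfold Nat.ModEq at h
  rcases key u hu with h1 | h1 <;> rcases key v hv with h2 | h2 <;> omega

theorem bd_cyclic {G : Type*} [Group G] [Finite G] [IsCyclic G] (m : ℕ) (hm : 2 ≤ m)
    (hcard : Nat.card G = 2 * m) : Bd G := by
  classical
  have : Fintype G := Fintype.ofFinite G
  have hcard' : Fintype.card G = 2 * m := by rw [← hcard, Nat.card_eq_fintype_card]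
  obtain ⟨g, hg⟩ := IsCyclic.exists_generator (α := G)
  have hord : orderOf g = 2 * m := by rw [orderOf_eq_card_of_forall_mem_zpowers hg, hcard]
  have hix : ∀ y : G, ∃ i, i < 2 * m ∧ g ^ i = y := by
    intro y
    have := (mem_powers_iff_mem_zpowers.mpr (hg y))
    rw [mem_powers_iff_mem_range_orderOf, hord] at this
    obtain ⟨i, hi, h⟩ := Finset.mem_image.mp this
    exact ⟨i, Finset.mem_range.mp hi, h⟩
  choose ix hlt hix using hix
  have hpow : ∀ u v, u < 4 * m → v < 4 * m → g ^ u = g ^ v → u = v ∨ u = v + 2 * m ∨ v = u + 2 * m := by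
    intro u v hu hv h
    rw [pow_eq_pow_iff_modEq, hord] at h
    exact mod_aux (2 * m) u v (by omega) (by omega) h
  let e : G → ℕ := fun y => if ix y < m then ix y else ix y + 1
  have he : ∀ y, (ix y < m ∧ e y = ix y) ∨ (m ≤ ix y ∧ e y = ix y + 1) := by
    intro y
    by_cases h : ix y < m
    · exact Or.inl ⟨h, if_pos h⟩
    · exact Or.inr ⟨by omega, if_neg h⟩
  have hC : ∀ y, y ≠ g ^ (2 * m - 1) → ix y ≠ 2 * m - 1 := by
    intro y hy h
    apply hy
    rw [← h, hix]
  have hfin : ∀ y y', ix y = ix y' → y = y' := by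
    intro y y' h
    rw [← hix y, h, hix]
  clear_value e
  refine bd_of_near ?_ ?_ (g ^ (2 * m - 1)) (fun y => g ^ e y) ?_ ?_
  · rw [hcard]; exact even_two_mul m
  · omega
  · intro y hy y' hy' h
    apply hfin
    have a1 := hC y hy; have a2 := hC y' hy'; have a3 := he y; have a4 := he y'
    have a5 := hlt y; have a6 := hlt y'
    have := hpow _ _ (by omega) (by omega) h
    omega
  · intro y hy y' hy' h
    apply hfin
    have a1 := hC y hy; have a2 := hC y' hy'; have a3 := he y; have a4 := he y'
    have a5 := hlt y; have a6 := hlt y'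
    have h : g ^ (e y + ix y) = g ^ (e y' + ix y') := by
      rw [pow_add, pow_add, hix, hix]; exact h
    have := hpow _ _ (by omega) (by omega) h
    omega

theorem bd_dihedral {G : Type*} [Group G] [Finite G] (k : ℕ) (hk : 1 ≤ k)
    (hcard : Nat.card G = 2 * (2 * k + 1)) (v t : G) (hv : orderOf v = 2 * k + 1) (ht : t * t = 1)
    (htv : t ∉ Subgroup.zpowers v) (hconj : t * v * t⁻¹ = v⁻¹) : Bd G := by
  classical
  have : Fintype G := Fintype.ofFinite G
  let E : ℤ → Bool → G := fun i b => v ^ i * (if b then t else 1)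
  have hti : t⁻¹ = t := inv_eq_of_mul_eq_one_left ht
  have hz : ∀ i : ℤ, t * v ^ i = v ^ (-i) * t := by
    intro i
    have : t * v ^ i * t⁻¹ = v ^ (-i) := by
      rw [← conj_zpow, hconj, inv_zpow, zpow_neg]
    rw [← this]; group
  have hmul : ∀ i b j b', E i b * E j b' = E (i + if b then -j else j) (xor b b') := by
    intro i b j b'
    cases b <;> cases b' <;> simp [E, zpow_add, mul_assoc, hz]
    rw [← mul_assoc, hz, mul_assoc, ht]; simp
  have hdvd : ∀ i j : ℤ, v ^ i = v ^ j → (2 * (k : ℤ) + 1) ∣ i - j := by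
    intro i j h
    rw [zpow_eq_zpow_iff_modEq, hv] at h
    have := h.symm.dvd
    exact_mod_cast this
  have hinj : ∀ i b j b', E i b = E j b' → b = b' ∧ (2 * (k : ℤ) + 1) ∣ i - j := by
    intro i b j b' h
    cases b <;> cases b' <;> simp [E] at h ⊢
    · exact hdvd _ _ h
    · apply htv
      refine ⟨-j + i, ?_⟩
      simp only [zpow_add, h]
      simp
    · apply htv
      refine ⟨-i + j, ?_⟩
      simp only [zpow_add, ← h]
      simp
    · exact hdvd _ _ h
  have hsmall : ∀ w : ℤ, (2 * (k : ℤ) + 1) ∣ w → -(2 * (k : ℤ) + 1) < w → w < 2 * (k : ℤ) + 1 → w = 0 := by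
    intro w h h1 h2
    exact Int.eq_zero_of_abs_lt_dvd h (abs_lt.mpr ⟨h1, h2⟩)
  have htwo : ∀ w : ℤ, (2 * (k : ℤ) + 1) ∣ 2 * w → (2 * (k : ℤ) + 1) ∣ w := by
    intro w h
    have hcop : IsCoprime (2 * (k : ℤ) + 1) 2 := ⟨1, -k, by ring⟩
    exact hcop.dvd_of_dvd_mul_left h
  -- parametrization
  have hsurj : Function.Surjective (fun p : Fin (2 * k + 1) × Bool => E p.1 p.2) := by
    have hi : Function.Injective (fun p : Fin (2 * k + 1) × Bool => E p.1 p.2) := by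
      rintro ⟨i, b⟩ ⟨j, b'⟩ h
      obtain ⟨h1, h2⟩ := hinj _ _ _ _ h
      have hi := i.2
      have hj := j.2
      have := hsmall _ h2 (by simp only; omega) (by simp only; omega)
      simp only [Prod.mk.injEq]
      exact ⟨Fin.ext (by simp only at this; omega), h1⟩
    refine ((Fintype.bijective_iff_injective_and_card _).mpr ⟨hi, ?_⟩).2
    rw [← Nat.card_eq_fintype_card (α := G), hcard]
    simp
    ring
  have hparam : ∀ y : G, ∃ (i : ℤ) (b : Bool), 0 ≤ i ∧ i < 2 * k + 1 ∧ E i b = y := by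
    intro y
    obtain ⟨⟨i, b⟩, h⟩ := hsurj y
    exact ⟨i, b, by omega, by have := i.2; omega, h⟩
  choose ix ty h0 h1 hE using hparam
  have hfin : ∀ y y', ix y = ix y' → ty y = ty y' → y = y' := by
    intro y y' h h'
    rw [← hE y, h, h', hE]
  let a : G → G := fun y => if (ix y < k ↔ ty y = false) then E (ix y) false else E (-ix y - 2) true
  have ha : ∀ y, (ix y < k ∧ ty y = false ∧ a y = E (ix y) false ∧ a y * y = E (2 * ix y) false) ∨
      (k ≤ ix y ∧ ty y = false ∧ a y = E (-ix y - 2) true ∧ a y * y = E (-2 * ix y - 2) true) ∨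
      (k ≤ ix y ∧ ty y = true ∧ a y = E (ix y) false ∧ a y * y = E (2 * ix y) true) ∨
      (ix y < k ∧ ty y = true ∧ a y = E (-ix y - 2) true ∧ a y * y = E (-2 * ix y - 2) false) := by
    intro y
    have key : ∀ i b j b' b'', E i b = a y → ty y = b' → b'' = xor b b' →
        j = (i + if b then -(ix y) else ix y) → a y * y = E j b'' := by
      intro i b j b' b'' h h' h'' hj
      rw [← h]
      calc E i b * y = E i b * E (ix y) (ty y) := by rw [hE]
        _ = _ := by rw [hmul, hj, h'', h']
    by_cases c1 : ix y < k <;> cases c2 : ty y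
    · have hay : a y = E (ix y) false := by simp [a, c1, c2]
      exact Or.inl ⟨c1, rfl, hay, key _ _ _ _ _ hay.symm c2 rfl (by simp; ring)⟩
    · have hay : a y = E (-ix y - 2) true := by simp [a, c1, c2]
      exact Or.inr (Or.inr (Or.inr ⟨c1, rfl, hay, key _ _ _ _ _ hay.symm c2 rfl (by simp; ring)⟩))
    · have hay : a y = E (-ix y - 2) true := by simp [a, c1, c2]
      exact Or.inr (Or.inl ⟨by omega, rfl, hay, key _ _ _ _ _ hay.symm c2 rfl (by simp; ring)⟩)
    · have hay : a y = E (ix y) false := by simp [a, c1, c2]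
      exact Or.inr (Or.inr (Or.inl ⟨by omega, rfl, hay, key _ _ _ _ _ hay.symm c2 rfl (by simp; ring)⟩))
  clear_value a E
  have hC : ∀ y, y ≠ E k true → ty y = true → ix y ≠ k := by
    intro y hy h1 h2
    apply hy
    rw [← hE y, h1, h2]
  refine bd_of_near (by rw [hcard]; exact even_two_mul _) (by omega) (E k true) a ?_ ?_
  · intro y hy y' hy' h
    have b1 := h0 y; have b2 := h1 y; have b3 := h0 y'; have b4 := h1 y'
    rcases ha y with ⟨c1, c2, c3, -⟩ | ⟨c1, c2, c3, -⟩ | ⟨c1, c2, c3, -⟩ | ⟨c1, c2, c3, -⟩ <;>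
    rcases ha y' with ⟨d1, d2, d3, -⟩ | ⟨d1, d2, d3, -⟩ | ⟨d1, d2, d3, -⟩ | ⟨d1, d2, d3, -⟩ <;>
    rw [c3, d3] at h <;> obtain ⟨e1, e2⟩ := hinj _ _ _ _ h <;>
    first
    | (exfalso; simp at e1; done)
    | (have e3 := hsmall _ e2 (by omega) (by omega)
       first
       | (exfalso; omega)
       | exact hfin _ _ (by omega) (c2.trans d2.symm))
  · intro y hy y' hy' h
    have b1 := h0 y; have b2 := h1 y; have b3 := h0 y'; have b4 := h1 y'
    have b5 := hC y hy; have b6 := hC y' hy'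
    have T1 : ∀ i j : ℤ, (2 * (k : ℤ) + 1) ∣ 2 * i - 2 * j → 0 ≤ i → i < 2 * k + 1 → 0 ≤ j →
        j < 2 * k + 1 → i = j := by
      intro i j h _ _ _ _
      have := hsmall (i - j) (htwo _ (by rw [mul_sub]; exact h)) (by omega) (by omega)
      omega
    have T2 : ∀ i j : ℤ, (2 * (k : ℤ) + 1) ∣ -2 * i - 2 - (-2 * j - 2) → 0 ≤ i → i < 2 * k + 1 → 0 ≤ j →
        j < 2 * k + 1 → i = j := by
      intro i j h h1 h2 h3 h4
      refine (T1 j i ?_ h3 h4 h1 h2).symm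
      convert h using 1; ring
    have T3 : ∀ i j : ℤ, (2 * (k : ℤ) + 1) ∣ 2 * i - (-2 * j - 2) → 0 ≤ i → i < 2 * k + 1 → 0 ≤ j →
        j < 2 * k + 1 → i + j = 2 * k := by
      intro i j h h1 h2 h3 h4
      have h5 : (2 * (k : ℤ) + 1) ∣ i + j + 1 := htwo _ (by convert h using 1; ring)
      have h6 : (2 * (k : ℤ) + 1) ∣ i + j + 1 - (2 * k + 1) := dvd_sub h5 dvd_rfl
      have := hsmall _ h6 (by omega) (by omega)
      omega
    have T4 : ∀ i j : ℤ, (2 * (k : ℤ) + 1) ∣ -2 * j - 2 - 2 * i → 0 ≤ i → i < 2 * k + 1 → 0 ≤ j →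
        j < 2 * k + 1 → i + j = 2 * k := by
      intro i j h h1 h2 h3 h4
      refine T3 i j ?_ h1 h2 h3 h4
      have h' := dvd_neg.mpr h
      rwa [show -(-2 * j - 2 - 2 * i) = 2 * i - (-2 * j - 2) by ring] at h'
    rcases ha y with ⟨c1, c2, -, c3⟩ | ⟨c1, c2, -, c3⟩ | ⟨c1, c2, -, c3⟩ | ⟨c1, c2, -, c3⟩ <;>
    rcases ha y' with ⟨d1, d2, -, d3⟩ | ⟨d1, d2, -, d3⟩ | ⟨d1, d2, -, d3⟩ | ⟨d1, d2, -, d3⟩ <;>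
    rw [c3, d3] at h <;> obtain ⟨e1, e2⟩ := hinj _ _ _ _ h <;>
    first
    | (exfalso; simp at e1; done)
    | exact hfin _ _ (T1 _ _ e2 b1 b2 b3 b4) (c2.trans d2.symm)
    | exact hfin _ _ (T2 _ _ e2 b1 b2 b3 b4) (c2.trans d2.symm)
    | (exfalso
       have e3 := T3 _ _ e2 b1 b2 b3 b4
       simp only [c2, d2] at b5 b6
       simp at b5 b6
       omega)
    | (exfalso
       have e3 := T4 _ _ e2 b3 b4 b1 b2
       simp only [c2, d2] at b5 b6
       simp at b5 b6
       omega)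


theorem CM_of_param {G : Type*} [Group G] {X : Type*} (E : X → G) (hE : Function.Bijective E)
    (m : X → X → X) (hm : ∀ x y, E x * E y = E (m x y)) (φ : X → X) (h1 : Function.Injective φ)
    (h2 : Function.Injective (fun x => m (φ x) x)) : CM G := by
  let e := Equiv.ofBijective E hE
  have he : ∀ y, E (e.symm y) = y := fun y => e.apply_symm_apply y
  refine ⟨fun y => E (φ (e.symm y)), ?_, ?_⟩
  · intro y y' h
    exact e.symm.injective (h1 (hE.1 h))
  · intro y y' h
    apply e.symm.injective
    apply h2
    apply hE.1
    simp only [← hm, he]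
    exact h

theorem CM_V4 {G : Type*} [Group G] [Finite G] (hc : Nat.card G = 4) (h2 : ∀ x : G, x * x = 1) :
    CM G := by
  classical
  have : Fintype G := Fintype.ofFinite G
  rw [Nat.card_eq_fintype_card] at hc
  have hinv : ∀ x : G, x⁻¹ = x := fun x => inv_eq_of_mul_eq_one_left (h2 x)
  have hcomm : ∀ x y : G, x * y = y * x := by
    intro x y
    have := hinv (x * y)
    rw [mul_inv_rev, hinv, hinv] at this
    exact this.symm
  have hex : ∀ S : Finset G, S.card < 4 → ∃ x, x ∉ S := by
    intro S hS
    by_contra hcon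
    push Not at hcon
    rw [Finset.eq_univ_iff_forall.mpr hcon, Finset.card_univ] at hS
    omega
  obtain ⟨a, ha⟩ := hex {1} (by simp)
  obtain ⟨b, hb⟩ := hex {1, a} (lt_of_le_of_lt Finset.card_le_two (by norm_num))
  simp only [Finset.mem_singleton, Finset.mem_insert, not_or] at ha hb
  have hab : a * b ≠ 1 := fun h => hb.2 (by rw [← hinv a]; exact (inv_eq_of_mul_eq_one_right h).symm)
  let E : Bool × Bool → G := fun p => (if p.1 then a else 1) * (if p.2 then b else 1)
  have hinj : Function.Injective E := by
    rintro ⟨i, j⟩ ⟨i', j'⟩ h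
    cases i <;> cases j <;> cases i' <;> cases j' <;> simp [E] at h <;> grind
  refine CM_of_param E ((Fintype.bijective_iff_injective_and_card _).mpr ⟨hinj, ?_⟩)
    (fun x y => (xor x.1 y.1, xor x.2 y.2)) ?_ (fun p => (p.2, xor p.1 p.2)) (by decide) (by decide)
  · rw [hc]; rfl
  · rintro ⟨i, j⟩ ⟨i', j'⟩
    have e1 := hcomm b a
    have e2 := h2 a
    have e3 := h2 b
    have e4 : ∀ w, a * (a * w) = w := fun w => by rw [← mul_assoc, h2, one_mul]
    cases i <;> cases j <;> cases i' <;> cases j' <;> simp [E, e1, e2, e3, mul_assoc, e4]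
    · rw [← mul_assoc, e1, mul_assoc, e3, mul_one]
    · rw [← mul_assoc b a b, e1, mul_assoc, e3, mul_one, e2]

/-- multiplication of groups of order 8 -/
def mul8 (α β γ : Bool) (x y : Bool × Bool × Bool) : Bool × Bool × Bool :=
  (xor x.1 y.1, xor x.2.1 y.2.1, xor (xor x.2.2 y.2.2)
    (xor (α && (x.1 && y.1)) (xor (β && (x.2.1 && y.2.1)) (γ && (x.2.1 && y.1)))))

/-- complete mapping of groups of order 8 -/
def phi8 (β γ : Bool) (x : Bool × Bool × Bool) : Bool × Bool × Bool :=
  match x with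
  | (false, false, false) => (true, true, false)
  | (false, false, true) => (false, true, true)
  | (false, true, false) => (false, false, true)
  | (false, true, true) => (true, false, false)
  | (true, false, false) => (true, false, true)
  | (true, false, true) => (false, false, false)
  | (true, true, k) => if xor k (xor β γ) then (true, true, true) else (false, true, false)

theorem phi8_inj : ∀ β γ, Function.Injective (phi8 β γ) := by decide

theorem phi8_inj2 : ∀ α β γ, Function.Injective (fun x => mul8 α β γ (phi8 β γ x) x) := by
  decide +kernel

theorem CM_8 {G : Type*} [Group G] [Finite G] (hc : Nat.card G = 8) (M : Subgroup G) [M.Normal]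
    (hM : Nat.card M = 2) (h2 : ∀ x : G, x * x ∈ M) : CM G := by
  classical
  have : Fintype G := Fintype.ofFinite G
  rw [Nat.card_eq_fintype_card] at hc
  obtain ⟨t, ht1, htM⟩ : ∃ t : G, t ≠ 1 ∧ ∀ x, x ∈ M ↔ x = 1 ∨ x = t := by
    obtain ⟨x, y, hxy, hu⟩ := Nat.card_eq_two_iff.mp hM
    have hall : ∀ z : M, z = x ∨ z = y := by
      intro z
      have : z ∈ ({x, y} : Set M) := by rw [hu]; trivial
      simpa using this
    rcases hall 1 with h | h
    · refine ⟨y, fun hy => hxy (h.symm.trans (Subtype.ext hy.symm)), fun z => ⟨fun hz => ?_, ?_⟩⟩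
      · rcases hall ⟨z, hz⟩ with h' | h'
        · left; rw [← h] at h'; exact congrArg Subtype.val h'
        · right; exact congrArg Subtype.val h'
      · rintro (rfl | rfl)
        · exact M.one_mem
        · exact y.2
    · refine ⟨x, fun hy => hxy ((Subtype.ext hy : x = 1).trans h), fun z => ⟨fun hz => ?_, ?_⟩⟩
      · rcases hall ⟨z, hz⟩ with h' | h'
        · right; exact congrArg Subtype.val h'
        · left; rw [← h] at h'; exact congrArg Subtype.val h'
      · rintro (rfl | rfl)
        · exact M.one_mem
        · exact x.2
  have htt : t * t = 1 := by
    rcases (htM _).mp (M.mul_mem ((htM t).mpr (Or.inr rfl)) ((htM t).mpr (Or.inr rfl))) with h | h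
    · exact h
    · exact absurd (by simpa using h) ht1
  have hcen : ∀ x, x * t = t * x := by
    intro x
    have := (‹M.Normal›).conj_mem t ((htM t).mpr (Or.inr rfl)) x
    rcases (htM _).mp this with h | h
    · exact absurd (by simpa using h) ht1
    · exact mul_inv_eq_iff_eq_mul.mp h
  have hex : ∀ S : Finset G, S.card < 8 → ∃ x, x ∉ S := by
    intro S hS
    by_contra hcon
    push Not at hcon
    rw [Finset.eq_univ_iff_forall.mpr hcon, Finset.card_univ] at hS
    omega
  let T : Bool → G := fun b => if b then t else 1
  have hT : ∀ x, x ∈ M → ∃ b, x = T b := by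
    intro x hx
    rcases (htM x).mp hx with rfl | rfl
    · exact ⟨false, rfl⟩
    · exact ⟨true, rfl⟩
  obtain ⟨a, ha⟩ := hex {1, t} (lt_of_le_of_lt Finset.card_le_two (by norm_num))
  obtain ⟨b, hb⟩ := hex {1, t, a, a * t} (lt_of_le_of_lt Finset.card_le_four (by norm_num))
  simp only [Finset.mem_singleton, Finset.mem_insert, not_or] at ha hb
  obtain ⟨α, hα⟩ := hT _ (h2 a)
  obtain ⟨β, hβ⟩ := hT _ (h2 b)
  obtain ⟨γ, hγ⟩ : ∃ γ, b * a = a * b * T γ := by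
    have h3 : (a * b)⁻¹ * (b * a) ∈ M := by
      have e : (a * b)⁻¹ * (b * a) = ((a * b)⁻¹ * (a * b)⁻¹) * (a * (b * b) * a⁻¹) * (a * a) := by group
      rw [e]
      refine M.mul_mem (M.mul_mem (h2 _) ((‹M.Normal›).conj_mem _ (h2 b) a)) (h2 a)
    obtain ⟨γ, h⟩ := hT _ h3
    exact ⟨γ, by rw [← h]; group⟩
  have hTc : ∀ k x, T k * x = x * T k := by
    intro k x
    cases k <;> simp [T, hcen]
  have hTT : ∀ k l, T k * T l = T (xor k l) := by
    intro k l
    cases k <;> cases l <;> simp [T, htt]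
  let A : Bool → G := fun i => if i then a else 1
  let B : Bool → G := fun i => if i then b else 1
  have hAA : ∀ i j, A i * A j = A (xor i j) * T (α && (i && j)) := by
    intro i j
    cases i <;> cases j <;> simp [A, hα]
    all_goals simp [T]
  have hBB : ∀ i j, B i * B j = B (xor i j) * T (β && (i && j)) := by
    intro i j
    cases i <;> cases j <;> simp [B, hβ]
    all_goals simp [T]
  have hBA : ∀ i j, B i * A j = A j * B i * T (γ && (i && j)) := by
    intro i j
    cases i <;> cases j <;> simp [A, B, hγ]
    all_goals simp [T]
  let E : Bool × Bool × Bool → G := fun p => A p.1 * B p.2.1 * T p.2.2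
  have hmul : ∀ x y, E x * E y = E (mul8 α β γ x y) := by
    rintro ⟨i, j, k⟩ ⟨i', j', k'⟩
    simp only [E, mul8]
    calc A i * B j * T k * (A i' * B j' * T k')
        = A i * B j * (T k * (A i' * B j')) * T k' := by group
      _ = A i * (B j * A i') * B j' * T k * T k' := by rw [hTc]; group
      _ = A i * A i' * B j * (T (γ && (j && i')) * B j') * T k * T k' := by rw [hBA]; group
      _ = A i * A i' * (B j * B j') * T (γ && (j && i')) * T k * T k' := by rw [hTc]; group
      _ = A (xor i i') * (T (α && (i && i')) * B (xor j j')) * T (β && (j && j')) *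
          T (γ && (j && i')) * T k * T k' := by rw [hAA, hBB]; group
      _ = A (xor i i') * B (xor j j') * (T (α && (i && i')) * T (β && (j && j')) *
          T (γ && (j && i')) * T k * T k') := by rw [hTc]; group
      _ = _ := by
        rw [hTT, hTT, hTT, hTT]
        congr 2
        generalize (α && (i && i')) = u
        generalize (β && (j && j')) = v
        generalize (γ && (j && i')) = w
        revert u v w k k'
        decide
  have hinj : Function.Injective E := by
    have cancelT : ∀ x y k k', x * T k = y * T k' → y = x ∨ y = x * t := by
      intro x y k k' h
      have : y = x * T (xor k k') := by
        have h' := congrArg (· * T k') h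
        simp only [mul_assoc, hTT] at h'
        simpa [T] using h'.symm
      rw [this]
      cases (xor k k') <;> simp [T]
    rintro ⟨i, j, k⟩ ⟨i', j', k'⟩ h
    have h' := cancelT _ _ _ _ h
    have hij : i = i' ∧ j = j' := by
      have c1 : ∀ x, t * (t * x) = x := fun x => by rw [← mul_assoc, htt, one_mul]
      obtain ⟨ha1, ha2⟩ := ha
      obtain ⟨hb1, hb2, hb3, hb4⟩ := hb
      have f1 : a * b ≠ 1 := by
        intro h
        have : b = a * (a * a)⁻¹ := by
          rw [eq_inv_of_mul_eq_one_right h]; group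
        rcases (htM _).mp (M.inv_mem (h2 a)) with h3 | h3 <;> rw [h3] at this
        · exact hb3 (by simpa using this)
        · exact hb4 this
      have f2 : a * b ≠ t := by
        intro h
        have : b = a * ((a * a)⁻¹ * t) := by
          rw [← h]; group
        rcases (htM _).mp (M.mul_mem (M.inv_mem (h2 a)) ((htM t).mpr (Or.inr rfl))) with h3 | h3 <;>
          rw [h3] at this
        · exact hb3 (by simpa using this)
        · exact hb4 this
      have g1 : ∀ x y, x = y * t → y = x * t := by
        rintro x y rfl
        rw [mul_assoc, htt, mul_one]
      have g2 : a * b * t ≠ 1 := fun h => f2 (by have := g1 _ _ h.symm; simpa using this)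
      have g3 : a * b * t ≠ a := fun h => hb2 (by rw [mul_assoc] at h; have h' := mul_eq_left.mp h; have := g1 _ _ h'.symm; simpa using this)
      have g4 : a * b * t ≠ b := fun h => ha2 (by rw [mul_assoc, hcen, ← mul_assoc] at h; have h' := mul_eq_right.mp h; have := g1 _ _ h'.symm; simpa using this)
      have g5 : a * t ≠ a * b := fun h => hb2 (mul_left_cancel h).symm
      have g6 : b * t ≠ a * b := fun h => ha2 (by rw [hcen] at h; exact (mul_right_cancel h).symm)
      have g7 : b * t ≠ a := fun h => hb4 (g1 _ _ h.symm)
      have g8 : a * t ≠ 1 := fun h => ha2 (by have := g1 _ _ h.symm; simpa using this)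
      have g9 : b * t ≠ 1 := fun h => hb2 (by have := g1 _ _ h.symm; simpa using this)
      have h1 : ∀ i, A i = if i then a else 1 := fun _ => rfl
      have h1' : ∀ i, B i = if i then b else 1 := fun _ => rfl
      rw [h1, h1, h1', h1'] at h'
      clear h h1 h1' hmul cancelT hBA hBB hAA hTT hTc hT hγ hβ hα hex g1 c1 h2 htM hcen
      clear E A B T
      have n1 : a * b ≠ a := fun h => hb1 (mul_eq_left.mp h)
      have n2 : a * b ≠ b := fun h => ha1 (mul_eq_right.mp h)
      cases i <;> cases j <;> cases i' <;> cases j' <;>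
        first
        | exact ⟨rfl, rfl⟩
        | (exfalso
           simp only [if_true, if_false, one_mul, mul_one, Bool.false_eq_true] at h'
           rcases h' with h' | h' <;> (try have h' := h'.symm) <;> grind)
    obtain ⟨rfl, rfl⟩ := hij
    have hk : T k = T k' := mul_left_cancel h
    have : k = k' := by
      cases k <;> cases k' <;> simp [T] at hk ⊢
      · exact ht1 hk.symm
      · exact ht1 hk
    rw [this]
  exact CM_of_param E ((Fintype.bijective_iff_injective_and_card _).mpr ⟨hinj, by rw [hc]; rfl⟩)
    (mul8 α β γ) hmul (phi8 β γ) (phi8_inj β γ) (phi8_inj2 α β γ)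


universe u

def IHyp (G : Type u) [Group G] : Prop :=
  ∀ (H : Type u) [Group H] [Finite H], 3 ≤ Nat.card H → Nat.card H < Nat.card G → Bd H

theorem R1 {G : Type u} [Group G] [Finite G] (IH : IHyp G) (M : Subgroup G) [M.Normal]
    (hodd : Odd (Nat.card M)) (h1 : 1 < Nat.card M) (h3 : 3 * Nat.card M ≤ Nat.card G) : Bd G := by
  have e := M.index_mul_card
  have ei : M.index = Nat.card (G ⧸ M) := rfl
  refine bd_of_sub_CM M (IH _ ?_ ?_) (CM_of_odd hodd)
  · rw [← ei]; nlinarith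
  · rw [← ei]; nlinarith [Nat.pos_of_ne_zero M.index_ne_zero_of_finite]

theorem R2 {G : Type u} [Group G] [Finite G] (IH : IHyp G) (M : Subgroup G) [M.Normal]
    (hcm : CM (G ⧸ M)) (h1 : 1 < M.index) (h3 : 3 ≤ Nat.card M) : Bd G := by
  have e := M.index_mul_card
  refine bd_of_quot_CM M hcm (IH _ h3 ?_)
  nlinarith

theorem R2' {G : Type u} [Group G] [Finite G] (IH : IHyp G) (M : Subgroup G) [M.Normal]
    (hcm : Odd M.index) (h1 : 1 < M.index) (h3 : 3 ≤ Nat.card M) : Bd G :=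
  R2 IH M (CM_of_odd hcm) h1 h3

theorem syl_card {G : Type u} [Group G] [Finite G] (p k m : ℕ) [hp : Fact p.Prime]
    (hn : Nat.card G = p ^ k * m) (hm : ¬ p ∣ m) (P : Sylow p G) :
    Nat.card P = p ^ k ∧ (P : Subgroup G).index = m := by
  have h1 : Nat.card P = p ^ k := by
    rw [P.card_eq_multiplicity, hn, Nat.factorization_mul (pow_ne_zero _ hp.out.ne_zero)
      (by rintro rfl; simp at hm)]
    simp [Nat.factorization_eq_zero_of_not_dvd hm, hp.out.factorization]
  refine ⟨h1, ?_⟩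
  have h2 := (P : Subgroup G).card_mul_index
  rw [hn] at h2
  have h3 : Nat.card (P : Subgroup G) = p ^ k := h1
  rw [h3] at h2
  exact Nat.eq_of_mul_eq_mul_left (pow_pos hp.out.pos _) h2

theorem syl_num {G : Type u} [Group G] [Finite G] (p k m : ℕ) [hp : Fact p.Prime]
    (hn : Nat.card G = p ^ k * m) (hm : ¬ p ∣ m) :
    Nat.card (Sylow p G) ∣ m ∧ Nat.card (Sylow p G) % p = 1 := by
  obtain ⟨P⟩ : Nonempty (Sylow p G) := inferInstance
  refine ⟨(syl_card p k m hn hm P).2 ▸ P.card_dvd_index, ?_⟩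
  have := card_sylow_modEq_one p G
  unfold Nat.ModEq at this
  rw [this, Nat.mod_eq_of_lt hp.out.one_lt]

theorem syl_normal {G : Type u} [Group G] [Finite G] (p : ℕ) [Fact p.Prime]
    (h : Nat.card (Sylow p G) = 1) (P : Sylow p G) : (P : Subgroup G).Normal := by
  have := (Nat.card_eq_one_iff_unique.mp h).1
  exact P.normal_of_subsingleton

theorem R1syl {G : Type u} [Group G] [Finite G] (IH : IHyp G) (p k m : ℕ) [hp : Fact p.Prime]
    (hn : Nat.card G = p ^ k * m) (hm : ¬ p ∣ m) (h : Nat.card (Sylow p G) = 1)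
    (hodd : Odd p) (hk : 0 < k) (h3 : 3 ≤ m) : Bd G := by
  obtain ⟨P⟩ : Nonempty (Sylow p G) := inferInstance
  have := syl_normal p h P
  have hc : Nat.card (P : Subgroup G) = p ^ k := (syl_card p k m hn hm P).1
  have hlt := Nat.one_lt_pow hk.ne' hp.out.one_lt
  refine R1 IH (P : Subgroup G) (hc ▸ hodd.pow) (hc ▸ hlt) ?_
  rw [hc, hn]; nlinarith

theorem burn {G : Type u} [Group G] [Finite G] (p : ℕ) [hp : Fact p.Prime] (P : Sylow p G)
    (h : Subgroup.normalizer ((P : Subgroup G) : Set G) ≤ Subgroup.centralizer (P : Set G)) :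
    ∃ M : Subgroup G, M.Normal ∧ M.index = Nat.card P ∧ Nat.card M = (P : Subgroup G).index := by
  have hc := MonoidHom.ker_transferSylow_isComplement' P h
  refine ⟨(MonoidHom.transferSylow P h).ker, inferInstance, ?_, ?_⟩
  · exact hc.symm.index_eq_card
  · exact hc.index_eq_card.symm

theorem norm_eq {G : Type u} [Group G] [Finite G] (p k m : ℕ) [hp : Fact p.Prime]
    (hn : Nat.card G = p ^ k * m) (hm : ¬ p ∣ m) (P : Sylow p G) :
    Nat.card (Subgroup.normalizer ((P : Subgroup G) : Set G)) * Nat.card (Sylow p G) = Nat.card G := by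
  rw [P.card_eq_index_normalizer]
  exact Subgroup.card_mul_index (Subgroup.normalizer ((P : Subgroup G) : Set G))

/-- prime-order Sylow case -/
theorem R_burn {G : Type u} [Group G] [Finite G] (IH : IHyp G) (p m : ℕ) [hp : Fact p.Prime]
    (hn : Nat.card G = p ^ 1 * m) (hm : ¬ p ∣ m) (h : Nat.card (Sylow p G) = m)
    (hodd : Odd p) (h3 : 3 ≤ m) : Bd G := by
  obtain ⟨P⟩ : Nonempty (Sylow p G) := inferInstance
  have hc := syl_card p 1 m hn hm P
  have hN := norm_eq p 1 m hn hm P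
  rw [h, hn] at hN
  have hN' := Nat.eq_of_mul_eq_mul_right (by omega) hN
  have hc1 : Nat.card (P : Subgroup G) = p ^ 1 := hc.1
  have heq : (P : Subgroup G) = Subgroup.normalizer ((P : Subgroup G) : Set G) :=
    Subgroup.eq_of_le_of_card_ge Subgroup.le_normalizer (by rw [hN', hc1])
  have hcy : IsCyclic (P : Subgroup G) := isCyclic_of_prime_card (p := p) (by rw [hc1, pow_one])
  obtain ⟨M, hM, hi, hcM⟩ := burn p P (by
    rw [← heq]
    intro x hx
    rw [Subgroup.mem_centralizer_iff]
    intro y hy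
    have := hcy.isMulCommutative.is_comm.comm (⟨y, hy⟩ : (P : Subgroup G)) ⟨x, hx⟩
    exact congrArg Subtype.val this)
  rw [hc.1, pow_one] at hi
  rw [hc.2] at hcM
  exact R2' IH M (hi ▸ hodd) (hi ▸ hp.out.one_lt) (hcM ▸ h3)

theorem case_20 {G : Type u} [Group G] [Finite G] (IH : IHyp G) (p m : ℕ) (hp : p.Prime)
    (hn : Nat.card G = p ^ 1 * m) (hm : ¬ p ∣ m) (h : ∀ q ≤ m, q ∣ m → q % p = 1 → q = 1 ∨ q = m)
    (hodd : Odd p) (h3 : 3 ≤ m) : Bd G := by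
  have : Fact p.Prime := ⟨hp⟩
  have hs := syl_num p 1 m hn hm
  rcases h _ (Nat.le_of_dvd (by omega) hs.1) hs.1 hs.2 with h1 | h1
  · exact R1syl IH p 1 m hn hm h1 hodd one_pos h3
  · exact R_burn IH p m hn hm h1 hodd h3

theorem case_list1 {G : Type u} [Group G] [Finite G] (IH : IHyp G)
    (h : Nat.card G = 20 ∨ Nat.card G = 28 ∨ Nat.card G = 40 ∨ Nat.card G = 44 ∨ Nat.card G = 12 ∨
      Nat.card G = 56) : Bd G := by
  rcases h with h | h | h | h | h | h
  · exact case_20 IH 5 4 (by norm_num) h (by decide) (by decide) (by decide) (by decide)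
  · exact case_20 IH 7 4 (by norm_num) h (by decide) (by decide) (by decide) (by decide)
  · exact case_20 IH 5 8 (by norm_num) h (by decide) (by decide) (by decide) (by decide)
  · exact case_20 IH 11 4 (by norm_num) h (by decide) (by decide) (by decide) (by decide)
  · exact case_20 IH 3 4 (by norm_num) h (by decide) (by decide) (by decide) (by decide)
  · exact case_20 IH 7 8 (by norm_num) h (by decide) (by decide) (by decide) (by decide)

/-- kernel of the action on Sylow subgroups -/
theorem syl_ker {G : Type u} [Group G] [Finite G] (p : ℕ) [hp : Fact p.Prime] :
    ∃ M : Subgroup G, M.Normal ∧ M.index ∣ (Nat.card (Sylow p G)).factorial ∧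
      Nat.card (Sylow p G) ∣ M.index := by
  obtain ⟨P⟩ : Nonempty (Sylow p G) := inferInstance
  refine ⟨(MulAction.toPermHom G (Sylow p G)).ker, inferInstance, ?_, ?_⟩
  · rw [Subgroup.index_ker, ← Nat.card_perm]
    exact Subgroup.card_subgroup_dvd_card _
  · rw [P.card_eq_index_normalizer]
    apply Subgroup.index_dvd_of_le
    intro g hg
    rw [← Sylow.smul_eq_iff_mem_normalizer]
    have := congrArg (fun f => f P) (MonoidHom.mem_ker.mp hg)
    simpa using this

theorem case_36 {G : Type u} [Group G] [Finite G] (IH : IHyp G) (h : Nat.card G = 36) : Bd G := by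
  have : Fact (Nat.Prime 3) := ⟨by norm_num⟩
  have hs := syl_num 3 2 4 h (by decide)
  have : ∀ q ≤ 4, q ∣ 4 → q % 3 = 1 → q = 1 ∨ q = 4 := by decide
  rcases this _ (Nat.le_of_dvd (by omega) hs.1) hs.1 hs.2 with h1 | h1
  · exact R1syl IH 3 2 4 h (by decide) h1 (by decide) (by decide) (by decide)
  · obtain ⟨M, hM, ha, hb⟩ := syl_ker (G := G) 3
    rw [h1] at ha hb
    have he := M.index_mul_card
    rw [h] at he
    have hle := Nat.le_of_dvd (by decide) ha
    have h36 : M.index ∣ 36 := ⟨_, he.symm⟩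
    have key : ∀ i ≤ 24, i ∣ 24 → 4 ∣ i → i ∣ 36 → i = 4 ∨ i = 12 := by decide
    have : Nat.card M = 9 ∨ Nat.card M = 3 := by
      rcases key _ hle ha hb h36 with h | h <;> rw [h] at he <;> omega
    rcases this with h5 | h5
    · exact R1 IH M (by rw [h5]; decide) (by omega) (by omega)
    · exact R1 IH M (by rw [h5]; decide) (by omega) (by omega)



theorem case_2pow {G : Type u} [Group G] [Finite G] (IH : IHyp G) (j : ℕ) (hj : 2 ≤ j)
    (hc : Nat.card G = 2 ^ (j + 1)) : Bd G := by
  have h2 : Fact (Nat.Prime 2) := ⟨Nat.prime_two⟩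
  have h4j : 4 ≤ 2 ^ j := by
    calc 4 = 2 ^ 2 := rfl
      _ ≤ 2 ^ j := Nat.pow_le_pow_right (by norm_num) hj
  by_cases hcy : IsCyclic G
  · exact bd_cyclic (2 ^ j) (by omega) (by rw [hc, pow_succ, mul_comm])
  have hidx : ∀ H : Subgroup G, Nat.card H = 2 ^ j → H.index = 2 := by
    intro H hH
    have := H.card_mul_index
    rw [hH, hc, pow_succ] at this
    exact Nat.eq_of_mul_eq_mul_left (by omega) this
  have hdvd : 2 ^ j ∣ Nat.card G := by rw [hc]; exact pow_dvd_pow 2 (by omega)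
  obtain ⟨H1, hH1⟩ := Sylow.exists_subgroup_card_pow_prime (G := G) 2 hdvd
  have i1 := hidx H1 hH1
  obtain ⟨g, hg⟩ : ∃ g, g ∉ H1 := by
    by_contra hcon
    push Not at hcon
    rw [(Subgroup.eq_top_iff' H1).mpr hcon] at i1
    simp at i1
  obtain ⟨i, hi, hgi⟩ := (Nat.dvd_prime_pow Nat.prime_two).mp (hc ▸ orderOf_dvd_natCard g)
  have hij : i ≤ j := by
    by_contra hcon
    have : i = j + 1 := by omega
    exact hcy (isCyclic_of_orderOf_eq_card g (by rw [hgi, hc, this]))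
  obtain ⟨H2, hH2, hle⟩ := Sylow.exists_subgroup_card_pow_prime_le 2 hdvd (Subgroup.zpowers g)
    (by rw [Nat.card_zpowers, hgi]) hij
  have i2 := hidx H2 hH2
  have n1 := Subgroup.normal_of_index_eq_two i1
  have n2 := Subgroup.normal_of_index_eq_two i2
  have hgH2 : g ∈ H2 := hle (Subgroup.mem_zpowers g)
  have hM : (H1 ⊓ H2).index = 4 := by
    have a1 : (H1 ⊓ H2).index ≤ 4 := by
      have := Subgroup.index_inf_le (H := H1) (K := H2)
      rwa [i1, i2] at this
    have a2 := Subgroup.relIndex_mul_index (inf_le_right : H1 ⊓ H2 ≤ H2)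
    rw [i2] at a2
    have a3 : (H1 ⊓ H2).relIndex H2 ≠ 1 := by
      intro h
      rw [Subgroup.relIndex_eq_one] at h
      exact hg (h hgH2).1
    have a4 : (H1 ⊓ H2).index ≠ 0 := Subgroup.index_ne_zero_of_finite
    omega
  have hcM := (H1 ⊓ H2).index_mul_card
  rw [hM, hc] at hcM
  have hsq : ∀ x : G, x * x ∈ H1 ⊓ H2 := fun x =>
    ⟨Subgroup.mul_self_mem_of_index_two i1 x, Subgroup.mul_self_mem_of_index_two i2 x⟩
  by_cases hj2 : j = 2
  · subst hj2
    exact (CM_8 hc (H1 ⊓ H2) (by omega) hsq).bd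
  · have h8 : 8 ≤ 2 ^ j := by
      calc 8 = 2 ^ 3 := rfl
        _ ≤ 2 ^ j := Nat.pow_le_pow_right (by norm_num) (by omega)
    rw [pow_succ] at hcM
    refine R2 IH (H1 ⊓ H2) (CM_V4 hM ?_) (by omega) (by omega)
    intro x
    induction x using QuotientGroup.induction_on with
    | H x =>
      rw [← QuotientGroup.mk_mul, QuotientGroup.eq_one_iff]
      exact hsq x

theorem case_24 {G : Type u} [Group G] [Finite G] (IH : IHyp G) (h : Nat.card G = 24) : Bd G := by
  have : Fact (Nat.Prime 3) := ⟨by norm_num⟩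
  have : Fact (Nat.Prime 2) := ⟨by norm_num⟩
  have hs := syl_num 3 1 8 h (by decide)
  have key : ∀ q ≤ 8, q ∣ 8 → q % 3 = 1 → q = 1 ∨ q = 4 := by decide
  rcases key _ (Nat.le_of_dvd (by omega) hs.1) hs.1 hs.2 with h1 | h1
  · exact R1syl IH 3 1 8 h (by decide) h1 (by decide) (by decide) (by decide)
  have hs2 := syl_num 2 3 3 h (by decide)
  rcases (Nat.dvd_prime Nat.prime_three).mp hs2.1 with h2 | h2
  · obtain ⟨P⟩ : Nonempty (Sylow 2 G) := inferInstance
    have := syl_normal 2 h2 P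
    have hc := syl_card 2 3 3 h (by decide) P
    have hc1 : Nat.card (P : Subgroup G) = 2 ^ 3 := hc.1
    exact R2' IH (P : Subgroup G) (by rw [hc.2]; decide) (by omega) (by omega)
  obtain ⟨M, hM, ha, hb⟩ := syl_ker (G := G) 2
  rw [h2] at ha hb
  have he := M.index_mul_card
  rw [h] at he
  have hle := Nat.le_of_dvd (by decide) ha
  have key : ∀ i ≤ 6, i ∣ 6 → 3 ∣ i → i = 3 ∨ i = 6 := by decide
  rcases key _ hle ha hb with h3 | h3
  · exact R2' IH M (by rw [h3]; decide) (by omega) (by rw [h3] at he; omega)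
  have hcM : Nat.card M = 4 := by rw [h3] at he; omega
  by_cases hsq : ∀ x : M, x * x = 1
  · refine bd_of_sub_CM M (IH _ ?_ ?_) (CM_V4 hcM hsq)
    · change 3 ≤ M.index
      omega
    · change M.index < _
      omega
  exfalso
  push Not at hsq
  obtain ⟨⟨x, hxM⟩, hx⟩ := hsq
  have hxx : x * x ≠ 1 := fun h => hx (Subtype.ext h)
  have ho : orderOf x = 4 := by
    have d : orderOf x ∣ 2 ^ 2 := by
      have := orderOf_dvd_natCard (⟨x, hxM⟩ : M)
      rwa [hcM, Subgroup.orderOf_mk] at this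
    obtain ⟨i, hi, hi'⟩ := (Nat.dvd_prime_pow Nat.prime_two).mp d
    interval_cases i
    · exact absurd ((pow_two x).symm.trans (orderOf_dvd_iff_pow_eq_one.mp ((by rw [hi'] <;> decide) : orderOf x ∣ 2))) hxx
    · exact absurd ((pow_two x).symm.trans (orderOf_dvd_iff_pow_eq_one.mp ((by rw [hi'] <;> decide) : orderOf x ∣ 2))) hxx
    · exact hi'
  have x4 : x ^ 4 = 1 := ho ▸ pow_orderOf_eq_one x
  have hz : Subgroup.zpowers x = M :=
    Subgroup.eq_of_le_of_card_ge (Subgroup.zpowers_le.mpr hxM) (by rw [hcM, Nat.card_zpowers, ho])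
  have hconj : ∀ g : G, g * x * g⁻¹ = x ∨ g * x * g⁻¹ = x⁻¹ := by
    classical
    intro g
    have hm := hM.conj_mem x hxM g
    rw [← hz, mem_zpowers_iff_mem_range_orderOf, ho] at hm
    simp only [Finset.mem_image, Finset.mem_range] at hm
    obtain ⟨k, hk, hk'⟩ := hm
    have hcc : (g * x * g⁻¹) * (g * x * g⁻¹) ≠ 1 := by
      intro h
      apply hxx
      have : (g * x * g⁻¹) * (g * x * g⁻¹) = g * (x * x) * g⁻¹ := by group
      rw [this] at h
      simpa using h
    rw [← hk'] at hcc ⊢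
    interval_cases k
    · simp at hcc
    · left; simp
    · rw [← pow_add] at hcc; exact absurd x4 hcc
    · right; rw [eq_inv_iff_mul_eq_one, ← pow_succ]; exact x4
  have hfix : ∀ g : G, g ^ 3 = 1 → g * x = x * g := by
    intro g hg
    rcases hconj g with h | h
    · exact mul_inv_eq_iff_eq_mul.mp h
    · exfalso
      have e2 : g * x⁻¹ * g⁻¹ = x := by
        have := congrArg Inv.inv h
        simpa [mul_assoc] using this
      have e3 : g ^ 3 * x * (g ^ 3)⁻¹ = g * (g * (g * x * g⁻¹) * g⁻¹) * g⁻¹ := by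
        simp only [pow_succ, pow_zero, one_mul, mul_inv_rev, mul_assoc]
      rw [h, e2, h, hg] at e3
      simp only [one_mul, inv_one, mul_one] at e3
      apply hxx
      nth_rewrite 1 [e3]
      simp
  obtain ⟨P⟩ : Nonempty (Sylow 3 G) := inferInstance
  have hcP := (syl_card 3 1 8 h (by decide) P).1
  have hN := norm_eq 3 1 8 h (by decide) P
  rw [h1, h] at hN
  have hxN : x ∈ Subgroup.normalizer ((P : Subgroup G) : Set G) := by
    apply Subgroup.centralizer_le_normalizer
    rw [Subgroup.mem_centralizer_iff]
    intro y hy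
    apply hfix
    have := orderOf_dvd_natCard (⟨y, hy⟩ : (P : Subgroup G))
    rw [hcP, Subgroup.orderOf_mk] at this
    exact orderOf_dvd_iff_pow_eq_one.mp this
  have := orderOf_dvd_natCard (⟨x, hxN⟩ : Subgroup.normalizer ((P : Subgroup G) : Set G))
  rw [Subgroup.orderOf_mk, ho] at this
  omega

theorem half {G : Type u} [Group G] [Finite G] (m : ℕ) (hm : Odd m) (hc : Nat.card G = 2 * m) :
    ∃ N : Subgroup G, N.Normal ∧ N.index = 2 ∧ Nat.card N = m ∧ ∃ t, t ∉ N ∧ orderOf t = 2 := by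
  have : Fact (Nat.Prime 2) := ⟨by norm_num⟩
  obtain ⟨P⟩ : Nonempty (Sylow 2 G) := inferInstance
  have hs := syl_card 2 1 m (by rw [hc, pow_one]) (by rw [← even_iff_two_dvd]; simpa using hm) P
  have hcy : IsCyclic (P : Subgroup G) := isCyclic_of_prime_card (p := 2) hs.1
  obtain ⟨N, hN, h1, h2⟩ := burn 2 P (IsCyclic.normalizer_le_centralizer
    ((Nat.minFac_eq_two_iff _).mpr (by rw [hc]; exact ⟨m, rfl⟩)) hcy)
  rw [hs.2] at h2
  refine ⟨N, hN, h1.trans hs.1, h2, ?_⟩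
  obtain ⟨t, ht⟩ := exists_prime_orderOf_dvd_card' (G := G) 2 (by rw [hc]; exact ⟨m, rfl⟩)
  refine ⟨t, fun htN => ?_, ht⟩
  have := orderOf_dvd_natCard (⟨t, htN⟩ : N)
  rw [Subgroup.orderOf_mk, ht, h2, ← even_iff_two_dvd] at this
  exact (Nat.not_even_iff_odd.mpr hm) this

theorem char_R1 {G : Type u} [Group G] [Finite G] (IH : IHyp G) (m : ℕ) (hm : Odd m)
    (hc : Nat.card G = 2 * m) (N : Subgroup G) [N.Normal] (hN : Nat.card N = m) (K : Subgroup N)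
    (hK : K.Characteristic) (h1 : K ≠ ⊥) (h2 : K ≠ ⊤) : Bd G := by
  have e : Nat.card (K.map N.subtype) = Nat.card K :=
    Subgroup.card_map_of_injective N.subtype_injective
  have hi := K.index_mul_card
  have hi1 : K.index ≠ 1 := fun h => h2 (Subgroup.index_eq_one.mp h)
  have hi0 : K.index ≠ 0 := Subgroup.index_ne_zero_of_finite
  rw [hN] at hi
  have hodd : Odd (Nat.card K) := by
    rw [← hi] at hm
    exact (Nat.odd_mul.mp hm).2
  have hK1 : Nat.card K ≠ 1 := fun h => h1 (Subgroup.card_eq_one.mp h)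
  have hK0 : Nat.card K ≠ 0 := Nat.card_pos.ne'
  have : 2 ≤ K.index := by omega
  have h2K : 2 * Nat.card K ≤ m := by rw [← hi]; exact Nat.mul_le_mul_right _ this
  exact R1 IH (K.map N.subtype) (by rw [e]; exact hodd) (by rw [e]; omega) (by rw [e, hc]; omega)

theorem Rz {G : Type u} [Group G] [Finite G] (IH : IHyp G) (m : ℕ) (hm : Odd m)
    (hc : Nat.card G = 2 * m) (N : Subgroup G) (hN : Nat.card N = m) (w : G)
    (hw : w ∈ N) (hw1 : w ≠ 1) (hn : (Subgroup.zpowers w).Normal) : Bd G ∨ orderOf w = m := by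
  have hd : orderOf w ∣ m := by
    have := orderOf_dvd_natCard (⟨w, hw⟩ : N)
    rwa [Subgroup.orderOf_mk, hN] at this
  by_cases h : orderOf w = m
  · exact Or.inr h
  left
  have h1 : orderOf w ≠ 1 := fun h => hw1 (orderOf_eq_one_iff.mp h)
  have h0 : orderOf w ≠ 0 := (orderOf_pos w).ne'
  obtain ⟨c, hc'⟩ := hd
  have hodd : Odd (orderOf w) := by
    rw [hc'] at hm
    exact (Nat.odd_mul.mp hm).1
  have h2 : 2 ≤ c := by
    rcases c with _ | _ | c
    · rw [hc'] at hm; simp at hm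
    · simp at hc'; exact absurd hc'.symm h
    · omega
  have h2K : orderOf w * 2 ≤ m := by rw [hc']; exact Nat.mul_le_mul_left _ h2
  exact R1 IH (Subgroup.zpowers w) (by rw [Nat.card_zpowers]; exact hodd)
    (by rw [Nat.card_zpowers]; omega) (by rw [Nat.card_zpowers]; omega)

theorem case_ab {G : Type u} [Group G] [Finite G] (IH : IHyp G) (m : ℕ) (hm : Odd m) (hm3 : 3 ≤ m)
    (hc : Nat.card G = 2 * m) (N : Subgroup G) [hNn : N.Normal] (hi : N.index = 2)
    (hN : Nat.card N = m)
    (t : G) (htN : t ∉ N) (ht : orderOf t = 2) (hab : ∀ x ∈ N, ∀ y ∈ N, x * y = y * x) : Bd G := by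
  have htt : t * t = 1 := by rw [← pow_two, ← ht]; exact pow_orderOf_eq_one t
  have htinv : t⁻¹ = t := inv_eq_of_mul_eq_one_left htt
  have hdec : ∀ g : G, g ∈ N ∨ ∃ n ∈ N, g = n * t := by
    intro g
    by_cases hg : g ∈ N
    · exact Or.inl hg
    · right
      refine ⟨g * t, ?_, by rw [mul_assoc, htt, mul_one]⟩
      rw [Subgroup.mul_mem_iff_of_index_two hi]
      exact ⟨fun h => absurd h hg, fun h => absurd h htN⟩
  by_cases hex : ∃ v ∈ N, v * (t * v * t⁻¹) ≠ 1
  · obtain ⟨v, hv, hw1⟩ := hex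
    have hv' := hNn.conj_mem v hv t
    have hw := N.mul_mem hv hv'
    have hwt : t * (v * (t * v * t⁻¹)) = v * (t * v * t⁻¹) * t := by
      calc t * (v * (t * v * t⁻¹)) = t * (t * v * t⁻¹ * v) := by rw [hab v hv _ hv']
        _ = (t * t) * v * t⁻¹ * v := by group
        _ = v * t * v := by rw [htt, htinv, one_mul]
        _ = _ := by group
    set w := v * (t * v * t⁻¹) with hwdef
    have hcen : ∀ g, g * w = w * g := by
      intro g
      rcases hdec g with hg | ⟨n, hn, rfl⟩
      · exact hab _ hg _ hw
      · rw [mul_assoc, hwt, ← mul_assoc, hab _ hn _ hw, mul_assoc]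
    have hnor : (Subgroup.zpowers w).Normal := by
      constructor
      intro x hx g
      obtain ⟨k, rfl⟩ := Subgroup.mem_zpowers_iff.mp hx
      have : g * w ^ k * g⁻¹ = w ^ k := by
        rw [mul_inv_eq_iff_eq_mul]
        exact ((show Commute g w from hcen g).zpow_right k)
      rw [this]; exact hx
    rcases Rz IH m hm hc N hN w hw hw1 hnor with h | h
    · exact h
    · have ho : orderOf (w * t) = Nat.card G := by
        rw [Commute.orderOf_mul_eq_mul_orderOf_of_coprime (show Commute w t from (hcen t).symm), h, ht,
          hc, mul_comm]
        rw [h, ht]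
        exact Nat.coprime_two_right.mpr hm
      have := isCyclic_of_orderOf_eq_card _ ho
      exact bd_cyclic m (by omega) hc
  · push Not at hex
    have hinv : ∀ v ∈ N, t * v * t⁻¹ = v⁻¹ := fun v hv => eq_inv_of_mul_eq_one_right (hex v hv)
    have hntr : Nontrivial N := by
      rw [← Finite.one_lt_card_iff_nontrivial, hN]; omega
    obtain ⟨⟨v, hv⟩, hv1⟩ := exists_ne (1 : N)
    have hv1' : v ≠ 1 := fun h => hv1 (Subtype.ext h)
    have hle : Subgroup.zpowers v ≤ N := Subgroup.zpowers_le.mpr hv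
    have hnor : (Subgroup.zpowers v).Normal := by
      constructor
      intro x hx g
      have hxN := hle hx
      rcases hdec g with hg | ⟨n, hn, rfl⟩
      · rw [mul_inv_eq_iff_eq_mul.mpr (hab g hg x hxN)]; exact hx
      · have : n * t * x * (n * t)⁻¹ = n * (t * x * t⁻¹) * n⁻¹ := by group
        rw [this, hinv x hxN, mul_inv_eq_iff_eq_mul.mpr (hab n hn x⁻¹ (N.inv_mem hxN))]
        exact Subgroup.inv_mem _ hx
    rcases Rz IH m hm hc N hN v hv hv1' hnor with h | h
    · exact h
    · obtain ⟨k, rfl⟩ := hm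
      exact bd_dihedral k (by omega) hc v t h htt (fun h => htN (hle h)) (hinv v hv)


theorem case_2m {G : Type u} [Group G] [Finite G] (IH : IHyp G) (m : ℕ) (hm : Odd m) (hm3 : 3 ≤ m)
    (hc : Nat.card G = 2 * m)
    (hs : (∃ p k, p.Prime ∧ m = p ^ k) ∨ m = 15 ∨ m = 21) : Bd G := by
  obtain ⟨N, hNn, hi, hN, t, htN, ht⟩ := half m hm hc
  have aux : ∀ p : ℕ, p.Prime → m = p ^ 1 * 3 → ¬ p ∣ 3 → (∀ q ≤ 3, q ∣ 3 → q % p = 1 → q = 1) → Bd G := by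
    intro p hp hmp h3 hq
    have : Fact p.Prime := ⟨hp⟩
    rw [hmp] at hN
    have hn := syl_num (G := N) p 1 3 hN h3
    obtain ⟨P⟩ : Nonempty (Sylow p N) := inferInstance
    have hP := syl_normal p (hq _ (Nat.le_of_dvd (by omega) hn.1) hn.1 hn.2) P
    have hcP := syl_card p 1 3 hN h3 P
    refine char_R1 IH m hm hc N (hN.trans hmp.symm) (P : Subgroup N) (P.characteristic_of_normal hP) ?_ ?_
    · intro h
      have h1 : Nat.card (P : Subgroup N) = p ^ 1 := hcP.1
      rw [h] at h1
      simp at h1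
      exact hp.one_lt.ne h1
    · intro h
      have := hcP.2
      rw [h] at this
      simp at this
  rcases hs with ⟨p, k, hp, hmk⟩ | h | h
  · have : Fact p.Prime := ⟨hp⟩
    have hpg : IsPGroup p N := IsPGroup.of_card (hN.trans hmk)
    have hntr : Nontrivial N := by
      rw [← Finite.one_lt_card_iff_nontrivial, hN]; omega
    have hcn := hpg.center_nontrivial
    by_cases hct : Subgroup.center N = ⊤
    · refine case_ab IH m hm hm3 hc N hi hN t htN ht ?_
      intro x hx y hy
      have : (⟨y, hy⟩ : N) ∈ Subgroup.center N := by rw [hct]; trivial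
      exact congrArg Subtype.val (Subgroup.mem_center_iff.mp this ⟨x, hx⟩)
    · exact char_R1 IH m hm hc N hN (Subgroup.center N) inferInstance
        ((Subgroup.nontrivial_iff_ne_bot _).mp hcn) hct
  · exact aux 5 (by norm_num) h (by decide) (by decide)
  · exact aux 7 (by norm_num) h (by decide) (by decide)

theorem bd_all (n : ℕ) : ∀ (G : Type u) [Group G] [Finite G], Nat.card G = n → 3 ≤ n → Bd G := by
  induction n using Nat.strong_induction_on with
  | _ n ih =>
  intro G _ _ hc h3
  have IH : IHyp G := fun H _ _ h1 h2 => ih (Nat.card H) (hc ▸ h2) H rfl h1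
  rcases Nat.even_or_odd (Nat.card G) with he | ho
  swap
  · exact (CM_of_odd ho).bd
  by_cases hL : Nat.card G ∈ excL
  swap
  · exact main_large he hL
  have P : ∀ m p k : ℕ, p.Prime → m = p ^ k → Odd m → 3 ≤ m → Nat.card G = 2 * m → Bd G :=
    fun m p k hp hm h1 h2 h3 => case_2m IH m h1 h2 h3 (Or.inl ⟨p, k, hp, hm⟩)
  simp only [excL, List.mem_cons, List.not_mem_nil, or_false] at hL
  rcases hL with h | h | h | h | h | h | h | h | h | h | h | h | h | h | h | h | h | h | h | h | h | h
  · omega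
  · exact P 3 3 1 (by norm_num) (by norm_num) (by decide) (by norm_num) h
  · exact case_2pow IH 2 (by norm_num) h
  · exact P 5 5 1 (by norm_num) (by norm_num) (by decide) (by norm_num) h
  · exact case_list1 IH (by omega)
  · exact P 7 7 1 (by norm_num) (by norm_num) (by decide) (by norm_num) h
  · exact case_2pow IH 3 (by norm_num) h
  · exact P 9 3 2 (by norm_num) (by norm_num) (by decide) (by norm_num) h
  · exact case_list1 IH (by omega)
  · exact P 11 11 1 (by norm_num) (by norm_num) (by decide) (by norm_num) h
  · exact case_24 IH h
  · exact P 13 13 1 (by norm_num) (by norm_num) (by decide) (by norm_num) h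
  · exact case_list1 IH (by omega)
  · exact case_2m IH 15 (by decide) (by norm_num) h (by simp)
  · exact case_2pow IH 4 (by norm_num) h
  · exact P 17 17 1 (by norm_num) (by norm_num) (by decide) (by norm_num) h
  · exact case_36 IH h
  · exact case_list1 IH (by omega)
  · exact case_2m IH 21 (by decide) (by norm_num) h (by simp)
  · exact case_list1 IH (by omega)
  · exact P 25 5 2 (by norm_num) (by norm_num) (by decide) (by norm_num) h
  · exact case_list1 IH (by omega)

theorem chromatic_le_three_halves {G : Type*} [Group G] [Fintype G]
    (hn : 3 ≤ Fintype.card G) :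
    2 * (cayleyGraph G).chromaticNumber ≤ ((3 * Fintype.card G : ℕ) : ℕ∞) := by
  obtain ⟨k, hk, h⟩ := bd_all _ G rfl (by rw [Nat.card_eq_fintype_card]; exact hn)
  rw [Nat.card_eq_fintype_card] at h
  calc 2 * (cayleyGraph G).chromaticNumber ≤ 2 * (k : ℕ∞) :=
        mul_le_mul_right hk.chromaticNumber_le 2
    _ ≤ _ := by exact_mod_cast h
end

section
/- Let n₁, n₂, …, n_k be positive integers whose product n = n₁·n₂·…·n_k is odd, let G = ZMod n₁ × ZMod n₂ × … × ZMod n_k, and enumerate G = {g₀, g₁, …, g_{n−1}} lexicographically. If s is a positive integer with gcd(s+1, n) = 1, then for every c, d ∈ {0, 1, …, n−1}, the map φ : G → G defined by φ(g_i) = g_{(i+c) mod n} + g_{(s·i+d) mod n} is injective. -/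
def mixV : (k : ℕ) → (Fin k → ℕ) → (Fin k → ℕ) → ℕ
  | 0, _, _ => 0
  | k + 1, nv, x => x 0 * (∏ i : Fin k, nv i.succ) + mixV k (fun i => nv i.succ) (fun i => x i.succ)

lemma mixV_lt : ∀ (k : ℕ) (nv x : Fin k → ℕ), (∀ i, x i < nv i) → mixV k nv x < ∏ i, nv i
  | 0, _, _, _ => by simp [mixV]
  | k + 1, nv, x, h => by
    have ih := mixV_lt k (fun i => nv i.succ) (fun i => x i.succ) (fun i => h _)
    rw [Fin.prod_univ_succ, mixV]
    have h0 := h 0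
    nlinarith

lemma mixV_lex : ∀ (k : ℕ) (nv x y : Fin k → ℕ), (∀ i, x i < nv i) → (∀ i, y i < nv i) →
    (∃ l : Fin k, (∀ m : Fin k, m < l → x m = y m) ∧ x l < y l) → mixV k nv x < mixV k nv y
  | 0, _, _, _, _, _, ⟨l, _⟩ => l.elim0
  | k + 1, nv, x, y, hx, hy, ⟨l, hl, hlt⟩ => by
    rw [mixV, mixV]
    induction l using Fin.cases with
    | zero =>
      have := mixV_lt k (fun i => nv i.succ) (fun i => x i.succ) (fun i => hx _)
      nlinarith
    | succ l =>
      have := mixV_lex k (fun i => nv i.succ) (fun i => x i.succ) (fun i => y i.succ)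
        (fun i => hx _) (fun i => hy _)
        ⟨l, fun m hm => hl _ (Fin.succ_lt_succ_iff.mpr hm), hlt⟩
      rw [hl 0 (Fin.succ_pos l)]
      omega

lemma eq_of_dvd_lt (N a b : ℕ) (ha : a < N) (hb : b < N) (h : (N : ℤ) ∣ (a : ℤ) - b) :
    a = b := by
  have := (Nat.modEq_iff_dvd (n := N) (a := b) (b := a)).mpr h
  exact (Nat.ModEq.eq_of_lt_of_lt this hb ha).symm

lemma mixV_digit (n0 N p p' v v' : ℕ) (a t u : ℤ) (hN : 0 < N) (hv : v < N) (hv' : v' < N)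
    (h : ((n0 * N : ℕ) : ℤ) ∣ ((p * N + v : ℕ) : ℤ) - a)
    (h' : ((n0 * N : ℕ) : ℤ) ∣ ((p' * N + v' : ℕ) : ℤ) - (a + t)) (ht : t = N * u) :
    (n0 : ℤ) ∣ (p' : ℤ) - p - u := by
  have h1 := dvd_sub h' h
  push_cast at h1
  have hvv : v' = v := by
    apply eq_of_dvd_lt N _ _ hv' hv
    have h2 : (N : ℤ) ∣ _ := (Dvd.intro_left _ rfl).trans h1
    have h3 : (N : ℤ) ∣ N * ((p' : ℤ) - p - u) := Dvd.intro _ rfl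
    convert dvd_sub h2 h3 using 1
    · rfl
    · rw [ht]; ring
  subst hvv
  have : (N : ℤ) ≠ 0 := by positivity
  apply Int.dvd_of_mul_dvd_mul_right this
  convert h1 using 1
  · rfl
  · rw [ht]; ring

lemma mixV_key (s : ℕ) : ∀ (k : ℕ) (nv x y x' y' : Fin k → ℕ),
    (∀ i, x i < nv i) → (∀ i, y i < nv i) → (∀ i, x' i < nv i) → (∀ i, y' i < nv i) →
    Nat.Coprime (s + 1) (∏ i, nv i) →
    ∀ a b t : ℤ, ((∏ i, nv i : ℕ) : ℤ) ∣ (mixV k nv x : ℤ) - a →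
      ((∏ i, nv i : ℕ) : ℤ) ∣ (mixV k nv y : ℤ) - b →
      ((∏ i, nv i : ℕ) : ℤ) ∣ (mixV k nv x' : ℤ) - (a + t) →
      ((∏ i, nv i : ℕ) : ℤ) ∣ (mixV k nv y' : ℤ) - (b + s * t) →
      (∀ i, (nv i : ℤ) ∣ (x' i + y' i : ℤ) - (x i + y i)) →
      ((∏ i, nv i : ℕ) : ℤ) ∣ t
  | 0, _, _, _, _, _, _, _, _, _, _ => by simp
  | k + 1, nv, x, y, x', y', hx, hy, hx', hy', hco => by
    intro a b t ha hb ha' hb' hd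
    rw [Fin.prod_univ_succ] at *
    have l1 := mixV_lt k (fun i => nv i.succ) (fun i => x i.succ) (fun i => hx _)
    have l2 := mixV_lt k (fun i => nv i.succ) (fun i => y i.succ) (fun i => hy _)
    have l3 := mixV_lt k (fun i => nv i.succ) (fun i => x' i.succ) (fun i => hx' _)
    have l4 := mixV_lt k (fun i => nv i.succ) (fun i => y' i.succ) (fun i => hy' _)
    have ih := mixV_key s k (fun i => nv i.succ) (fun i => x i.succ) (fun i => y i.succ)
      (fun i => x' i.succ) (fun i => y' i.succ) (fun i => hx _) (fun i => hy _) (fun i => hx' _)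
      (fun i => hy' _) (Nat.Coprime.coprime_mul_left_right hco) a b t
    simp only [mixV] at *
    generalize mixV k (fun i => nv i.succ) (fun i => x i.succ) = vx at *
    generalize mixV k (fun i => nv i.succ) (fun i => y i.succ) = vy at *
    generalize mixV k (fun i => nv i.succ) (fun i => x' i.succ) = vx' at *
    generalize mixV k (fun i => nv i.succ) (fun i => y' i.succ) = vy' at *
    generalize (∏ i : Fin k, nv i.succ) = N at *
    have red : ∀ (p v : ℕ) (c : ℤ), ((nv 0 * N : ℕ) : ℤ) ∣ ((p * N + v : ℕ) : ℤ) - c →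
        (N : ℤ) ∣ (v : ℤ) - c := by
      intro p v c h
      have h2 : (N : ℤ) ∣ _ := (Dvd.intro_left (nv 0 : ℤ) (by push_cast; rfl)).trans h
      have h3 : (N : ℤ) ∣ (p : ℤ) * N := Dvd.intro_left _ rfl
      convert dvd_sub h2 h3 using 1
      · rfl
      · push_cast; ring
    obtain ⟨u, hu⟩ := ih (red _ _ _ ha) (red _ _ _ hb) (red _ _ _ ha') (red _ _ _ hb')
      (fun i => hd _)
    have hN : 0 < N := by omega
    have e1 := mixV_digit _ _ _ _ _ _ _ _ _ hN l1 l3 ha ha' hu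
    have e2 := mixV_digit _ _ _ _ _ _ _ _ (s * u) hN l2 l4 hb hb' (by rw [hu]; ring)
    have e3 := dvd_sub (hd 0) (dvd_add e1 e2)
    have e4 : (nv 0 : ℤ) ∣ ((s + 1 : ℕ) : ℤ) * u := by
      convert e3 using 1
      · rfl
      · push_cast; ring
    have hc : IsCoprime (nv 0 : ℤ) ((s + 1 : ℕ) : ℤ) :=
      (Nat.isCoprime_iff_coprime.mpr (Nat.Coprime.coprime_mul_right_right hco)).symm
    have e5 := hc.dvd_of_dvd_mul_left e4
    rw [hu, mul_comm (nv 0)]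
    push_cast
    exact mul_dvd_mul_left _ e5

theorem tech_lemma {k : ℕ} (nv : Fin k → ℕ) (hpos : ∀ i, 0 < nv i)
    (n : ℕ) (hn : n = ∏ i, nv i) (hodd : Odd n)
    (g : Fin n → ((i : Fin k) → ZMod (nv i)))
    (hbij : Function.Bijective g)
    (hlex : ∀ i j : Fin n, i < j ↔
      ∃ l : Fin k, (∀ m : Fin k, m < l → g i m = g j m) ∧ (g i l).val < (g j l).val)
    (s : ℕ) (hs : 0 < s) (hgcd : Nat.gcd (s + 1) n = 1)
    (c d : ℕ) (hc : c < n) (hd : d < n) :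
    Function.Injective fun i : Fin n =>
      g ⟨((i : ℕ) + c) % n, Nat.mod_lt _ i.pos⟩ +
        g ⟨(s * (i : ℕ) + d) % n, Nat.mod_lt _ i.pos⟩ := by
  have : ∀ i, NeZero (nv i) := fun i => ⟨(hpos i).ne'⟩
  have hlt : ∀ (i : Fin n) (l : Fin k), (g i l).val < nv l := fun i l => ZMod.val_lt _
  let F : Fin n → Fin n := fun i =>
    ⟨mixV k nv (fun l => (g i l).val), by rw [hn]; exact mixV_lt _ _ _ (hlt i)⟩
  have hF : StrictMono F := by
    intro i j hij
    obtain ⟨l, hl, hl'⟩ := (hlex i j).mp hij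
    exact mixV_lex k nv _ _ (hlt i) (hlt j) ⟨l, fun m hm => by rw [hl m hm], hl'⟩
  have hFid : ∀ i, F i = i := fun i => le_antisymm hF.apply_le hF.le_apply
  have hval : ∀ i : Fin n, mixV k nv (fun l => (g i l).val) = i := fun i =>
    congrArg Fin.val (hFid i)
  have hmod : ∀ (e : ℕ) (h : e % n < n),
      ((∏ i, nv i : ℕ) : ℤ) ∣ (mixV k nv (fun l => (g ⟨e % n, h⟩ l).val) : ℤ) - e := by
    intro e h
    rw [hval, ← hn]
    exact (Nat.modEq_iff_dvd (n := n) (a := e) (b := e % n)).mp (Nat.mod_modEq e n).symm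
  intro i j hij
  simp only at hij
  have key := mixV_key s k nv _ _ _ _ (hlt ⟨((i : ℕ) + c) % n, Nat.mod_lt _ i.pos⟩)
    (hlt ⟨(s * (i : ℕ) + d) % n, Nat.mod_lt _ i.pos⟩)
    (hlt ⟨((j : ℕ) + c) % n, Nat.mod_lt _ i.pos⟩)
    (hlt ⟨(s * (j : ℕ) + d) % n, Nat.mod_lt _ i.pos⟩) (by rw [← hn]; exact hgcd)
    ((i + c : ℕ) : ℤ) ((s * i + d : ℕ) : ℤ) ((j : ℤ) - i) (hmod _ _) (hmod _ _)
    (by convert hmod ((j : ℕ) + c) (Nat.mod_lt _ i.pos) using 2; push_cast; ring)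
    (by convert hmod (s * (j : ℕ) + d) (Nat.mod_lt _ i.pos) using 2; push_cast; ring)
    (by
      intro l
      have := congrFun hij l
      simp only [Pi.add_apply] at this
      rw [← ZMod.intCast_zmod_eq_zero_iff_dvd]
      push_cast
      simp only [ZMod.natCast_val, ZMod.cast_id', id]
      rw [this, sub_self])
  rw [← hn] at key
  exact (Fin.ext (eq_of_dvd_lt n j i j.2 i.2 key)).symm
end

section
/- Let n ≥ 3 and let M_n denote the Möbius ladder of order 2n, i.e., the circulant graph on vertex set ZMod (2n) in which x and y are adjacent if and only if y − x ∈ {1, −1, n}. If u, v ∈ ZMod (2n) form a near-antipodal pair, i.e., v − u = n − 1 or v − u = n + 1 in ZMod (2n), then the induced subgraph of M_n on the vertex set ZMod (2n) \ {u, v} is bipartite. -/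
/-- The Möbius ladder of order `2 * n`: the circulant graph on `ZMod (2 * n)` in which
`x` and `y` are adjacent iff `y - x ∈ {1, -1, n}`. -/
def mobiusLadder (n : ℕ) : SimpleGraph (ZMod (2 * n)) :=
  SimpleGraph.fromRel fun x y =>
    y - x = 1 ∨ y - x = -1 ∨ y - x = (n : ZMod (2 * n))

theorem mobius_aux (n : ℕ) (hn : 3 ≤ n) (u v : ZMod (2 * n))
    (huv : v = u + ((n - 1 : ℕ) : ZMod (2 * n))) :
    ((mobiusLadder n).induce {x | x ≠ u ∧ x ≠ v}).Colorable 2 := by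
  haveI : NeZero (2 * n) := ⟨by omega⟩
  have key : ∀ x y : ZMod (2 * n), ∀ k : ℕ, k < 2 * n → y - x = (k : ZMod (2 * n)) →
      (y - u).val = (x - u).val + k ∨ (y - u).val + 2 * n = (x - u).val + k := by
    intro x y k hk h
    have e : y - u = (x - u) + (k : ZMod (2 * n)) := by rw [← h]; ring
    have h1 : (y - u).val = ((x - u).val + k) % (2 * n) := by
      rw [e, ZMod.val_add, ZMod.val_natCast, Nat.mod_eq_of_lt hk]
    have h2 := ZMod.val_lt (x - u)
    rcases lt_or_ge ((x - u).val + k) (2 * n) with h3 | h3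
    · left; rw [h1, Nat.mod_eq_of_lt h3]
    · right
      rw [h1, Nat.mod_eq_sub_mod h3, Nat.mod_eq_of_lt (by omega)]; omega
  have hu : ∀ x : ZMod (2 * n), x ≠ u → (x - u).val ≠ 0 := by
    intro x hx h
    exact hx (sub_eq_zero.1 ((ZMod.val_eq_zero _).1 h))
  have hv : ∀ x : ZMod (2 * n), x ≠ v → (x - u).val ≠ n - 1 := by
    intro x hx h
    apply hx
    rw [huv, ← h, ZMod.natCast_zmod_val]; ring
  let c : ZMod (2 * n) → Bool := fun x =>
    if (x - u).val < n then decide ((x - u).val % 2 = 0)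
    else decide (((x - u).val + n + 1) % 2 = 0)
  have main : ∀ x y : ZMod (2 * n), x ≠ u → x ≠ v → y ≠ u → y ≠ v →
      (y - x = 1 ∨ y - x = -1 ∨ y - x = (n : ZMod (2 * n))) → c x ≠ c y := by
    intro x y hxu hxv hyu hyv h
    have a1 := hu x hxu
    have a2 := hv x hxv
    have a3 := hu y hyu
    have a4 := hv y hyv
    have a5 := ZMod.val_lt (x - u)
    have a6 := ZMod.val_lt (y - u)
    have h' : ((y - u).val = (x - u).val + 1 ∨ (y - u).val + 2 * n = (x - u).val + 1) ∨
        ((x - u).val = (y - u).val + 1 ∨ (x - u).val + 2 * n = (y - u).val + 1) ∨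
        ((y - u).val = (x - u).val + n ∨ (y - u).val + 2 * n = (x - u).val + n) := by
      rcases h with h | h | h
      · exact Or.inl (key x y 1 (by omega) (by simpa using h))
      · refine Or.inr (Or.inl (key y x 1 (by omega) ?_))
        rw [← neg_sub, h]; simp
      · exact Or.inr (Or.inr (key x y n (by omega) h))
    simp only [c]
    generalize (x - u).val = s at *
    generalize (y - u).val = t at *
    intro hc
    split_ifs at hc <;> rw [decide_eq_decide] at hc <;> omega
  have col : ((mobiusLadder n).induce {x | x ≠ u ∧ x ≠ v}).Coloring Bool := by
    refine SimpleGraph.Coloring.mk (fun x => c x.1) ?_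
    rintro ⟨x, hx⟩ ⟨y, hy⟩ h
    have h2 : (mobiusLadder n).Adj x y := h
    rw [mobiusLadder, SimpleGraph.fromRel_adj] at h2
    rcases h2.2 with h3 | h3
    · exact main x y hx.1 hx.2 hy.1 hy.2 h3
    · exact (main y x hy.1 hy.2 hx.1 hx.2 h3).symm
  simpa using col.colorable

theorem mobius_minus_near_antipodal_bipartite (n : ℕ) (hn : 3 ≤ n)
    (u v : ZMod (2 * n))
    (huv : v - u = (n : ZMod (2 * n)) - 1 ∨ v - u = (n : ZMod (2 * n)) + 1) :
    ((mobiusLadder n).induce {x | x ≠ u ∧ x ≠ v}).Colorable 2 := by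
  have hc : ((n - 1 : ℕ) : ZMod (2 * n)) = (n : ZMod (2 * n)) - 1 := by
    rw [Nat.cast_sub (by omega)]; simp
  rcases huv with h | h
  · apply mobius_aux n hn u v
    rw [hc, ← h]; ring
  · have h0 : (n : ZMod (2 * n)) + n = 0 := by
      have := ZMod.natCast_self (2 * n)
      push_cast at this
      rw [← this]; ring
    have := mobius_aux n hn v u (by
      rw [hc]
      linear_combination -h + (-1 : ZMod (2 * n)) * h0)
    have e : {x : ZMod (2 * n) | x ≠ u ∧ x ≠ v} = {x | x ≠ v ∧ x ≠ u} := by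
      ext x; exact and_comm
    rw [e]; exact this
end
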